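/- There exist constants b > 0 and C > 0 such that the following holds. Let k be an even nonzero integer and x ≥ 3 with log|k| ≤ b·√(log x), and let p ↦ ρ_p be any function assigning to each prime p ≡ ±1 (mod 8) a totally positive element ρ_p ∈ ℤ[√2] with N(ρ_p) = p. Then Σ_{p ≤ x, p ≡ ±1 (mod 8)} |cos( (πk/(4·log ε)) · log(ρ_p/σ(ρ_p)) )| / p ≤ (1/π)·log log x + (1 − 2/π)·log log|k| + C. (The summand does not depend on the choice of ρ_p.) -/

import Mathlib

noncomputable section

/-- `ℤ[√2]`, the ring of integers of `ℚ(√2)`. -/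
abbrev Zrt2 := Zsqrtd 2

/-- The real embedding `u + v√2 ↦ u + v·√2`. -/
def toR (z : Zrt2) : ℝ := z.re + z.im * Real.sqrt 2

/-- The Galois conjugation `σ(u + v√2) = u − v√2`. -/
def sigma (z : Zrt2) : Zrt2 := ⟨z.re, -z.im⟩

namespace SqrtTwo

/-- A completely multiplicative function, seen as an arithmetic function. -/
def toArith (u : ℕ →*₀ ℂ) : ArithmeticFunction ℂ := ⟨u, map_zero u⟩

@[simp] lemma toArith_apply (u : ℕ →*₀ ℂ) (n : ℕ) : toArith u n = u n := rfl

/-- The restriction of `u` to the integers divisible by no prime of `s`. -/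
def sift (s : Finset ℕ) (u : ℕ →*₀ ℂ) : ℕ →*₀ ℂ where
  toFun n := if ∀ p ∈ s, p.Prime → ¬ p ∣ n then u n else 0
  map_zero' := by simp
  map_one' := by
    rw [if_pos, map_one]
    intro p _ hp h
    exact hp.one_lt.ne' (Nat.dvd_one.mp h)
  map_mul' m n := by
    by_cases hm : ∀ p ∈ s, p.Prime → ¬ p ∣ m
    · by_cases hn : ∀ p ∈ s, p.Prime → ¬ p ∣ n
      · rw [if_pos hm, if_pos hn, if_pos, map_mul]
        intro p hp hpp h
        rcases (hpp.dvd_mul).mp h with h | h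
        · exact hm p hp hpp h
        · exact hn p hp hpp h
      · rw [if_neg hn, mul_zero, if_neg]
        intro h
        exact hn fun p hp hpp hd ↦ h p hp hpp (hd.mul_left m)
    · rw [if_neg hm, zero_mul, if_neg]
      intro h
      exact hm fun p hp hpp hd ↦ h p hp hpp (hd.mul_right n)

lemma sift_apply (s : Finset ℕ) (u : ℕ →*₀ ℂ) (n : ℕ) :
    sift s u n = if ∀ p ∈ s, p.Prime → ¬ p ∣ n then u n else 0 := rfl

lemma sift_prime (s : Finset ℕ) (u : ℕ →*₀ ℂ) {p : ℕ} (hp : p.Prime) :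
    sift s u p = if p ∈ s then 0 else u p := by
  rw [sift_apply]
  by_cases h : p ∈ s
  · rw [if_pos h, if_neg]
    intro h'
    exact h' p h hp dvd_rfl
  · rw [if_neg h, if_pos]
    intro q hq hqp hd
    exact h (((Nat.prime_dvd_prime_iff_eq hqp hp).mp hd) ▸ hq)

lemma sift_empty (u : ℕ →*₀ ℂ) : sift ∅ u = u := by
  ext n; simp [sift_apply]

lemma norm_sift_le (s : Finset ℕ) (u : ℕ →*₀ ℂ) (n : ℕ) : ‖sift s u n‖ ≤ ‖u n‖ := by
  rw [sift_apply]; split_ifs <;> simp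

/-- The indicator function of the positive integer `m`. -/
def single (m : ℕ) : ArithmeticFunction ℂ :=
  ⟨fun n ↦ if n = 0 then 0 else if n = m then 1 else 0, by simp⟩

lemma single_apply (m n : ℕ) : single m n = if n = 0 then 0 else if n = m then 1 else 0 := rfl

lemma single_mul_apply {p : ℕ} (hp : p ≠ 0) (w : ArithmeticFunction ℂ) (n : ℕ) :
    (single p * w) n = if p ∣ n then w (n / p) else 0 := by
  rcases eq_or_ne n 0 with rfl | hn
  · simp
  rw [ArithmeticFunction.mul_apply]
  split_ifs with h
  · obtain ⟨m, rfl⟩ := h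
    rw [Nat.mul_div_cancel_left _ (Nat.pos_of_ne_zero hp),
      Finset.sum_eq_single (p, m)]
    · simp [single_apply, hp]
    · rintro ⟨a, b⟩ hab hne
      rw [Nat.mem_divisorsAntidiagonal] at hab
      simp only [single_apply]
      rw [ite_eq_left_iff.mpr, zero_mul]
      intro _
      rw [if_neg]
      rintro rfl
      have hb : b = m := Nat.eq_of_mul_eq_mul_left (Nat.pos_of_ne_zero hp) hab.1
      exact hne (by rw [hb])
    · intro h
      exact absurd (Nat.mem_divisorsAntidiagonal.mpr ⟨rfl, hn⟩) h
  · refine Finset.sum_eq_zero ?_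
    rintro ⟨a, b⟩ hab
    rw [Nat.mem_divisorsAntidiagonal] at hab
    simp only [single_apply]
    rw [ite_eq_left_iff.mpr, zero_mul]
    intro _
    rw [if_neg]
    rintro rfl
    exact h ⟨b, hab.1.symm⟩

/-- The summatory function of an arithmetic function. -/
def psum (f : ArithmeticFunction ℂ) (x : ℝ) : ℂ := ∑ n ∈ Finset.Icc 1 ⌊x⌋₊, f n

lemma psum_single_mul {p : ℕ} (hp : p ≠ 0) (w : ArithmeticFunction ℂ) (x : ℝ) :
    psum (single p * w) x = psum w (x / p) := by
  have hp' := Nat.pos_of_ne_zero hp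
  simp only [psum, single_mul_apply hp, Nat.floor_div_natCast]
  rw [← Finset.sum_filter]
  refine Finset.sum_nbij' (fun n ↦ n / p) (fun m ↦ p * m) ?_ ?_ ?_ ?_ ?_
  · intro n hn
    simp only [Finset.mem_filter, Finset.mem_Icc] at hn ⊢
    exact ⟨Nat.div_pos (Nat.le_of_dvd (by lia) hn.2) hp', Nat.div_le_div_right hn.1.2⟩
  · intro m hm
    simp only [Finset.mem_filter, Finset.mem_Icc] at hm ⊢
    refine ⟨⟨Nat.mul_pos hp' (by lia), ?_⟩, dvd_mul_right _ _⟩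
    rw [mul_comm]; exact (Nat.le_div_iff_mul_le hp').mp hm.2
  · intro n hn
    simp only [Finset.mem_filter] at hn
    exact Nat.mul_div_cancel' hn.2
  · intro m _
    exact Nat.mul_div_cancel_left _ hp'
  · intro n _; rfl

lemma toArith_sift_insert (s : Finset ℕ) (u : ℕ →*₀ ℂ) {p : ℕ} (hp : p.Prime) :
    toArith (sift (insert p s) u) =
      toArith (sift s u) - sift s u p • (single p * toArith (sift s u)) := by
  ext n
  simp only [sub_eq_add_neg, ArithmeticFunction.add_apply, ArithmeticFunction.neg_apply,
    ArithmeticFunction.smul_map, smul_eq_mul, toArith_apply, single_mul_apply hp.ne_zero]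
  by_cases h : p ∣ n
  · obtain ⟨m, rfl⟩ := h
    rw [if_pos (dvd_mul_right _ _), Nat.mul_div_cancel_left _ hp.pos, map_mul (sift s u),
      add_neg_cancel, sift_apply, if_neg]
    intro h'
    exact h' p (Finset.mem_insert_self _ _) hp (dvd_mul_right _ _)
  · rw [if_neg h, mul_zero, neg_zero, add_zero, sift_apply, sift_apply]
    congr 1
    simp [h]

lemma psum_sub (f g : ArithmeticFunction ℂ) (x : ℝ) : psum (f - g) x = psum f x - psum g x := by
  simp [psum, sub_eq_add_neg, Finset.sum_add_distrib]

lemma psum_smul (c : ℂ) (f : ArithmeticFunction ℂ) (x : ℝ) : psum (c • f) x = c * psum f x := by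
  simp [psum, Finset.mul_sum]

lemma norm_psum_sift_mul_le {u : ℕ →*₀ ℂ} (hu : ∀ n, ‖u n‖ ≤ 1) {w : ArithmeticFunction ℂ}
    {A β : ℝ} (h : ∀ x : ℝ, 0 ≤ x → ‖psum (toArith u * w) x‖ ≤ A * x ^ β)
    (s : Finset ℕ) (hs : ∀ p ∈ s, p.Prime) {x : ℝ} (hx : 0 ≤ x) :
    ‖psum (toArith (sift s u) * w) x‖ ≤ A * (∏ p ∈ s, (1 + (p : ℝ) ^ (-β))) * x ^ β := by
  induction s using Finset.induction_on generalizing x with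
  | empty => simpa [sift_empty] using h x hx
  | insert p s hps ih =>
    have hp : p.Prime := hs p (Finset.mem_insert_self _ _)
    have ih' := fun {x : ℝ} ↦ ih (fun q hq ↦ hs q (Finset.mem_insert_of_mem hq)) (x := x)
    rw [toArith_sift_insert s u hp, sub_mul, smul_mul_assoc, mul_assoc, psum_sub, psum_smul,
      psum_single_mul hp.ne_zero, Finset.prod_insert hps]
    have hp0 : (0 : ℝ) < p := by exact_mod_cast hp.pos
    have h1 := ih' hx
    have h2 := ih' (div_nonneg hx hp0.le)
    rw [Real.div_rpow hx hp0.le, div_eq_mul_inv (x ^ β), ← Real.rpow_neg hp0.le] at h2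
    have h3 : ‖sift s u p‖ ≤ 1 := (norm_sift_le s u p).trans (hu p)
    calc _ ≤ _ := norm_sub_le _ _
      _ ≤ A * (∏ p ∈ s, (1 + (p : ℝ) ^ (-β))) * x ^ β +
          1 * (A * (∏ p ∈ s, (1 + (p : ℝ) ^ (-β))) * (x ^ β * (p : ℝ) ^ (-β))) := by
        rw [norm_mul]
        gcongr
      _ = _ := by ring

lemma norm_psum_sift_mul_sift_le {u v : ℕ →*₀ ℂ} (hu : ∀ n, ‖u n‖ ≤ 1) (hv : ∀ n, ‖v n‖ ≤ 1)
    {A β : ℝ} (h : ∀ x : ℝ, 0 ≤ x → ‖psum (toArith u * toArith v) x‖ ≤ A * x ^ β)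
    (s : Finset ℕ) (hs : ∀ p ∈ s, p.Prime) {x : ℝ} (hx : 0 ≤ x) :
    ‖psum (toArith (sift s u) * toArith (sift s v)) x‖ ≤
      A * (∏ p ∈ s, (1 + (p : ℝ) ^ (-β))) ^ 2 * x ^ β := by
  have h1 : ∀ x : ℝ, 0 ≤ x → ‖psum (toArith v * toArith (sift s u)) x‖ ≤
      (A * (∏ p ∈ s, (1 + (p : ℝ) ^ (-β)))) * x ^ β := fun x hx ↦ by
    rw [mul_comm (toArith v)]
    exact norm_psum_sift_mul_le hu h s hs hx
  have h2 := norm_psum_sift_mul_le hv h1 s hs hx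
  rw [mul_comm (toArith (sift s u))]
  refine h2.trans (le_of_eq (by ring))

/-- Second-order recursion of a convolution of two completely multiplicative functions. -/
lemma toArith_mul_toArith_recursion (u v : ℕ →*₀ ℂ) {p : ℕ} (hp : p.Prime) {n : ℕ} (hn : p ∣ n) :
    (toArith u * toArith v) n = (u p + v p) * (toArith u * toArith v) (n / p) -
      u p * v p * (if p ∣ n / p then (toArith u * toArith v) (n / p / p) else 0) := by
  have hu := toArith_sift_insert ∅ u hp
  have hv := toArith_sift_insert ∅ v hp
  simp only [sift_empty] at hu hv
  have key : toArith (sift (insert p ∅) u) * toArith (sift (insert p ∅) v) =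
      toArith u * toArith v - (u p + v p) • (single p * (toArith u * toArith v)) +
        (u p * v p) • (single p * (single p * (toArith u * toArith v))) := by
    rw [hu, hv]
    have hC (c : ℂ) (X : ArithmeticFunction ℂ) : c • X = (c • 1) * X := (smul_one_mul c X).symm
    rw [hC (u p), hC (v p), hC (u p + v p), hC (u p * v p), add_smul, mul_smul, hC (u p) (v p • 1)]
    ring
  have h0 : (toArith (sift (insert p ∅) u) * toArith (sift (insert p ∅) v)) n = 0 := by
    rw [ArithmeticFunction.mul_apply]
    refine Finset.sum_eq_zero ?_
    rintro ⟨a, b⟩ hab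
    rw [Nat.mem_divisorsAntidiagonal] at hab
    rcases hp.dvd_mul.mp (hab.1 ▸ hn) with h | h
    · have : sift (insert p ∅) u a = 0 := by
        rw [sift_apply, if_neg]; intro h'; exact h' p (Finset.mem_insert_self _ _) hp h
      simp only [toArith_apply, this, zero_mul]
    · have : sift (insert p ∅) v b = 0 := by
        rw [sift_apply, if_neg]; intro h'; exact h' p (Finset.mem_insert_self _ _) hp h
      simp only [toArith_apply, this, mul_zero]
  rw [key] at h0
  simp only [sub_eq_add_neg, ArithmeticFunction.add_apply, ArithmeticFunction.neg_apply,
    ArithmeticFunction.smul_map, smul_eq_mul, single_mul_apply hp.ne_zero, if_pos hn] at h0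
  linear_combination h0

/-- The sum `∑ c(p) p^(-1-δ)` over all primes `p`. -/
def primeSum (c : ℕ → ℝ) (δ : ℝ) : ℝ := ∑' p : Nat.Primes, c p * ((p : ℕ) : ℝ) ^ (-(1 + δ))

lemma summable_primeSum {c : ℕ → ℝ} {B : ℝ} (hc : ∀ p, |c p| ≤ B) {δ : ℝ} (hδ : 0 < δ) :
    Summable fun p : Nat.Primes ↦ c p * ((p : ℕ) : ℝ) ^ (-(1 + δ)) := by
  have h : Summable fun p : Nat.Primes ↦ ((p : ℕ) : ℝ) ^ (-(1 + δ)) :=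
    Nat.Primes.summable_rpow.mpr (by linarith)
  refine Summable.of_norm_bounded (h.mul_left B) fun p ↦ ?_
  rw [norm_mul, Real.norm_eq_abs, Real.norm_eq_abs, abs_of_nonneg (a := _ ^ _) (by positivity)]
  gcongr
  exact hc p

lemma summable_natCast_rpow_mul {u : ℕ →*₀ ℂ} (hu : ∀ n, ‖u n‖ ≤ 1) {δ : ℝ} (hδ : 0 < δ) :
    LSeriesSummable u (1 + δ) := by
  refine LSeriesSummable_of_bounded_of_one_lt_re (m := 1) (fun n _ ↦ hu n) ?_
  simp [hδ]

lemma abs_log_norm_LSeries_sub_primeSum_le : ∃ C : ℝ, 0 ≤ C ∧ ∀ u : ℕ →*₀ ℂ, (∀ n, ‖u n‖ ≤ 1) →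
    ∀ δ : ℝ, 0 < δ → LSeries u (1 + δ) ≠ 0 ∧
      |Real.log ‖LSeries u (1 + δ)‖ - primeSum (fun p ↦ (u p).re) δ| ≤ C := by
  have hS2 : Summable fun p : Nat.Primes ↦ ((p : ℕ) : ℝ) ^ (-2 : ℝ) :=
    Nat.Primes.summable_rpow.mpr (by norm_num)
  refine ⟨∑' p : Nat.Primes, ((p : ℕ) : ℝ) ^ (-2 : ℝ), tsum_nonneg fun p ↦ by positivity, ?_⟩
  intro u hu δ hδ
  have hs : (1 + δ : ℂ) ≠ 0 := by
    intro h
    have := congrArg Complex.re h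
    simp at this
    linarith
  set f : ℕ →*₀ ℂ := u * riemannZetaSummandHom hs with hf
  have hfn (n : ℕ) : f n = u n * (n : ℂ) ^ (-(1 + δ) : ℂ) := rfl
  have hterm (n : ℕ) : LSeries.term u (1 + δ) n = f n := by
    rcases eq_or_ne n 0 with rfl | hn
    · simp
    · rw [LSeries.term_of_ne_zero hn, hfn, Complex.cpow_neg, div_eq_mul_inv]
  have hsum : Summable (‖f ·‖) := by
    have := (summable_natCast_rpow_mul hu hδ).norm
    simpa only [hterm] using this
  have hL : LSeries u (1 + δ) = ∑' n, f n := by simp only [LSeries, hterm]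
  have hE := EulerProduct.exp_tsum_primes_log_eq_tsum hsum
  rw [hL, ← hE]
  refine ⟨Complex.exp_ne_zero _, ?_⟩
  rw [Complex.norm_exp, Real.log_exp]
  have hnormf (p : Nat.Primes) : ‖f p‖ ≤ ((p : ℕ) : ℝ) ^ (-(1 + δ)) := by
    rw [hfn, norm_mul]
    have : ‖((p : ℕ) : ℂ) ^ (-(1 + δ) : ℂ)‖ = ((p : ℕ) : ℝ) ^ (-(1 + δ)) := by
      rw [Complex.norm_natCast_cpow_of_pos p.prop.pos]; simp
    rw [this]
    exact mul_le_of_le_one_left (by positivity) (hu p)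
  have hp1 (p : Nat.Primes) : (2 : ℝ) ≤ (p : ℕ) := by exact_mod_cast p.prop.two_le
  have hnormf1 (p : Nat.Primes) : ‖f p‖ ≤ ((p : ℕ) : ℝ) ^ (-1 : ℝ) :=
    (hnormf p).trans (Real.rpow_le_rpow_of_exponent_le (by linarith [hp1 p]) (by linarith))
  have hhalf (p : Nat.Primes) : ‖f p‖ ≤ 1 / 2 := by
    refine (hnormf1 p).trans ?_
    rw [Real.rpow_neg_one, one_div]
    exact inv_anti₀ (by norm_num) (hp1 p)
  have hsumlog : Summable fun p : Nat.Primes ↦ -Complex.log (1 - f p) :=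
    (hsum.of_norm.clog_one_sub.neg).subtype Nat.Prime
  have hdiff (p : Nat.Primes) :
      ‖(-Complex.log (1 - f p)).re - (u p).re * ((p : ℕ) : ℝ) ^ (-(1 + δ))‖ ≤
        ((p : ℕ) : ℝ) ^ (-2 : ℝ) := by
    have h1 : (u p).re * ((p : ℕ) : ℝ) ^ (-(1 + δ)) = (f p).re := by
      rw [hfn]
      have : ((p : ℕ) : ℂ) ^ (-(1 + δ) : ℂ) = ((((p : ℕ) : ℝ) ^ (-(1 + δ)) : ℝ) : ℂ) := by
        rw [Complex.ofReal_cpow (by positivity)]; simp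
      rw [this, Complex.re_mul_ofReal]
    have h2 : -Complex.log (1 - f p) = Complex.log (1 - f p)⁻¹ := by
      rw [Complex.log_inv]
      intro harg
      rw [Complex.arg_eq_pi_iff] at harg
      have h4 := (Complex.re_le_norm (f p)).trans (hhalf p)
      have h3 := harg.1
      rw [Complex.sub_re, Complex.one_re] at h3
      linarith
    have hlt : ‖f p‖ < 1 := (hhalf p).trans_lt (by norm_num)
    rw [h1, h2, ← Complex.sub_re, Real.norm_eq_abs]
    refine (Complex.abs_re_le_norm _).trans
      ((Complex.norm_log_one_sub_inv_sub_self_le hlt).trans ?_)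
    have h5 : (1 - ‖f p‖)⁻¹ ≤ 2 := by
      rw [inv_le_comm₀ (by linarith) (by norm_num)]; linarith [hhalf p]
    have h6 : ‖f p‖ ^ 2 ≤ ((p : ℕ) : ℝ) ^ (-2 : ℝ) := by
      calc ‖f p‖ ^ 2 ≤ (((p : ℕ) : ℝ) ^ (-1 : ℝ)) ^ 2 := by gcongr; exact hnormf1 p
        _ = _ := by rw [← Real.rpow_natCast, ← Real.rpow_mul (by positivity)]; norm_num
    nlinarith [sq_nonneg ‖f p‖]
  have hre : Summable fun p : Nat.Primes ↦ (-Complex.log (1 - f p)).re :=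
    (Complex.hasSum_re hsumlog.hasSum).summable
  have hc : Summable fun p : Nat.Primes ↦ (u p).re * ((p : ℕ) : ℝ) ^ (-(1 + δ)) :=
    summable_primeSum (c := fun p ↦ (u p).re) (B := 1)
      (fun p ↦ (Complex.abs_re_le_norm _).trans (hu p)) hδ
  rw [Complex.re_tsum hsumlog, primeSum, ← hre.tsum_sub hc]
  exact tsum_of_norm_bounded hS2.hasSum hdiff

/-- The completely multiplicative function equal to `1` on all positive integers. -/
def oneHom : ℕ →*₀ ℂ where
  toFun n := if n = 0 then 0 else 1
  map_zero' := by simp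
  map_one' := by simp
  map_mul' m n := by by_cases hm : m = 0 <;> by_cases hn : n = 0 <;> simp [hm, hn]

lemma oneHom_apply (n : ℕ) : oneHom n = if n = 0 then 0 else 1 := rfl

/-- The quadratic character modulo `8` attached to `ℚ(√2)`. -/
def chiHom : ℕ →*₀ ℂ where
  toFun n := ((ZMod.χ₈ (n : ZMod 8) : ℤ) : ℂ)
  map_zero' := by simp
  map_one' := by simp
  map_mul' m n := by rw [Nat.cast_mul, map_mul, Int.cast_mul]

lemma chiHom_apply (n : ℕ) : chiHom n =
    if n % 2 = 0 then 0 else if n % 8 = 1 ∨ n % 8 = 7 then 1 else -1 := by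
  have : chiHom n = ((ZMod.χ₈ (n : ZMod 8) : ℤ) : ℂ) := rfl
  rw [this, ZMod.χ₈_nat_eq_if_mod_eight]
  split_ifs <;> simp

lemma norm_oneHom_le (n : ℕ) : ‖oneHom n‖ ≤ 1 := by
  rw [oneHom_apply]; split_ifs <;> simp

lemma norm_chiHom_le (n : ℕ) : ‖chiHom n‖ ≤ 1 := by
  rw [chiHom_apply]; split_ifs <;> simp

lemma exists_abs_log_norm_le {f : ℂ → ℂ} (hf : Continuous f)
    (h0 : ∀ δ : ℝ, 0 ≤ δ → f (1 + δ) ≠ 0) :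
    ∃ C : ℝ, ∀ δ : ℝ, 0 ≤ δ → δ ≤ 1 → |Real.log ‖f (1 + δ)‖| ≤ C := by
  have hc : ContinuousOn (fun δ : ℝ ↦ Real.log ‖f (1 + δ)‖) (Set.Icc 0 1) := by
    refine ContinuousOn.log (by fun_prop) ?_
    intro δ hδ
    exact norm_ne_zero_iff.mpr (h0 δ hδ.1)
  obtain ⟨C, hC⟩ := isCompact_Icc.exists_bound_of_continuousOn hc
  exact ⟨C, fun δ h1 h2 ↦ hC δ ⟨h1, h2⟩⟩

lemma abs_primeSum_one_sub_log_le : ∃ C : ℝ, ∀ δ : ℝ, 0 < δ → δ ≤ 1 →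
    |primeSum (fun _ ↦ 1) δ - Real.log (1 / δ)| ≤ C := by
  obtain ⟨C0, -, hE⟩ := abs_log_norm_LSeries_sub_primeSum_le
  have hz (δ : ℝ) (hδ : δ ≠ 0) : riemannZeta₁ (1 + δ) = δ * riemannZeta (1 + δ) := by
    rw [riemannZeta_eq_inv_sub_mul (by simpa using hδ)]
    have : (δ : ℂ) ≠ 0 := by exact_mod_cast hδ
    rw [add_sub_cancel_left, mul_inv_cancel_left₀ this]
  obtain ⟨C1, h1⟩ := exists_abs_log_norm_le (f := riemannZeta₁)
    differentiable_riemannZeta₁.continuous (by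
      intro δ hδ
      rcases hδ.eq_or_lt with rfl | hδ
      · simp
      · rw [hz δ hδ.ne']
        refine mul_ne_zero (by exact_mod_cast hδ.ne') (riemannZeta_ne_zero_of_one_le_re ?_)
        simp [hδ.le])
  refine ⟨C0 + C1, fun δ hδ hδ1 ↦ ?_⟩
  obtain ⟨hne, hE⟩ := hE oneHom norm_oneHom_le δ hδ
  have hL : LSeries oneHom (1 + δ) = riemannZeta (1 + δ) := by
    rw [← LSeries_one_eq_riemannZeta (by simp [hδ])]
    refine LSeries_congr ?_ _
    intro n hn
    simp [oneHom_apply, hn]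
  have h2 := h1 δ hδ.le hδ1
  rw [hL] at hE hne
  rw [hz δ hδ.ne', norm_mul, Real.log_mul (by simpa using hδ.ne') (norm_ne_zero_iff.mpr hne),
    Complex.norm_real, Real.norm_eq_abs, abs_of_pos hδ] at h2
  have h3 : primeSum (fun p ↦ (oneHom p).re) δ = primeSum (fun _ ↦ 1) δ := by
    refine tsum_congr fun p ↦ ?_
    simp [oneHom_apply, p.prop.ne_zero]
  rw [h3] at hE
  rw [one_div, Real.log_inv]
  rw [abs_le] at *
  constructor <;> linarith

lemma abs_primeSum_chi_le : ∃ C : ℝ, ∀ δ : ℝ, 0 < δ → δ ≤ 1 →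
    |primeSum (fun p ↦ (chiHom p).re) δ| ≤ C := by
  obtain ⟨C0, -, hE⟩ := abs_log_norm_LSeries_sub_primeSum_le
  set χ : DirichletCharacter ℂ 8 := ZMod.χ₈.ringHomComp (Int.castRingHom ℂ) with hχ
  have hχ1 : χ ≠ 1 := by
    intro h
    have h3 : χ (3 : ℕ) = 1 := by
      rw [h]; exact MulChar.one_apply ((ZMod.isUnit_iff_coprime 3 8).mpr (by norm_num))
    have : χ (3 : ℕ) = -1 := by
      rw [hχ, MulChar.ringHomComp_apply, ZMod.χ₈_nat_eq_if_mod_eight]; simp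
    rw [this] at h3
    norm_num at h3
  obtain ⟨C1, h1⟩ := exists_abs_log_norm_le (f := χ.LFunction)
    (DirichletCharacter.differentiable_LFunction hχ1).continuous (by
      intro δ hδ
      exact DirichletCharacter.LFunction_ne_zero_of_one_le_re χ (Or.inl hχ1) (by simp [hδ]))
  refine ⟨C0 + C1, fun δ hδ hδ1 ↦ ?_⟩
  obtain ⟨hne, hE⟩ := hE chiHom norm_chiHom_le δ hδ
  have h2 := h1 δ hδ.le hδ1
  rw [DirichletCharacter.LFunction_eq_LSeries χ (by simp [hδ])] at h2
  have hL : LSeries chiHom (1 + δ) = LSeries (χ ·) (1 + δ) := rfl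
  rw [hL] at hE
  rw [abs_le] at *
  constructor <;> linarith

/-- The primes up to `x`. -/
def primesUpTo (x : ℝ) : Finset ℕ := (Finset.Icc 1 ⌊x⌋₊).filter Nat.Prime

lemma mem_primesUpTo {x : ℝ} {p : ℕ} : p ∈ primesUpTo x ↔ p.Prime ∧ (p : ℝ) ≤ x := by
  rw [primesUpTo, Finset.mem_filter, Finset.mem_Icc]
  constructor
  · rintro ⟨⟨h1, h2⟩, h3⟩
    exact ⟨h3, (Nat.le_floor_iff' h3.ne_zero).mp h2⟩
  · rintro ⟨h1, h2⟩
    exact ⟨⟨h1.one_lt.le, (Nat.le_floor_iff' h1.ne_zero).mpr h2⟩, h1⟩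

/-- The sum `∑ c(p) / p` over the primes up to `x`. -/
def truncSum (c : ℕ → ℝ) (x : ℝ) : ℝ := ∑ p ∈ primesUpTo x, c p / p

open Classical in
lemma truncSum_eq_tsum (c : ℕ → ℝ) (x : ℝ) :
    truncSum c x = ∑' p : Nat.Primes, if ((p : ℕ) : ℝ) ≤ x then c p / ((p : ℕ) : ℝ) else 0 := by
  have h : (∑' p : Nat.Primes, if ((p : ℕ) : ℝ) ≤ x then c p / ((p : ℕ) : ℝ) else 0) =
      ∑' n : ℕ, {p : ℕ | p.Prime}.indicator (fun n ↦ if (n : ℝ) ≤ x then c n / (n : ℝ) else 0) n :=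
    tsum_subtype {p : ℕ | p.Prime} (fun n : ℕ ↦ if (n : ℝ) ≤ x then c n / (n : ℝ) else 0)
  rw [h, tsum_eq_sum (s := primesUpTo x), truncSum]
  · refine Finset.sum_congr rfl fun p hp ↦ ?_
    rw [mem_primesUpTo] at hp
    simp [hp.1, hp.2]
  · intro p hp
    rw [mem_primesUpTo] at hp
    by_cases h1 : p.Prime
    · have h2 : ¬ (p : ℝ) ≤ x := fun h2 ↦ hp ⟨h1, h2⟩
      simp [h2]
    · simp [h1]

/-- The nonnegative kernel comparing a sharp cut-off at `exp T` with a smooth one. -/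
lemma abs_sub_rpow_le_kernel {T p w : ℝ} (hT : 0 < T) (hp : 1 ≤ p)
    (hw1 : p ≤ Real.exp T → p ^ (-(1 + 1 / T)) ≤ w ∧ w ≤ p⁻¹) (hw2 : ¬ p ≤ Real.exp T → w = 0) :
    |w - p ^ (-(1 + 1 / T))| ≤ 4 * (p ^ (-(1 + 1 / (2 * T))) - p ^ (-(1 + 1 / T))) := by
  have hp0 : 0 < p := by linarith
  set y := p ^ (-(1 / (2 * T))) with hy
  have hy0 : 0 < y := by positivity
  have hy1 : y ≤ 1 := Real.rpow_le_one_of_one_le_of_nonpos hp (by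
    have : 0 < 1 / (2 * T) := by positivity
    linarith)
  have e1 : p ^ (-(1 + 1 / (2 * T))) = p⁻¹ * y := by
    rw [hy, ← Real.rpow_neg_one, ← Real.rpow_add hp0]; ring_nf
  have e2 : p ^ (-(1 + 1 / T)) = p⁻¹ * y ^ 2 := by
    rw [hy, ← Real.rpow_neg_one, ← Real.rpow_natCast, ← Real.rpow_mul hp0.le,
      ← Real.rpow_add hp0]
    congr 1
    field_simp
    push_cast
    ring
  have hpi : 0 < p⁻¹ := by positivity
  have hyl : Real.log y = -(1 / (2 * T)) * Real.log p := Real.log_rpow hp0 _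
  rw [e1, e2]
  rw [e2] at hw1
  by_cases h : p ≤ Real.exp T
  · obtain ⟨h1, h2⟩ := hw1 h
    have hlp : Real.log p ≤ T := (Real.log_le_iff_le_exp hp0).mpr h
    have hyh : 1 / 2 ≤ y := by
      have : -(1 / 2) ≤ Real.log y := by
        rw [hyl]
        have : 1 / (2 * T) * Real.log p ≤ 1 / (2 * T) * T := by gcongr
        have h3 : 1 / (2 * T) * T = 1 / 2 := by field_simp
        linarith
      have h3 := Real.log_le_sub_one_of_pos hy0
      linarith
    rw [abs_of_nonneg (by linarith)]
    have : 1 - y ^ 2 ≤ 4 * (y - y ^ 2) := by nlinarith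
    nlinarith
  · rw [hw2 h, zero_sub, abs_neg, abs_of_nonneg (by positivity)]
    have hyh : y ≤ 2 / 3 := by
      have h4 : Real.log y ≤ -(1 / 2) := by
        rw [hyl]
        have hlp : T ≤ Real.log p := (Real.le_log_iff_exp_le hp0).mpr (by linarith)
        have : 1 / (2 * T) * T ≤ 1 / (2 * T) * Real.log p := by gcongr
        have h3 : 1 / (2 * T) * T = 1 / 2 := by field_simp
        linarith
      have h5 : Real.log (1 / y) ≤ 1 / y - 1 := Real.log_le_sub_one_of_pos (by positivity)
      rw [one_div, Real.log_inv] at h5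
      have h6 : 3 / 2 ≤ y⁻¹ := by linarith
      have := inv_anti₀ (by norm_num) h6
      rw [inv_inv] at this
      linarith
    have : y ^ 2 ≤ 4 * (y - y ^ 2) := by nlinarith
    nlinarith

open Classical in
lemma abs_tsum_sub_primeSum_le : ∃ C : ℝ, 0 ≤ C ∧ ∀ (c : ℕ → ℝ), (∀ p, |c p| ≤ 1) →
    ∀ T : ℝ, 1 ≤ T → ∀ w : Nat.Primes → ℝ,
      (∀ p : Nat.Primes, ((p : ℕ) : ℝ) ≤ Real.exp T →
        ((p : ℕ) : ℝ) ^ (-(1 + 1 / T)) ≤ w p ∧ w p ≤ ((p : ℕ) : ℝ)⁻¹) →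
      (∀ p : Nat.Primes, ¬ ((p : ℕ) : ℝ) ≤ Real.exp T → w p = 0) →
      |∑' p : Nat.Primes, c p * w p - primeSum c (1 / T)| ≤ C := by
  obtain ⟨C, hC⟩ := abs_primeSum_one_sub_log_le
  refine ⟨4 * (Real.log 2 + 2 * |C|), by positivity, fun c hc T hT w hw1 hw2 ↦ ?_⟩
  have hT0 : 0 < T := by linarith
  have hs1 : Summable fun p : Nat.Primes ↦ 1 * ((p : ℕ) : ℝ) ^ (-(1 + 1 / (2 * T))) :=
    summable_primeSum (c := fun _ ↦ 1) (B := 1) (fun _ ↦ by simp) (by positivity)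
  have hs2 : Summable fun p : Nat.Primes ↦ 1 * ((p : ℕ) : ℝ) ^ (-(1 + 1 / T)) :=
    summable_primeSum (c := fun _ ↦ 1) (B := 1) (fun _ ↦ by simp) (by positivity)
  have hs3 := (hs1.sub hs2).mul_left 4
  have hs4 : Summable fun p : Nat.Primes ↦ c p * ((p : ℕ) : ℝ) ^ (-(1 + 1 / T)) :=
    summable_primeSum hc (by positivity)
  have hbd (p : Nat.Primes) : ‖c p * w p - c p * ((p : ℕ) : ℝ) ^ (-(1 + 1 / T))‖ ≤
      4 * (1 * ((p : ℕ) : ℝ) ^ (-(1 + 1 / (2 * T))) - 1 * ((p : ℕ) : ℝ) ^ (-(1 + 1 / T))) := by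
    rw [← mul_sub, norm_mul, Real.norm_eq_abs, Real.norm_eq_abs, one_mul, one_mul]
    have h1 := abs_sub_rpow_le_kernel hT0 (p := (p : ℕ)) (by exact_mod_cast p.prop.one_lt.le)
      (hw1 p) (hw2 p)
    exact (mul_le_of_le_one_left (abs_nonneg _) (hc p)).trans h1
  have hs5 : Summable fun p : Nat.Primes ↦ c p * w p := by
    refine summable_of_hasFiniteSupport ?_
    refine ((primesUpTo (Real.exp T)).finite_toSet.preimage (f := fun p : Nat.Primes ↦ (p : ℕ))
      (Subtype.val_injective.injOn)).subset ?_
    intro p hp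
    by_contra h
    have h3 : w p = 0 := hw2 p fun h2 ↦ h (mem_primesUpTo.mpr ⟨p.prop, h2⟩)
    exact hp (by simp only [h3, mul_zero])
  rw [primeSum, ← hs5.tsum_sub hs4]
  refine (tsum_of_norm_bounded hs3.hasSum hbd).trans ?_
  rw [tsum_mul_left, hs1.tsum_sub hs2]
  have h1 := hC (1 / (2 * T)) (by positivity) (by rw [div_le_one (by positivity)]; linarith)
  have h2 := hC (1 / T) (by positivity) (by rw [div_le_one (by positivity)]; linarith)
  have h3 : Real.log (1 / (1 / (2 * T))) = Real.log 2 + Real.log (1 / (1 / T)) := by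
    rw [one_div_one_div, one_div_one_div, Real.log_mul (by norm_num) hT0.ne']
  rw [h3] at h1
  rw [primeSum] at h1 h2
  have := le_abs_self C
  rw [abs_le] at h1 h2
  linarith

lemma abs_truncSum_sub_primeSum_le : ∃ C : ℝ, 0 ≤ C ∧ ∀ (c : ℕ → ℝ), (∀ p, |c p| ≤ 1) →
    ∀ T : ℝ, 1 ≤ T → |truncSum c (Real.exp T) - primeSum c (1 / T)| ≤ C := by
  classical
  obtain ⟨C, hC0, hC⟩ := abs_tsum_sub_primeSum_le
  refine ⟨C, hC0, fun c hc T hT ↦ ?_⟩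
  have hT0 : 0 < T := by linarith
  have := hC c hc T hT (fun p ↦ if ((p : ℕ) : ℝ) ≤ Real.exp T then ((p : ℕ) : ℝ)⁻¹ else 0)
    (by
      intro p hp
      rw [if_pos hp]
      refine ⟨?_, le_rfl⟩
      rw [← Real.rpow_neg_one]
      refine Real.rpow_le_rpow_of_exponent_le (by exact_mod_cast p.prop.one_lt.le) ?_
      have : 0 < 1 / T := by positivity
      linarith)
    (by intro p hp; rw [if_neg hp])
  rw [truncSum_eq_tsum]
  simpa only [mul_ite, mul_zero, ← div_eq_mul_inv] using this

lemma abs_primeSum_rough_le : ∃ C : ℝ, 0 ≤ C ∧ ∀ (c : ℕ → ℝ), (∀ p, |c p| ≤ 1) →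
    ∀ T : ℝ, 1 ≤ T → ∀ δ : ℝ, 0 < δ → δ ≤ 1 / T →
    |primeSum (fun p ↦ if p ∈ primesUpTo (Real.exp T) then 0 else c p) δ -
      (primeSum c δ - primeSum c (1 / T))| ≤ C := by
  classical
  obtain ⟨C, hC0, hC⟩ := abs_tsum_sub_primeSum_le
  refine ⟨C, hC0, fun c hc T hT δ hδ hδT ↦ ?_⟩
  have hT0 : 0 < T := by linarith
  have := hC c hc T hT
    (fun p ↦ if ((p : ℕ) : ℝ) ≤ Real.exp T then ((p : ℕ) : ℝ) ^ (-(1 + δ)) else 0)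
    (by
      intro p hp
      have hp1 : (1 : ℝ) ≤ (p : ℕ) := by exact_mod_cast p.prop.one_lt.le
      rw [if_pos hp]
      refine ⟨Real.rpow_le_rpow_of_exponent_le hp1 (by linarith), ?_⟩
      rw [← Real.rpow_neg_one]
      exact Real.rpow_le_rpow_of_exponent_le hp1 (by linarith))
    (by intro p hp; rw [if_neg hp])
  have hs1 := summable_primeSum hc hδ
  have hs2 := summable_primeSum (c := fun p ↦ if p ∈ primesUpTo (Real.exp T) then 0 else c p)
    (B := 1) (by intro p; split_ifs; · simp
                 · exact hc p) hδ
  have e : ∑' p : Nat.Primes, c p *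
      (if ((p : ℕ) : ℝ) ≤ Real.exp T then ((p : ℕ) : ℝ) ^ (-(1 + δ)) else 0) =
      primeSum c δ - primeSum (fun p ↦ if p ∈ primesUpTo (Real.exp T) then 0 else c p) δ := by
    rw [primeSum, primeSum, ← hs1.tsum_sub hs2]
    refine tsum_congr fun p ↦ ?_
    have : (p : ℕ) ∈ primesUpTo (Real.exp T) ↔ ((p : ℕ) : ℝ) ≤ Real.exp T := by
      rw [mem_primesUpTo]; exact and_iff_right p.prop
    simp only [this]
    split_ifs <;> simp
  rw [e] at this
  rw [abs_le] at *
  constructor <;> linarith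

/-- A version of Mertens' theorem. -/
lemma abs_truncSum_one_sub_le : ∃ C : ℝ, 0 ≤ C ∧ ∀ T : ℝ, 1 ≤ T →
    |truncSum (fun _ ↦ 1) (Real.exp T) - Real.log T| ≤ C := by
  obtain ⟨C1, h10, h1⟩ := abs_truncSum_sub_primeSum_le
  obtain ⟨C2, h2⟩ := abs_primeSum_one_sub_log_le
  refine ⟨C1 + |C2|, by positivity, fun T hT ↦ ?_⟩
  have hT0 : 0 < T := by linarith
  have a1 := h1 (fun _ ↦ 1) (by simp) T hT
  have a2 := h2 (1 / T) (by positivity) (by rw [div_le_one hT0]; exact hT)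
  rw [one_div_one_div] at a2
  have := le_abs_self C2
  rw [abs_le] at *
  constructor <;> linarith

lemma abs_truncSum_chi_le : ∃ C : ℝ, 0 ≤ C ∧ ∀ T : ℝ, 1 ≤ T →
    |truncSum (fun p ↦ (chiHom p).re) (Real.exp T)| ≤ C := by
  obtain ⟨C1, h10, h1⟩ := abs_truncSum_sub_primeSum_le
  obtain ⟨C2, h2⟩ := abs_primeSum_chi_le
  refine ⟨C1 + |C2|, by positivity, fun T hT ↦ ?_⟩
  have hT0 : 0 < T := by linarith
  have a1 := h1 (fun p ↦ (chiHom p).re)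
    (fun p ↦ (Complex.abs_re_le_norm _).trans (norm_chiHom_le p)) T hT
  have a2 := h2 (1 / T) (by positivity) (by rw [div_le_one hT0]; exact hT)
  have := le_abs_self C2
  rw [abs_le] at *
  constructor <;> linarith

section

open MeasureTheory Filter Asymptotics

lemma measurable_psum (f : ArithmeticFunction ℂ) : Measurable (psum f) :=
  (measurable_from_nat (f := fun n ↦ ∑ k ∈ Finset.Icc 1 n, f k)).comp Nat.measurable_floor

lemma sum_Icc_isBigO {h : ℕ → ℝ} (h0 : ∀ n, 0 ≤ h n) {r : ℝ} (hr : 0 < r)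
    (hs : LSeriesSummable (fun n ↦ (h n : ℂ)) r) :
    (fun n ↦ ∑ k ∈ Finset.Icc 1 n, h k) =O[atTop] fun n ↦ (n : ℝ) ^ r := by
  have hs' : Summable fun n ↦ ‖LSeries.term (fun n ↦ (h n : ℂ)) r n‖ := hs.norm
  refine IsBigO.of_bound (∑' n, ‖LSeries.term (fun n ↦ (h n : ℂ)) r n‖) ?_
  refine Eventually.of_forall fun n ↦ ?_
  rw [Real.norm_of_nonneg (Finset.sum_nonneg fun k _ ↦ h0 k), Real.norm_of_nonneg (by positivity)]
  have h1 : ∑ k ∈ Finset.Icc 1 n, h k ≤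
      ∑ k ∈ Finset.Icc 1 n, ‖LSeries.term (fun n ↦ (h n : ℂ)) r k‖ * (n : ℝ) ^ r := by
    refine Finset.sum_le_sum fun k hk ↦ ?_
    rw [Finset.mem_Icc] at hk
    have hk0 : (0 : ℝ) < k := by exact_mod_cast hk.1
    rw [LSeries.term_of_ne_zero (by omega), norm_div, Complex.norm_real,
      Real.norm_of_nonneg (h0 k), Complex.norm_natCast_cpow_of_pos (by omega), Complex.ofReal_re,
      div_mul_eq_mul_div, le_div_iff₀ (by positivity)]
    have hkn : (k : ℝ) ≤ n := by exact_mod_cast hk.2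
    have := h0 k
    gcongr
  refine h1.trans ?_
  rw [← Finset.sum_mul]
  gcongr
  exact hs'.sum_le_tsum _ (fun _ _ ↦ norm_nonneg _)

lemma integrableOn_sum_Icc_mul_rpow {h : ℕ → ℝ} (h0 : ∀ n, 0 ≤ h n)
    (hs : ∀ δ : ℝ, 0 < δ → LSeriesSummable (fun n ↦ (h n : ℂ)) (1 + δ)) {δ : ℝ} (hδ : 0 < δ)
    (hne : LSeries (fun n ↦ (h n : ℂ)) (1 + δ) ≠ 0) :
    IntegrableOn (fun t : ℝ ↦ (∑ k ∈ Finset.Icc 1 ⌊t⌋₊, h k) * t ^ (-(2 + δ))) (Set.Ioi 1) ∧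
      ∫ t in Set.Ioi (1 : ℝ), (∑ k ∈ Finset.Icc 1 ⌊t⌋₊, h k) * t ^ (-(2 + δ)) ≤
        ‖LSeries (fun n ↦ (h n : ℂ)) (1 + δ)‖ := by
  have hs2 : LSeriesSummable (fun n ↦ (h n : ℂ)) ((1 + δ / 2 : ℝ) : ℂ) := by
    have := hs (δ / 2) (by positivity)
    push_cast at this ⊢
    exact this
  have hE := LSeries_eq_mul_integral_of_nonneg h (r := 1 + δ / 2) (s := 1 + δ) (by positivity)
    (by simp; linarith) (sum_Icc_isBigO h0 (by positivity) hs2) h0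
  have hEq : ∫ t in Set.Ioi (1 : ℝ),
      (∑ k ∈ Finset.Icc 1 ⌊t⌋₊, (h k : ℂ)) * t ^ (-((1 + δ : ℂ) + 1)) =
      ((∫ t in Set.Ioi (1 : ℝ), (∑ k ∈ Finset.Icc 1 ⌊t⌋₊, h k) * t ^ (-(2 + δ)) : ℝ) : ℂ) := by
    rw [← integral_complex_ofReal]
    refine setIntegral_congr_fun measurableSet_Ioi fun t ht ↦ ?_
    have ht0 : (0 : ℝ) ≤ t := le_trans zero_le_one (le_of_lt ht)
    push_cast
    rw [Complex.ofReal_cpow ht0]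
    push_cast
    ring_nf
  rw [hEq] at hE
  set I := ∫ t in Set.Ioi (1 : ℝ), (∑ k ∈ Finset.Icc 1 ⌊t⌋₊, h k) * t ^ (-(2 + δ)) with hI
  constructor
  · by_contra hn
    have : I = 0 := integral_undef hn
    rw [this] at hE
    exact hne (by simpa using hE)
  · have hI0 : 0 ≤ I := setIntegral_nonneg measurableSet_Ioi fun t ht ↦ by
      have ht0 : (0 : ℝ) ≤ t := le_trans zero_le_one (le_of_lt ht)
      exact mul_nonneg (Finset.sum_nonneg fun k _ ↦ h0 k) (by positivity)
    have h1 : (1 + δ : ℂ) = ((1 + δ : ℝ) : ℂ) := by push_cast; rfl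
    rw [hE, h1, ← Complex.ofReal_mul, Complex.norm_real, Real.norm_of_nonneg (by positivity)]
    nlinarith

lemma abs_rpow_sub_rpow_le {t : ℝ} (ht : 1 ≤ t) {δ δ' : ℝ} (hδ : 0 ≤ δ) (hδ' : 0 ≤ δ') :
    |t ^ (-δ) - t ^ (-δ')| ≤ |δ - δ'| * Real.log t := by
  wlog h : δ ≤ δ' generalizing δ δ'
  · rw [abs_sub_comm, abs_sub_comm δ]
    exact this hδ' hδ (le_of_not_ge h)
  have ht0 : 0 < t := by linarith
  have hl : 0 ≤ Real.log t := Real.log_nonneg ht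
  have h1 : t ^ (-δ') ≤ t ^ (-δ) := Real.rpow_le_rpow_of_exponent_le ht (by linarith)
  have h2 : t ^ (-δ') = t ^ (-δ) * Real.exp (-((δ' - δ) * Real.log t)) := by
    rw [Real.rpow_def_of_pos ht0, Real.rpow_def_of_pos ht0, ← Real.exp_add]; ring_nf
  have h3 : t ^ (-δ) ≤ 1 := Real.rpow_le_one_of_one_le_of_nonpos ht (by linarith)
  have h4 : 0 ≤ t ^ (-δ) := by positivity
  have h5 := Real.add_one_le_exp (-((δ' - δ) * Real.log t))
  have h6 : 0 ≤ (δ' - δ) * Real.log t := mul_nonneg (by linarith) hl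
  rw [abs_of_nonneg (by linarith), abs_sub_comm, abs_of_nonneg (by linarith), h2]
  nlinarith

lemma norm_LSeries_div_le {g : ArithmeticFunction ℂ} {h : ℕ → ℝ} (hg : ∀ n, ‖g n‖ ≤ h n)
    (hs : ∀ δ : ℝ, 0 < δ → LSeriesSummable (fun n ↦ (h n : ℂ)) (1 + δ))
    {δ₀ η B : ℝ} (hδ₀ : 0 < δ₀) (hη : 0 < η) (hB : 0 ≤ B)
    (hne : LSeries (fun n ↦ (h n : ℂ)) (1 + δ₀) ≠ 0)
    (hS : ∀ t, Real.exp (1 / δ₀) ≤ t → ‖psum g t‖ ≤ B * t ^ (1 - 2 * η)) :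
    (∀ δ : ℝ, 0 < δ → ‖LSeries g (1 + δ) / (1 + δ)‖ ≤
      Real.exp 1 * ‖LSeries (fun n ↦ (h n : ℂ)) (1 + δ₀)‖ + B / (2 * η)) ∧
    (∀ δ δ' : ℝ, 0 < δ → 0 < δ' → ‖LSeries g (1 + δ) / (1 + δ) - LSeries g (1 + δ') / (1 + δ')‖ ≤
      |δ - δ'| * (Real.exp 1 / δ₀ * ‖LSeries (fun n ↦ (h n : ℂ)) (1 + δ₀)‖ + B / η ^ 2)) := by
  have h0 (n : ℕ) : 0 ≤ h n := (norm_nonneg _).trans (hg n)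
  set W := ‖LSeries (fun n ↦ (h n : ℂ)) (1 + δ₀)‖ with hW
  obtain ⟨hEint, hle⟩ := integrableOn_sum_Icc_mul_rpow h0 hs hδ₀ hne
  set Q : ℝ → ℝ := fun t ↦ (∑ k ∈ Finset.Icc 1 ⌊t⌋₊, h k) * t ^ (-(2 + δ₀)) with hQ
  have hQ0 (t : ℝ) (ht : 1 < t) : 0 ≤ Q t :=
    mul_nonneg (Finset.sum_nonneg fun k _ ↦ h0 k) (Real.rpow_nonneg (by linarith) _)
  have hP (t : ℝ) (ht : 1 < t) : ‖psum g t‖ ≤ Q t * t ^ (2 + δ₀) := by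
    have ht0 : 0 < t := by linarith
    rw [hQ, mul_assoc, ← Real.rpow_add ht0, neg_add_cancel, Real.rpow_zero, mul_one]
    exact (norm_sum_le _ _).trans (Finset.sum_le_sum fun k _ ↦ hg k)
  have hhead (t : ℝ) (ht : 1 < t) (h2 : t ≤ Real.exp (1 / δ₀)) :
      ‖psum g t‖ * t ^ (-2 : ℝ) ≤ Real.exp 1 * Q t := by
    have ht0 : 0 < t := by linarith
    have h3 : t ^ δ₀ ≤ Real.exp 1 := by
      calc t ^ δ₀ ≤ Real.exp (1 / δ₀) ^ δ₀ := by gcongr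
        _ = Real.exp 1 := by rw [← Real.exp_mul]; field_simp
    calc ‖psum g t‖ * t ^ (-2 : ℝ) ≤ Q t * t ^ (2 + δ₀) * t ^ (-2 : ℝ) := by gcongr; exact hP t ht
      _ = Q t * t ^ δ₀ := by rw [mul_assoc, ← Real.rpow_add ht0]; ring_nf
      _ ≤ Q t * Real.exp 1 := by gcongr; exact hQ0 t ht
      _ = _ := mul_comm _ _
  have htail (t : ℝ) (ht : 1 < t) (h2 : Real.exp (1 / δ₀) ≤ t) :
      ‖psum g t‖ * t ^ (-2 : ℝ) ≤ B * t ^ (-(1 + 2 * η)) := by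
    have ht0 : 0 < t := by linarith
    calc ‖psum g t‖ * t ^ (-2 : ℝ) ≤ B * t ^ (1 - 2 * η) * t ^ (-2 : ℝ) := by gcongr; exact hS t h2
      _ = _ := by rw [mul_assoc, ← Real.rpow_add ht0]; ring_nf
  have hM1 (t : ℝ) (ht : 1 < t) :
      ‖psum g t‖ * t ^ (-2 : ℝ) ≤ Real.exp 1 * Q t + B * t ^ (-(1 + 2 * η)) := by
    have ht0 : 0 < t := by linarith
    have e1 : 0 ≤ Real.exp 1 * Q t := mul_nonneg (Real.exp_pos _).le (hQ0 t ht)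
    have e2 : 0 ≤ B * t ^ (-(1 + 2 * η)) := by positivity
    rcases le_total t (Real.exp (1 / δ₀)) with h2 | h2
    · linarith [hhead t ht h2]
    · linarith [htail t ht h2]
  have hM2 (t : ℝ) (ht : 1 < t) : ‖psum g t‖ * t ^ (-2 : ℝ) * Real.log t ≤
      Real.exp 1 / δ₀ * Q t + B / η * t ^ (-(1 + η)) := by
    have ht0 : 0 < t := by linarith
    have hl : 0 ≤ Real.log t := Real.log_nonneg ht.le
    have e1 : 0 ≤ Real.exp 1 / δ₀ * Q t := mul_nonneg (by positivity) (hQ0 t ht)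
    have e2 : 0 ≤ B / η * t ^ (-(1 + η)) := by positivity
    rcases le_total t (Real.exp (1 / δ₀)) with h2 | h2
    · have h3 : Real.log t ≤ 1 / δ₀ := (Real.log_le_iff_le_exp ht0).mpr h2
      calc _ ≤ (Real.exp 1 * Q t) * (1 / δ₀) :=
            mul_le_mul (hhead t ht h2) h3 hl (mul_nonneg (Real.exp_pos _).le (hQ0 t ht))
        _ = Real.exp 1 / δ₀ * Q t := by ring
        _ ≤ _ := by linarith
    · have h3 : Real.log t ≤ t ^ η / η := Real.log_le_rpow_div ht0.le hη
      calc _ ≤ (B * t ^ (-(1 + 2 * η))) * (t ^ η / η) :=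
            mul_le_mul (htail t ht h2) h3 hl (by positivity)
        _ = B / η * (t ^ (-(1 + 2 * η)) * t ^ η) := by ring
        _ = B / η * t ^ (-(1 + η)) := by rw [← Real.rpow_add ht0]; ring_nf
        _ ≤ _ := by linarith
  have hi1 {c : ℝ} (hc : 0 < c) : IntegrableOn (fun t : ℝ ↦ t ^ (-(1 + c))) (Set.Ioi 1) :=
    integrableOn_Ioi_rpow_of_lt (by linarith) one_pos
  have hv1 {c : ℝ} (hc : 0 < c) : ∫ t in Set.Ioi (1 : ℝ), t ^ (-(1 + c)) = 1 / c := by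
    rw [integral_Ioi_rpow_of_lt (by linarith) one_pos, Real.one_rpow]
    rw [show -(1 + c) + 1 = -c by ring, neg_div_neg_eq]
  have hI1 : IntegrableOn (fun t ↦ Real.exp 1 * Q t + B * t ^ (-(1 + 2 * η))) (Set.Ioi 1) :=
    (hEint.const_mul _).add ((hi1 (by positivity)).const_mul _)
  have hI2 : IntegrableOn (fun t ↦ Real.exp 1 / δ₀ * Q t + B / η * t ^ (-(1 + η))) (Set.Ioi 1) :=
    (hEint.const_mul _).add ((hi1 hη).const_mul _)
  have hV1 : ∫ t in Set.Ioi (1 : ℝ), (Real.exp 1 * Q t + B * t ^ (-(1 + 2 * η))) ≤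
      Real.exp 1 * W + B / (2 * η) := by
    rw [integral_add (hEint.const_mul _) ((hi1 (by positivity)).const_mul _), integral_const_mul,
      integral_const_mul, hv1 (by positivity), mul_one_div]
    gcongr
  have hV2 : ∫ t in Set.Ioi (1 : ℝ), (Real.exp 1 / δ₀ * Q t + B / η * t ^ (-(1 + η))) ≤
      Real.exp 1 / δ₀ * W + B / η ^ 2 := by
    rw [integral_add (hEint.const_mul _) ((hi1 hη).const_mul _), integral_const_mul,
      integral_const_mul, hv1 hη, mul_one_div, div_div, ← sq]
    gcongr
  have hnorm (δ t : ℝ) (ht : 1 < t) : psum g t * (t : ℂ) ^ (-((1 + δ : ℂ) + 1)) =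
      psum g t * ((t ^ (-2 : ℝ) * t ^ (-δ) : ℝ) : ℂ) := by
    have ht0 : 0 < t := by linarith
    rw [← Real.rpow_add ht0, Complex.ofReal_cpow ht0.le]
    push_cast
    ring_nf
  have hint1 (δ : ℝ) (hδ : 0 < δ) :
      IntegrableOn (fun t : ℝ ↦ psum g t * (t : ℂ) ^ (-((1 + δ : ℂ) + 1))) (Set.Ioi 1) ∧
      ∀ t ∈ Set.Ioi (1 : ℝ), ‖psum g t * (t : ℂ) ^ (-((1 + δ : ℂ) + 1))‖ ≤
        Real.exp 1 * Q t + B * t ^ (-(1 + 2 * η)) := by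
    have hb : ∀ t ∈ Set.Ioi (1 : ℝ), ‖psum g t * (t : ℂ) ^ (-((1 + δ : ℂ) + 1))‖ ≤
        Real.exp 1 * Q t + B * t ^ (-(1 + 2 * η)) := by
      intro t ht
      have ht0 : (0 : ℝ) < t := lt_trans zero_lt_one ht
      rw [hnorm δ t ht, norm_mul, Complex.norm_real, Real.norm_of_nonneg (by positivity),
        ← mul_assoc]
      refine le_trans ?_ (hM1 t ht)
      have : t ^ (-δ) ≤ 1 := Real.rpow_le_one_of_one_le_of_nonpos (le_of_lt ht) (by linarith)
      exact mul_le_of_le_one_right (by positivity) this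
    refine ⟨hI1.mono' ?_ ((ae_restrict_iff' measurableSet_Ioi).mpr (ae_of_all _ hb)), hb⟩
    refine Measurable.aestronglyMeasurable ?_
    have := measurable_psum g
    fun_prop
  have hLg (δ : ℝ) (hδ : 0 < δ) : LSeries g (1 + δ) / (1 + δ) =
      ∫ t in Set.Ioi (1 : ℝ), psum g t * (t : ℂ) ^ (-((1 + δ : ℂ) + 1)) := by
    have hs2 : LSeriesSummable (fun n ↦ (h n : ℂ)) ((1 + δ / 2 : ℝ) : ℂ) := by
      have := hs (δ / 2) (by positivity)
      push_cast at this ⊢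
      exact this
    have hO := sum_Icc_isBigO h0 (by positivity) hs2
    have hO' : (fun n ↦ ∑ k ∈ Finset.Icc 1 n, ‖g k‖) =O[atTop] fun n ↦ (n : ℝ) ^ (1 + δ / 2) := by
      refine (isBigO_of_le _ fun n ↦ ?_).trans hO
      rw [Real.norm_of_nonneg (Finset.sum_nonneg fun k _ ↦ norm_nonneg _),
        Real.norm_of_nonneg (Finset.sum_nonneg fun k _ ↦ h0 k)]
      exact Finset.sum_le_sum fun k _ ↦ hg k
    have := LSeries_eq_mul_integral' g (r := 1 + δ / 2) (s := 1 + δ) (by positivity)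
      (by simp; linarith) hO'
    have h1 : (1 + δ : ℂ) ≠ 0 := by
      have : (1 + δ : ℝ) ≠ 0 := by positivity
      exact_mod_cast this
    rw [this, mul_div_cancel_left₀ _ h1]
    rfl
  constructor
  · intro δ hδ
    rw [hLg δ hδ]
    exact (norm_integral_le_of_norm_le hI1
      ((ae_restrict_iff' measurableSet_Ioi).mpr (ae_of_all _ (hint1 δ hδ).2))).trans hV1
  · intro δ δ' hδ hδ'
    rw [hLg δ hδ, hLg δ' hδ', ← integral_sub (hint1 δ hδ).1 (hint1 δ' hδ').1]
    refine (norm_integral_le_of_norm_le (hI2.const_mul |δ - δ'|)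
      ((ae_restrict_iff' measurableSet_Ioi).mpr (ae_of_all _ fun t ht ↦ ?_))).trans ?_
    · have ht0 : (0 : ℝ) < t := lt_trans zero_lt_one ht
      rw [hnorm δ t ht, hnorm δ' t ht, ← mul_sub, ← Complex.ofReal_sub, norm_mul,
        Complex.norm_real, Real.norm_eq_abs, ← mul_sub, abs_mul, abs_of_nonneg (by positivity)]
      calc _ ≤ ‖psum g t‖ * (t ^ (-2 : ℝ) * (|δ - δ'| * Real.log t)) := by
            gcongr
            exact abs_rpow_sub_rpow_le (le_of_lt ht) hδ.le hδ'.le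
        _ = |δ - δ'| * (‖psum g t‖ * t ^ (-2 : ℝ) * Real.log t) := by ring
        _ ≤ _ := by gcongr; exact hM2 t ht
    · rw [integral_const_mul]
      gcongr

end

/-- The L-series at `1 + δ` of `u` restricted to integers without prime factors up to `exp T`. -/
def roughL (u : ℕ →*₀ ℂ) (T δ : ℝ) : ℂ := LSeries (sift (primesUpTo (Real.exp T)) u) (1 + δ)

lemma norm_sift_le_one {u : ℕ →*₀ ℂ} (hu : ∀ n, ‖u n‖ ≤ 1) (s : Finset ℕ) (n : ℕ) :
    ‖sift s u n‖ ≤ 1 := by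
  rw [sift_apply]
  split_ifs
  · exact hu n
  · simp

lemma abs_log_norm_roughL_sub_le : ∃ C : ℝ, 0 ≤ C ∧ ∀ u : ℕ →*₀ ℂ, (∀ n, ‖u n‖ ≤ 1) →
    ∀ T δ : ℝ, 0 < δ → roughL u T δ ≠ 0 ∧
      |Real.log ‖roughL u T δ‖ -
        primeSum (fun p ↦ if p ∈ primesUpTo (Real.exp T) then 0 else (u p).re) δ| ≤ C := by
  obtain ⟨C, hC0, hC⟩ := abs_log_norm_LSeries_sub_primeSum_le
  refine ⟨C, hC0, fun u hu T δ hδ ↦ ?_⟩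
  have := hC (sift (primesUpTo (Real.exp T)) u) (norm_sift_le_one hu _) δ hδ
  have h2 : primeSum (fun p ↦ if p ∈ primesUpTo (Real.exp T) then 0 else (u p).re) δ =
      primeSum (fun p ↦ (sift (primesUpTo (Real.exp T)) u p).re) δ := by
    refine tsum_congr fun p ↦ ?_
    simp only [sift_prime _ u p.prop]
    split_ifs <;> simp
  rw [h2]
  exact this

lemma abs_log_norm_roughL_sub_sub_le : ∃ C : ℝ, 0 ≤ C ∧ ∀ u : ℕ →*₀ ℂ, (∀ n, ‖u n‖ ≤ 1) →
    ∀ T δ : ℝ, 1 ≤ T → 0 < δ → δ ≤ 1 / T →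
      |Real.log ‖roughL u T δ‖ -
        (primeSum (fun p ↦ (u p).re) δ - primeSum (fun p ↦ (u p).re) (1 / T))| ≤ C := by
  obtain ⟨C1, h10, h1⟩ := abs_log_norm_roughL_sub_le
  obtain ⟨C2, h20, h2⟩ := abs_primeSum_rough_le
  refine ⟨C1 + C2, by positivity, fun u hu T δ hT hδ hδT ↦ ?_⟩
  have a1 := (h1 u hu T δ hδ).2
  have a2 := h2 (fun p ↦ (u p).re) (fun p ↦ (Complex.abs_re_le_norm _).trans (hu p)) T hT δ hδ hδT
  rw [abs_le] at *
  constructor <;> linarith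

lemma log_norm_roughL_one_le : ∃ C : ℝ, 0 ≤ C ∧ ∀ T δ : ℝ, 1 ≤ T → 0 < δ → δ ≤ 1 / T →
    Real.log ‖roughL oneHom T δ‖ ≤ -Real.log (δ * T) + C ∧
    Real.log ‖roughL chiHom T δ‖ ≤ C := by
  obtain ⟨C1, h10, h1⟩ := abs_log_norm_roughL_sub_sub_le
  obtain ⟨C2, h2⟩ := abs_primeSum_one_sub_log_le
  obtain ⟨C3, h3⟩ := abs_primeSum_chi_le
  refine ⟨C1 + 2 * |C2| + 2 * |C3|, by positivity, fun T δ hT hδ hδT ↦ ?_⟩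
  have hT0 : 0 < T := by linarith
  have hT1 : 1 / T ≤ 1 := by rw [div_le_one hT0]; exact hT
  have a1 := h1 oneHom norm_oneHom_le T δ hT hδ hδT
  have a2 := h1 chiHom norm_chiHom_le T δ hT hδ hδT
  have b1 := h2 δ hδ (hδT.trans hT1)
  have b2 := h2 (1 / T) (by positivity) hT1
  have c1 := h3 δ hδ (hδT.trans hT1)
  have c2 := h3 (1 / T) (by positivity) hT1
  have e1 (δ : ℝ) : primeSum (fun p ↦ (oneHom p).re) δ = primeSum (fun _ ↦ 1) δ := by
    refine tsum_congr fun p ↦ ?_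
    simp [oneHom_apply, p.prop.ne_zero]
  rw [e1, e1] at a1
  rw [one_div_one_div] at b2
  rw [one_div, Real.log_inv] at b1
  rw [Real.log_mul hδ.ne' hT0.ne']
  have d2 := le_abs_self C2
  have d3 := le_abs_self C3
  have d4 := abs_nonneg C2
  have d5 := abs_nonneg C3
  rw [abs_le] at a1 a2 b1 b2 c1 c2
  constructor <;> linarith

lemma three_four_one_le : ∃ C : ℝ, 0 ≤ C ∧ ∀ u v u₂ v₂ : ℕ →*₀ ℂ, (∀ n, ‖u n‖ ≤ 1) →
    (∀ n, ‖v n‖ ≤ 1) → (∀ n, ‖u₂ n‖ ≤ 1) → (∀ n, ‖v₂ n‖ ≤ 1) →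
    (∀ p : ℕ, p.Prime → p ≠ 2 → 0 ≤ 3 * (1 + (chiHom p).re) + 4 * ((u p).re + (v p).re) +
      ((u₂ p).re + (v₂ p).re)) → ∀ T δ : ℝ, 1 ≤ T → 0 < δ → δ ≤ 1 / T →
    3 * Real.log (δ * T) - C ≤ 4 * (Real.log ‖roughL u T δ‖ + Real.log ‖roughL v T δ‖) +
      (Real.log ‖roughL u₂ T δ‖ + Real.log ‖roughL v₂ T δ‖) := by
  obtain ⟨C1, h10, h1⟩ := abs_log_norm_roughL_sub_le
  obtain ⟨C2, h20, h2⟩ := log_norm_roughL_one_le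
  refine ⟨16 * C1 + 6 * C2, by positivity, ?_⟩
  intro u v u₂ v₂ hu hv hu₂ hv₂ h T δ hT hδ hδT
  obtain ⟨b1, b2⟩ := h2 T δ hT hδ hδT
  have key : 0 ≤
      3 * (primeSum (fun p ↦ if p ∈ primesUpTo (Real.exp T) then 0 else (oneHom p).re) δ +
        primeSum (fun p ↦ if p ∈ primesUpTo (Real.exp T) then 0 else (chiHom p).re) δ) +
      4 * (primeSum (fun p ↦ if p ∈ primesUpTo (Real.exp T) then 0 else (u p).re) δ +
        primeSum (fun p ↦ if p ∈ primesUpTo (Real.exp T) then 0 else (v p).re) δ) +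
      (primeSum (fun p ↦ if p ∈ primesUpTo (Real.exp T) then 0 else (u₂ p).re) δ +
        primeSum (fun p ↦ if p ∈ primesUpTo (Real.exp T) then 0 else (v₂ p).re) δ) := by
    have hs (w : ℕ →*₀ ℂ) (hw : ∀ n, ‖w n‖ ≤ 1) := summable_primeSum
      (c := fun p ↦ if p ∈ primesUpTo (Real.exp T) then 0 else (w p).re) (B := 1)
      (by
        intro p
        split_ifs
        · simp
        · exact (Complex.abs_re_le_norm _).trans (hw p)) hδ
    unfold primeSum
    rw [← (hs _ norm_oneHom_le).tsum_add (hs _ norm_chiHom_le), ← (hs _ hu).tsum_add (hs _ hv),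
      ← (hs _ hu₂).tsum_add (hs _ hv₂), ← tsum_mul_left, ← tsum_mul_left,
      ← (((hs _ norm_oneHom_le).add (hs _ norm_chiHom_le)).mul_left 3).tsum_add
        (((hs _ hu).add (hs _ hv)).mul_left 4),
      ← ((((hs _ norm_oneHom_le).add (hs _ norm_chiHom_le)).mul_left 3).add
        (((hs _ hu).add (hs _ hv)).mul_left 4)).tsum_add ((hs _ hu₂).add (hs _ hv₂))]
    refine tsum_nonneg fun p ↦ ?_
    split_ifs with hp
    · simp
    · have hp2 : (p : ℕ) ≠ 2 := by
        intro hp2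
        refine hp (mem_primesUpTo.mpr ⟨p.prop, ?_⟩)
        rw [hp2]
        have := Real.add_one_le_exp T
        push_cast
        linarith
      have h3 := h p p.prop hp2
      have h4 : 0 ≤ ((p : ℕ) : ℝ) ^ (-(1 + δ)) := by positivity
      have h5 : (oneHom p).re = 1 := by simp [oneHom_apply, p.prop.ne_zero]
      have := mul_nonneg h3 h4
      rw [h5]
      linarith
  have a1 := (h1 _ norm_oneHom_le T δ hδ).2
  have a2 := (h1 _ norm_chiHom_le T δ hδ).2
  have a3 := (h1 _ hu T δ hδ).2
  have a4 := (h1 _ hv T δ hδ).2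
  have a5 := (h1 _ hu₂ T δ hδ).2
  have a6 := (h1 _ hv₂ T δ hδ).2
  rw [abs_le] at a1 a2 a3 a4 a5 a6
  linarith

lemma prod_primesUpTo_le : ∃ C : ℝ, 0 < C ∧ ∀ T : ℝ, 1 ≤ T →
    ∏ p ∈ primesUpTo (Real.exp T), (1 + (p : ℝ) ^ (-(1 - 1 / T))) ≤ C * T ^ 3 := by
  obtain ⟨C, hC0, hC⟩ := abs_truncSum_one_sub_le
  refine ⟨Real.exp (3 * C), by positivity, fun T hT ↦ ?_⟩
  have hT0 : 0 < T := by linarith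
  have h1 : ∏ p ∈ primesUpTo (Real.exp T), (1 + (p : ℝ) ^ (-(1 - 1 / T))) ≤
      Real.exp (∑ p ∈ primesUpTo (Real.exp T), 3 * (1 / (p : ℝ))) := by
    rw [Real.exp_sum]
    refine Finset.prod_le_prod (fun p _ ↦ by positivity) fun p hp ↦ ?_
    rw [mem_primesUpTo] at hp
    have hp0 : (0 : ℝ) < p := by exact_mod_cast hp.1.pos
    have h2 : (p : ℝ) ^ (-(1 - 1 / T)) ≤ 3 * (1 / (p : ℝ)) := by
      have : (p : ℝ) ^ (-(1 - 1 / T)) = (p : ℝ) ^ (1 / T) * (1 / (p : ℝ)) := by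
        rw [one_div (p : ℝ), ← Real.rpow_neg_one (p : ℝ), ← Real.rpow_add hp0]; ring_nf
      rw [this]
      gcongr
      calc (p : ℝ) ^ (1 / T) ≤ Real.exp T ^ (1 / T) := by gcongr; exact hp.2
        _ = Real.exp 1 := by rw [← Real.exp_mul]; field_simp
        _ ≤ 3 := by linarith [Real.exp_one_lt_d9]
    have := Real.add_one_le_exp (3 * (1 / (p : ℝ)))
    linarith
  have h2 : ∑ p ∈ primesUpTo (Real.exp T), 3 * (1 / (p : ℝ)) ≤ 3 * C + 3 * Real.log T := by
    rw [← Finset.mul_sum]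
    have := hC T hT
    rw [truncSum, abs_le] at this
    linarith
  refine h1.trans ((Real.exp_le_exp.mpr h2).trans (le_of_eq ?_))
  have h3 : Real.exp (3 * Real.log T) = T ^ 3 := by
    rw [mul_comm, Real.exp_mul, Real.exp_log hT0]
    norm_cast
  rw [Real.exp_add, h3]

/-- The convolution of the restrictions of `u` and `v` to integers free of primes up to `exp T`. -/
def roughConv (u v : ℕ →*₀ ℂ) (T : ℝ) : ArithmeticFunction ℂ :=
  toArith (sift (primesUpTo (Real.exp T)) u) * toArith (sift (primesUpTo (Real.exp T)) v)

lemma LSeries_roughConv {u v : ℕ →*₀ ℂ} (hu : ∀ n, ‖u n‖ ≤ 1) (hv : ∀ n, ‖v n‖ ≤ 1) (T : ℝ)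
    {δ : ℝ} (hδ : 0 < δ) :
    LSeries (roughConv u v T) (1 + δ) = roughL u T δ * roughL v T δ :=
  ArithmeticFunction.LSeries_mul' (f := toArith (sift (primesUpTo (Real.exp T)) u))
    (g := toArith (sift (primesUpTo (Real.exp T)) v))
    (summable_natCast_rpow_mul (norm_sift_le_one hu _) hδ)
    (summable_natCast_rpow_mul (norm_sift_le_one hv _) hδ)

lemma LSeriesSummable_roughConv {u v : ℕ →*₀ ℂ} (hu : ∀ n, ‖u n‖ ≤ 1) (hv : ∀ n, ‖v n‖ ≤ 1)
    (T : ℝ) {δ : ℝ} (hδ : 0 < δ) : LSeriesSummable (roughConv u v T) (1 + δ) :=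
  ArithmeticFunction.LSeriesSummable_mul (f := toArith (sift (primesUpTo (Real.exp T)) u))
    (g := toArith (sift (primesUpTo (Real.exp T)) v))
    (summable_natCast_rpow_mul (norm_sift_le_one hu _) hδ)
    (summable_natCast_rpow_mul (norm_sift_le_one hv _) hδ)

lemma norm_roughConv_le {u v : ℕ →*₀ ℂ} (hu : ∀ n, ‖u n‖ ≤ 1) (hv : ∀ n, ‖v n‖ ≤ 1) (T : ℝ)
    (n : ℕ) : ‖roughConv u v T n‖ ≤ ‖roughConv oneHom oneHom T n‖ ∧
      ((‖roughConv oneHom oneHom T n‖ : ℝ) : ℂ) = roughConv oneHom oneHom T n := by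
  set s := primesUpTo (Real.exp T)
  have h1 (u : ℕ →*₀ ℂ) (hu : ∀ n, ‖u n‖ ≤ 1) (m : ℕ) : ‖sift s u m‖ ≤ ‖sift s oneHom m‖ := by
    rcases eq_or_ne m 0 with rfl | hm
    · simp
    rw [sift_apply, sift_apply]
    split_ifs
    · simpa [oneHom_apply, hm] using hu m
    · simp
  have h2 (m : ℕ) : sift s oneHom m = ((‖sift s oneHom m‖ : ℝ) : ℂ) := by
    rw [sift_apply, oneHom_apply]
    split_ifs <;> simp
  have h3 : roughConv oneHom oneHom T n = ((∑ x ∈ n.divisorsAntidiagonal,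
      ‖sift s oneHom x.1‖ * ‖sift s oneHom x.2‖ : ℝ) : ℂ) := by
    rw [roughConv, ArithmeticFunction.mul_apply]
    push_cast
    refine Finset.sum_congr rfl fun x _ ↦ ?_
    rw [toArith_apply, toArith_apply, ← h2, ← h2]
  have h4 : ‖roughConv oneHom oneHom T n‖ = ∑ x ∈ n.divisorsAntidiagonal,
      ‖sift s oneHom x.1‖ * ‖sift s oneHom x.2‖ := by
    rw [h3, Complex.norm_real, Real.norm_of_nonneg]
    exact Finset.sum_nonneg fun x _ ↦ by positivity
  refine ⟨?_, by rw [h4, h3]⟩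
  rw [h4, roughConv, ArithmeticFunction.mul_apply]
  refine (norm_sum_le _ _).trans (Finset.sum_le_sum fun x _ ↦ ?_)
  rw [norm_mul]
  gcongr
  · exact h1 u hu _
  · exact h1 v hv _

lemma exists_pow_mul_exp_neg_le (n : ℕ) {c : ℝ} (hc : 0 < c) :
    ∃ C : ℝ, 0 < C ∧ ∀ a : ℝ, 0 ≤ a → a ^ n * Real.exp (-(c * a)) ≤ C := by
  refine ⟨n.factorial / c ^ n, by positivity, fun a ha ↦ ?_⟩
  have h1 := Real.pow_div_factorial_le_exp (c * a) (by positivity) n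
  rw [Real.exp_neg, ← div_eq_mul_inv, div_le_div_iff₀ (Real.exp_pos _) (by positivity)]
  rw [div_le_iff₀ (by positivity), mul_pow] at h1
  linarith

lemma norm_psum_roughConv_le (K : ℝ) (hK : 0 ≤ K) : ∃ C : ℝ, 0 ≤ C ∧ ∀ a : ℝ, 11 / 10 ≤ a →
    ∀ u v : ℕ →*₀ ℂ, (∀ n, ‖u n‖ ≤ 1) → (∀ n, ‖v n‖ ≤ 1) →
    (∀ X : ℝ, 0 ≤ X → ‖psum (toArith u * toArith v) X‖ ≤ K * Real.exp (a ^ 13) * Real.sqrt X) →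
    (∀ X : ℝ, 0 ≤ X → ‖psum (toArith u * toArith v) X‖ ≤ K * X) →
    ∀ X : ℝ, Real.exp (8 * a ^ 13) ≤ X →
      ‖psum (roughConv u v (a ^ 12)) X‖ ≤ C / a ^ 24 * X ^ (1 - 2 * (1 / (4 * a ^ 12))) := by
  obtain ⟨C1, h10, h1⟩ := prod_primesUpTo_le
  obtain ⟨C2, h20, h2⟩ := exists_pow_mul_exp_neg_le 96 (c := 2) (by norm_num)
  refine ⟨K * C1 ^ 2 * C2, by positivity, fun a ha u v hu hv hS1 hS2 X hX ↦ ?_⟩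
  have ha0 : 0 < a := by linarith
  set T := a ^ 12 with hT
  have hT2 : 2 ≤ T := by
    calc (2 : ℝ) ≤ (11 / 10) ^ 12 := by norm_num
      _ ≤ a ^ 12 := by gcongr
  have hT1 : 1 ≤ T := by linarith
  have hT0 : 0 < T := by linarith
  have haT : a ^ 13 = a * T := by rw [hT]; ring
  have hX0 : 0 < X := (Real.exp_pos _).trans_le hX
  have hS (x : ℝ) (hx : 0 ≤ x) : ‖psum (toArith u * toArith v) x‖ ≤
      K * Real.exp (2 * a) * x ^ (1 - 1 / T) := by
    rcases hx.eq_or_lt with rfl | hx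
    · have := hS2 0 le_rfl
      rw [mul_zero] at this
      exact this.trans (by positivity)
    rcases le_total x (Real.exp (2 * a ^ 13)) with h | h
    · refine (hS2 x hx.le).trans ?_
      have h3 : x = x ^ (1 / T) * x ^ (1 - 1 / T) := by
        rw [← Real.rpow_add hx]; simp
      have h4 : x ^ (1 / T) ≤ Real.exp (2 * a) := by
        calc x ^ (1 / T) ≤ Real.exp (2 * a ^ 13) ^ (1 / T) := by gcongr
          _ = Real.exp (2 * a) := by rw [← Real.exp_mul, haT]; field_simp
      calc K * x = K * (x ^ (1 / T) * x ^ (1 - 1 / T)) := by rw [← h3]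
        _ ≤ K * (Real.exp (2 * a) * x ^ (1 - 1 / T)) := by gcongr
        _ = _ := by ring
    · have hl : 2 * a ^ 13 ≤ Real.log x := (Real.le_log_iff_exp_le hx).mpr h
      refine (hS1 x hx.le).trans ?_
      rw [mul_assoc, mul_assoc]
      refine mul_le_mul_of_nonneg_left ?_ hK
      rw [Real.sqrt_eq_rpow, Real.rpow_def_of_pos hx, Real.rpow_def_of_pos hx, ← Real.exp_add,
        ← Real.exp_add]
      refine Real.exp_le_exp.mpr ?_
      have h5 : 0 ≤ 1 / 2 - 1 / T := by
        have := one_div_le_one_div_of_le (by norm_num) hT2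
        linarith
      have h6 := mul_le_mul_of_nonneg_right hl h5
      have h7 : 2 * a ^ 13 * (1 / 2 - 1 / T) = a ^ 13 - 2 * a := by
        rw [haT]; field_simp
      linarith
  have hg := norm_psum_sift_mul_sift_le hu hv hS (primesUpTo (Real.exp T))
    (fun p hp ↦ (mem_primesUpTo.mp hp).1) hX0.le
  refine hg.trans ?_
  have hP0 : 0 ≤ ∏ p ∈ primesUpTo (Real.exp T), (1 + (p : ℝ) ^ (-(1 - 1 / T))) :=
    Finset.prod_nonneg fun p _ ↦ by positivity
  have hXs : X ^ (1 - 1 / T) ≤ Real.exp (-(4 * a)) * X ^ (1 - 2 * (1 / (4 * T))) := by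
    have h3 : X ^ (1 - 1 / T) = X ^ (-(1 / (2 * T))) * X ^ (1 - 2 * (1 / (4 * T))) := by
      rw [← Real.rpow_add hX0]
      congr 1
      field_simp
      ring
    rw [h3]
    gcongr
    have hl : 8 * a ^ 13 ≤ Real.log X := (Real.le_log_iff_exp_le hX0).mpr hX
    rw [Real.rpow_def_of_pos hX0]
    refine Real.exp_le_exp.mpr ?_
    have h6 := mul_le_mul_of_nonneg_right hl (show 0 ≤ 1 / (2 * T) by positivity)
    have h7 : 8 * a ^ 13 * (1 / (2 * T)) = 4 * a := by
      rw [haT]; field_simp; norm_num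
    linarith
  calc _ ≤ K * Real.exp (2 * a) * (C1 * T ^ 3) ^ 2 *
        (Real.exp (-(4 * a)) * X ^ (1 - 2 * (1 / (4 * T)))) := by
        gcongr
        exact h1 T hT1
    _ = K * C1 ^ 2 * (a ^ 96 * (Real.exp (2 * a) * Real.exp (-(4 * a)))) / a ^ 24 *
        X ^ (1 - 2 * (1 / (4 * T))) := by
        rw [hT]; field_simp
    _ ≤ _ := by
        have e : Real.exp (2 * a) * Real.exp (-(4 * a)) = Real.exp (-(2 * a)) := by
          rw [← Real.exp_add]; ring_nf
        rw [e]
        gcongr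
        exact h2 a ha0.le

lemma norm_LSeries_roughConv_le (K : ℝ) (hK : 0 ≤ K) : ∃ C : ℝ, 0 < C ∧ ∀ a : ℝ, 11 / 10 ≤ a →
    ∀ u v : ℕ →*₀ ℂ, (∀ n, ‖u n‖ ≤ 1) → (∀ n, ‖v n‖ ≤ 1) →
    (∀ X : ℝ, 0 ≤ X → ‖psum (toArith u * toArith v) X‖ ≤ K * Real.exp (a ^ 13) * Real.sqrt X) →
    (∀ X : ℝ, 0 ≤ X → ‖psum (toArith u * toArith v) X‖ ≤ K * X) →
    (∀ δ : ℝ, 0 < δ →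
      ‖roughL u (a ^ 12) δ * roughL v (a ^ 12) δ / (1 + δ)‖ ≤ C * a ^ 2) ∧
    (∀ δ δ' : ℝ, 0 < δ → 0 < δ' →
      ‖roughL u (a ^ 12) δ * roughL v (a ^ 12) δ / (1 + δ) -
        roughL u (a ^ 12) δ' * roughL v (a ^ 12) δ' / (1 + δ')‖ ≤ |δ - δ'| * (C * a ^ 15)) := by
  obtain ⟨C1, h10, h1⟩ := norm_psum_roughConv_le K hK
  obtain ⟨C2, h20, h2⟩ := log_norm_roughL_one_le
  refine ⟨3 * (Real.exp C2 * 8) ^ 2 * 8 + 16 * C1, by positivity, ?_⟩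
  intro a ha u v hu hv hS1 hS2
  have ha1 : 1 ≤ a := by linarith
  have ha0 : 0 < a := by linarith
  have hS := h1 a ha u v hu hv hS1 hS2
  set T := a ^ 12 with hT
  have hT1 : 1 ≤ T := one_le_pow₀ ha1
  have hT0 : 0 < T := by linarith
  have haT : a ^ 13 = a * T := by rw [hT]; ring
  set δ₀ := 1 / (8 * a ^ 13) with hδ₀
  have hδ₀0 : 0 < δ₀ := by positivity
  have hδ₀1 : 1 / δ₀ = 8 * a ^ 13 := one_div_one_div _
  have hδ₀T : δ₀ ≤ 1 / T := by
    rw [hδ₀, haT]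
    refine one_div_le_one_div_of_le hT0 ?_
    nlinarith
  set h : ℕ → ℝ := fun n ↦ ‖roughConv oneHom oneHom T n‖ with hh
  have hhc : (fun n ↦ (h n : ℂ)) = roughConv oneHom oneHom T := by
    ext n
    exact (norm_roughConv_le hu hv T n).2
  have hW : ‖LSeries (fun n ↦ (h n : ℂ)) (1 + δ₀)‖ ≤ (Real.exp C2 * (8 * a)) ^ 2 ∧
      LSeries (fun n ↦ (h n : ℂ)) (1 + δ₀) ≠ 0 := by
    obtain ⟨_, -, h3⟩ := abs_log_norm_roughL_sub_le
    have hne := (h3 oneHom norm_oneHom_le T δ₀ hδ₀0).1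
    rw [hhc, LSeries_roughConv norm_oneHom_le norm_oneHom_le T hδ₀0]
    refine ⟨?_, mul_ne_zero hne hne⟩
    rw [norm_mul, ← sq]
    have h4 := (h2 T δ₀ hT1 hδ₀0 hδ₀T).1
    gcongr
    have h5 : δ₀ * T = (8 * a)⁻¹ := by
      rw [hδ₀, haT]; field_simp
    rw [h5, Real.log_inv, neg_neg, Real.log_le_iff_le_exp (norm_pos_iff.mpr hne), Real.exp_add,
      Real.exp_log (by positivity)] at h4
    linarith
  have hmain := norm_LSeries_div_le (g := roughConv u v T) (h := h)
    (fun n ↦ (norm_roughConv_le hu hv T n).1)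
    (fun δ hδ ↦ by
      rw [hhc]
      exact LSeriesSummable_roughConv norm_oneHom_le norm_oneHom_le T hδ)
    (δ₀ := δ₀) (η := 1 / (4 * T)) (B := C1 / a ^ 24) hδ₀0 (by positivity) (by positivity) hW.2
    (by rw [hδ₀1]; exact hS)
  have he : Real.exp 1 ≤ 3 := by linarith [Real.exp_one_lt_d9]
  have e1 : C1 / a ^ 24 / (2 * (1 / (4 * T))) ≤ 16 * C1 * a ^ 2 := by
    have : C1 / a ^ 24 / (2 * (1 / (4 * T))) = 2 * C1 / a ^ 12 := by
      rw [hT]; field_simp; norm_num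
    rw [this]
    have h6 : 2 * C1 / a ^ 12 ≤ 2 * C1 := div_le_self (by positivity) (one_le_pow₀ ha1)
    have h7 : 1 ≤ a ^ 2 := one_le_pow₀ ha1
    nlinarith
  have e2 : C1 / a ^ 24 / (1 / (4 * T)) ^ 2 ≤ 16 * C1 * a ^ 15 := by
    have : C1 / a ^ 24 / (1 / (4 * T)) ^ 2 = 16 * C1 := by
      rw [hT]; field_simp; norm_num
    rw [this]
    have h7 : 1 ≤ a ^ 15 := one_le_pow₀ ha1
    nlinarith
  constructor
  · intro δ hδ
    have := hmain.1 δ hδ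
    rw [LSeries_roughConv hu hv T hδ] at this
    refine this.trans ?_
    calc _ ≤ 3 * (Real.exp C2 * (8 * a)) ^ 2 + 16 * C1 * a ^ 2 := by
          gcongr
          exact hW.1
      _ = (3 * (Real.exp C2 * 8) ^ 2 + 16 * C1) * a ^ 2 := by ring
      _ ≤ _ := by
          refine mul_le_mul_of_nonneg_right ?_ (by positivity)
          nlinarith [sq_nonneg (Real.exp C2 * 8)]
  · intro δ δ' hδ hδ'
    have := hmain.2 δ δ' hδ hδ'
    rw [LSeries_roughConv hu hv T hδ, LSeries_roughConv hu hv T hδ'] at this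
    refine this.trans ?_
    gcongr
    rw [div_eq_mul_one_div (Real.exp 1), hδ₀1]
    calc _ ≤ 3 * (8 * a ^ 13) * (Real.exp C2 * (8 * a)) ^ 2 + 16 * C1 * a ^ 15 := by
          gcongr
          exact hW.1
      _ = _ := by ring

lemma abs_log_norm_sub_log_norm_le {z w : ℂ} (hw : w ≠ 0) (h : ‖z - w‖ ≤ 1 / 2 * ‖w‖) :
    |Real.log ‖z‖ - Real.log ‖w‖| ≤ 1 := by
  have hw0 : 0 < ‖w‖ := norm_pos_iff.mpr hw
  have h1 : ‖w‖ ≤ ‖z‖ + ‖z - w‖ := by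
    have := norm_sub_norm_le w z
    rw [norm_sub_rev] at this
    linarith
  have h2 : ‖z‖ ≤ ‖w‖ + ‖z - w‖ := by
    have := norm_sub_norm_le z w
    linarith
  have hz0 : 0 < ‖z‖ := by linarith
  rw [← Real.log_div hz0.ne' hw0.ne']
  set r := ‖z‖ / ‖w‖ with hr
  have hr1 : 1 / 2 ≤ r := by rw [hr, le_div_iff₀ hw0]; linarith
  have hr2 : r ≤ 3 / 2 := by rw [hr, div_le_iff₀ hw0]; linarith
  have hr0 : 0 < r := by linarith
  rw [abs_le]
  constructor
  · have := Real.log_le_sub_one_of_pos (inv_pos.mpr hr0)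
    rw [Real.log_inv] at this
    have h3 : r⁻¹ ≤ 2 := by rw [inv_le_comm₀ hr0 (by norm_num)]; linarith
    linarith
  · have := Real.log_le_sub_one_of_pos hr0
    linarith

lemma abs_log_norm_roughL_sub_star_le (K : ℝ) (hK : 0 ≤ K) : ∃ q : ℝ, 0 < q ∧ q ≤ 1 ∧
    ∀ a : ℝ, 11 / 10 ≤ a →
    ∀ u v u₂ v₂ : ℕ →*₀ ℂ, (∀ n, ‖u n‖ ≤ 1) → (∀ n, ‖v n‖ ≤ 1) →
    (∀ n, ‖u₂ n‖ ≤ 1) → (∀ n, ‖v₂ n‖ ≤ 1) →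
    (∀ X : ℝ, 0 ≤ X → ‖psum (toArith u * toArith v) X‖ ≤ K * Real.exp (a ^ 13) * Real.sqrt X) →
    (∀ X : ℝ, 0 ≤ X → ‖psum (toArith u * toArith v) X‖ ≤ K * X) →
    (∀ X : ℝ, 0 ≤ X → ‖psum (toArith u₂ * toArith v₂) X‖ ≤ K * Real.exp (a ^ 13) * Real.sqrt X) →
    (∀ X : ℝ, 0 ≤ X → ‖psum (toArith u₂ * toArith v₂) X‖ ≤ K * X) →
    (∀ p : ℕ, p.Prime → p ≠ 2 → 0 ≤ 3 * (1 + (chiHom p).re) + 4 * ((u p).re + (v p).re) +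
      ((u₂ p).re + (v₂ p).re)) →
    ∀ δ : ℝ, 0 < δ → δ ≤ q ^ 4 / a ^ 26 →
    |Real.log ‖roughL u (a ^ 12) δ‖ + Real.log ‖roughL v (a ^ 12) δ‖ -
      (Real.log ‖roughL u (a ^ 12) (q ^ 4 / a ^ 26)‖ +
        Real.log ‖roughL v (a ^ 12) (q ^ 4 / a ^ 26)‖)| ≤ 2 := by
  obtain ⟨CA, hCA0, hCA⟩ := norm_LSeries_roughConv_le K hK
  obtain ⟨CB, hCB0, hCB⟩ := three_four_one_le
  obtain ⟨_, -, hE⟩ := abs_log_norm_roughL_sub_le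
  set D := (CB + Real.log (2 * CA)) / 4 with hD
  set q := min 1 (Real.exp (-D) / (4 * CA)) with hq
  have hq0 : 0 < q := lt_min one_pos (by positivity)
  have hq1 : q ≤ 1 := min_le_left _ _
  have hqC : q * CA ≤ Real.exp (-D) / 4 := by
    have : q ≤ Real.exp (-D) / (4 * CA) := min_le_right _ _
    rw [le_div_iff₀ (by positivity)] at this
    linarith
  refine ⟨q, hq0, hq1, ?_⟩
  intro a ha u v u₂ v₂ hu hv hu₂ hv₂ hS1 hS2 hS3 hS4 h341 δ hδ hδs
  have ha1 : 1 ≤ a := by linarith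
  have ha0 : 0 < a := by linarith
  obtain ⟨-, hA2⟩ := hCA a ha u v hu hv hS1 hS2
  obtain ⟨hA3, -⟩ := hCA a ha u₂ v₂ hu₂ hv₂ hS3 hS4
  set T := a ^ 12 with hT
  have hT1 : 1 ≤ T := one_le_pow₀ ha1
  have hT0 : 0 < T := by linarith
  set s := q ^ 4 / a ^ 26 with hs
  have hs0 : 0 < s := by positivity
  have hsT : s * T = q ^ 4 / a ^ 14 := by rw [hs, hT]; field_simp
  have hsT1 : s ≤ 1 / T := by
    rw [le_div_iff₀ hT0, hsT]
    exact (div_le_self (by positivity) (one_le_pow₀ ha1)).trans (pow_le_one₀ hq0.le hq1)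
  have hs1 : s ≤ 1 := hsT1.trans (by rw [div_le_one hT0]; exact hT1)
  have hne (w : ℕ →*₀ ℂ) (hw : ∀ n, ‖w n‖ ≤ 1) (δ : ℝ) (hδ : 0 < δ) : 0 < ‖roughL w T δ‖ :=
    norm_pos_iff.mpr (hE w hw T δ hδ).1
  have hn1 (δ : ℝ) (hδ : 0 < δ) : ‖(1 + δ : ℂ)‖ = 1 + δ := by
    have : (1 + δ : ℂ) = ((1 + δ : ℝ) : ℂ) := by push_cast; rfl
    rw [this, Complex.norm_real, Real.norm_of_nonneg (by positivity)]
  have hH (u v : ℕ →*₀ ℂ) (δ : ℝ) (hδ : 0 < δ) : ‖roughL u T δ * roughL v T δ / (1 + δ)‖ =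
      ‖roughL u T δ‖ * ‖roughL v T δ‖ / (1 + δ) := by
    rw [norm_div, norm_mul, hn1 δ hδ]
  have hlogH (δ : ℝ) (hδ : 0 < δ) : Real.log ‖roughL u T δ * roughL v T δ / (1 + δ)‖ =
      Real.log ‖roughL u T δ‖ + Real.log ‖roughL v T δ‖ - Real.log (1 + δ) := by
    have h1 := hne u hu δ hδ
    have h2 := hne v hv δ hδ
    rw [hH u v δ hδ, Real.log_div (by positivity) (by positivity),
      Real.log_mul h1.ne' h2.ne']
  have hlog1 (δ : ℝ) (hδ : 0 < δ) (hδ1 : δ ≤ 1) :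
      0 ≤ Real.log (1 + δ) ∧ Real.log (1 + δ) ≤ 1 := by
    refine ⟨Real.log_nonneg (by linarith), ?_⟩
    have := Real.log_le_sub_one_of_pos (show 0 < 1 + δ by linarith)
    linarith
  have hG2 : Real.log ‖roughL u₂ T s‖ + Real.log ‖roughL v₂ T s‖ ≤
      Real.log (2 * CA) + 2 * Real.log a := by
    have h1 := hne u₂ hu₂ s hs0
    have h2 := hne v₂ hv₂ s hs0
    have h3 := hA3 s hs0
    rw [hH u₂ v₂ s hs0, div_le_iff₀ (by positivity)] at h3
    rw [← Real.log_mul h1.ne' h2.ne']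
    have h4 : 2 * Real.log a = Real.log (a ^ 2) := by rw [Real.log_pow]; norm_cast
    rw [h4, ← Real.log_mul (by positivity) (by positivity)]
    refine Real.log_le_log (by positivity) (h3.trans ?_)
    have : CA * a ^ 2 * (1 + s) ≤ CA * a ^ 2 * 2 := by gcongr; linarith
    linarith
  have hB := hCB u v u₂ v₂ hu hv hu₂ hv₂ h341 T s hT1 hs0 hsT1
  have hlogs : Real.log (s * T) = 4 * Real.log q - 14 * Real.log a := by
    rw [hsT, Real.log_div (by positivity) (by positivity), Real.log_pow, Real.log_pow]
    norm_cast
  rw [hlogs] at hB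
  have hlow : Real.log (q ^ 3 / a ^ 11 * Real.exp (-D)) ≤
      Real.log ‖roughL u T s‖ + Real.log ‖roughL v T s‖ := by
    rw [Real.log_mul (by positivity) (by positivity), Real.log_div (by positivity) (by positivity),
      Real.log_pow, Real.log_pow, Real.log_exp]
    push_cast
    rw [hD]
    linarith
  have hlow2 : q ^ 3 / a ^ 11 * Real.exp (-D) / 2 ≤
      ‖roughL u T s * roughL v T s / (1 + s)‖ := by
    have h1 := hne u hu s hs0
    have h2 := hne v hv s hs0
    rw [← Real.log_mul h1.ne' h2.ne', Real.log_le_log_iff (by positivity) (by positivity)] at hlow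
    rw [hH u v s hs0]
    gcongr
    linarith
  have hdiff : ‖roughL u T δ * roughL v T δ / (1 + δ) - roughL u T s * roughL v T s / (1 + s)‖ ≤
      1 / 2 * ‖roughL u T s * roughL v T s / (1 + s)‖ := by
    refine (hA2 δ s hδ hs0).trans ?_
    have h5 : |δ - s| ≤ s := by
      rw [abs_le]; constructor <;> linarith
    calc |δ - s| * (CA * a ^ 15) ≤ s * (CA * a ^ 15) := by gcongr
      _ = q ^ 3 / a ^ 11 * (q * CA) := by rw [hs]; field_simp
      _ ≤ q ^ 3 / a ^ 11 * (Real.exp (-D) / 4) := by gcongr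
      _ = 1 / 2 * (q ^ 3 / a ^ 11 * Real.exp (-D) / 2) := by ring
      _ ≤ _ := by gcongr
  have hHs : roughL u T s * roughL v T s / (1 + s) ≠ 0 :=
    norm_pos_iff.mp (lt_of_lt_of_le (by positivity) hlow2)
  have hfin := abs_log_norm_sub_log_norm_le hHs hdiff
  rw [hlogH δ hδ, hlogH s hs0] at hfin
  have l1 := hlog1 δ hδ (hδs.trans hs1)
  have l2 := hlog1 s hs0 hs1
  rw [abs_le] at *
  constructor <;> linarith

/-- Equidistribution in logarithmic scale from square-root cancellation in the partial sums of the
convolution `u * v` and a `3-4-1` inequality. -/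
theorem exists_abs_truncSum_sub_le (K : ℝ) (hK : 0 ≤ K) : ∃ C C₁ : ℝ, 0 ≤ C ∧ 1 ≤ C₁ ∧
    ∀ a : ℝ, 11 / 10 ≤ a →
    ∀ u v u₂ v₂ : ℕ →*₀ ℂ, (∀ n, ‖u n‖ ≤ 1) → (∀ n, ‖v n‖ ≤ 1) →
    (∀ n, ‖u₂ n‖ ≤ 1) → (∀ n, ‖v₂ n‖ ≤ 1) →
    (∀ X : ℝ, 0 ≤ X → ‖psum (toArith u * toArith v) X‖ ≤ K * Real.exp (a ^ 13) * Real.sqrt X) →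
    (∀ X : ℝ, 0 ≤ X → ‖psum (toArith u * toArith v) X‖ ≤ K * X) →
    (∀ X : ℝ, 0 ≤ X → ‖psum (toArith u₂ * toArith v₂) X‖ ≤ K * Real.exp (a ^ 13) * Real.sqrt X) →
    (∀ X : ℝ, 0 ≤ X → ‖psum (toArith u₂ * toArith v₂) X‖ ≤ K * X) →
    (∀ p : ℕ, p.Prime → p ≠ 2 → 0 ≤ 3 * (1 + (chiHom p).re) + 4 * ((u p).re + (v p).re) +
      ((u₂ p).re + (v₂ p).re)) →
    ∀ T₁ T₂ : ℝ, C₁ * a ^ 26 ≤ T₁ → C₁ * a ^ 26 ≤ T₂ →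
    |truncSum (fun p ↦ (u p).re) (Real.exp T₁) + truncSum (fun p ↦ (v p).re) (Real.exp T₁) -
      (truncSum (fun p ↦ (u p).re) (Real.exp T₂) + truncSum (fun p ↦ (v p).re) (Real.exp T₂))| ≤
      C := by
  obtain ⟨q, hq0, hq1, hq⟩ := abs_log_norm_roughL_sub_star_le K hK
  obtain ⟨CE, hCE0, hCE⟩ := abs_log_norm_roughL_sub_sub_le
  obtain ⟨CT, hCT0, hCT⟩ := abs_truncSum_sub_primeSum_le
  refine ⟨4 + 8 * CE + 4 * CT, 1 / q ^ 4, by positivity,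
    one_le_one_div (by positivity) (pow_le_one₀ hq0.le hq1), ?_⟩
  intro a ha u v u₂ v₂ hu hv hu₂ hv₂ hS1 hS2 hS3 hS4 h341
  have h := hq a ha u v u₂ v₂ hu hv hu₂ hv₂ hS1 hS2 hS3 hS4 h341
  have ha1 : 1 ≤ a := by linarith
  have ha0 : 0 < a := by linarith
  have hT1 : (1 : ℝ) ≤ a ^ 12 := one_le_pow₀ ha1
  set s := q ^ 4 / a ^ 26 with hs
  have hs0 : 0 < s := by positivity
  have hsT1 : s ≤ 1 / a ^ 12 := by
    have : s * a ^ 12 = q ^ 4 / a ^ 14 := by rw [hs]; field_simp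
    rw [le_div_iff₀ (by positivity), this]
    exact (div_le_self (by positivity) (one_le_pow₀ ha1)).trans (pow_le_one₀ hq0.le hq1)
  have hre (w : ℕ →*₀ ℂ) (hw : ∀ n, ‖w n‖ ≤ 1) (n : ℕ) : |(w n).re| ≤ 1 :=
    (Complex.abs_re_le_norm _).trans (hw n)
  have key (T₁ : ℝ) (h1 : 1 / q ^ 4 * a ^ 26 ≤ T₁) :
      |truncSum (fun p ↦ (u p).re) (Real.exp T₁) + truncSum (fun p ↦ (v p).re) (Real.exp T₁) -
      (primeSum (fun p ↦ (u p).re) s + primeSum (fun p ↦ (v p).re) s)| ≤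
        2 + 4 * CE + 2 * CT := by
    have e1 : 1 / q ^ 4 * a ^ 26 = 1 / s := by rw [hs]; field_simp
    rw [e1] at h1
    have hT0 : 0 < T₁ := lt_of_lt_of_le (by positivity) h1
    have h2 : 1 / T₁ ≤ s := by
      rw [div_le_iff₀ hT0]
      rwa [div_le_iff₀ hs0, mul_comm] at h1
    have h3 : 0 < 1 / T₁ := by positivity
    have hT11 : 1 ≤ T₁ := by
      refine le_trans ?_ h1
      rw [one_le_div hs0]
      exact hsT1.trans (by rw [div_le_one (by positivity)]; exact hT1)
    have a1 := h (1 / T₁) h3 h2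
    have a2 := hCE u hu _ _ hT1 h3 (h2.trans hsT1)
    have a3 := hCE v hv _ _ hT1 h3 (h2.trans hsT1)
    have a4 := hCE u hu _ _ hT1 hs0 hsT1
    have a5 := hCE v hv _ _ hT1 hs0 hsT1
    have a6 := hCT (fun p ↦ (u p).re) (hre u hu) T₁ hT11
    have a7 := hCT (fun p ↦ (v p).re) (hre v hv) T₁ hT11
    rw [abs_le] at a1 a2 a3 a4 a5 a6 a7 ⊢
    constructor <;> linarith
  intro T₁ T₂ h1 h2
  have k1 := key T₁ h1
  have k2 := key T₂ h2
  rw [abs_le] at *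
  constructor <;> linarith

section

open MeasureTheory

lemma norm_sum_sub_integral_le {E : ℝ → ℂ} (hE1 : ∀ t, ‖E t‖ ≤ 1) {M : ℝ} (hM : 0 ≤ M)
    (hE2 : ∀ s t, ‖E s - E t‖ ≤ M * |s - t|) (hEc : Continuous E) {x : ℝ} (hx : 1 ≤ x) {t₀ : ℝ}
    (h0 : 0 ≤ t₀) (h1 : t₀ ≤ 1 / 2) :
    ‖∑ y ∈ Finset.Ico ⌈t₀ * x⌉₊ ⌈x / 2⌉₊, E (y / x) - x * ∫ t in t₀..(1 / 2), E t‖ ≤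
      2 * M + 2 := by
  have hx0 : 0 < x := by linarith
  set a := ⌈t₀ * x⌉₊ with ha
  set b := ⌈x / 2⌉₊ with hb
  have hab : a ≤ b := Nat.ceil_mono (by nlinarith)
  have hEint (s t : ℝ) : IntervalIntegrable E volume s t := hEc.intervalIntegrable s t
  have hsplit : ∑ k ∈ Finset.Ico a b, ∫ t in ((k : ℝ) / x)..(((k + 1 : ℕ) : ℝ) / x), E t =
      ∫ t in ((a : ℝ) / x)..((b : ℝ) / x), E t :=
    intervalIntegral.sum_integral_adjacent_intervals_Ico (a := fun k : ℕ ↦ (k : ℝ) / x) hab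
      fun k _ ↦ hEint _ _
  have hnb (s t : ℝ) : ‖∫ u in s..t, E u‖ ≤ |t - s| := by
    have := intervalIntegral.norm_integral_le_of_norm_le_const (a := s) (b := t) (C := 1) (f := E)
      fun u _ ↦ hE1 u
    simpa using this
  have hcell (k : ℕ) : ‖E (k / x) - x * ∫ t in ((k : ℝ) / x)..(((k + 1 : ℕ) : ℝ) / x), E t‖ ≤
      M / x := by
    have hlen : ((k + 1 : ℕ) : ℝ) / x - k / x = 1 / x := by push_cast; field_simp; ring
    have h2 : E (k / x) = x * ∫ t in ((k : ℝ) / x)..(((k + 1 : ℕ) : ℝ) / x), E (k / x) := by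
      rw [intervalIntegral.integral_const, hlen, Complex.real_smul]
      have hxc : (x : ℂ) ≠ 0 := by exact_mod_cast hx0.ne'
      push_cast
      rw [← mul_assoc, mul_one_div_cancel hxc, one_mul]
    rw [h2, ← mul_sub, ← intervalIntegral.integral_sub (by simp) (hEint _ _), norm_mul,
      Complex.norm_real, Real.norm_of_nonneg hx0.le]
    have h3 : ‖∫ t in ((k : ℝ) / x)..(((k + 1 : ℕ) : ℝ) / x), (E (k / x) - E t)‖ ≤
        M / x * |((k + 1 : ℕ) : ℝ) / x - k / x| := by
      refine intervalIntegral.norm_integral_le_of_norm_le_const fun t ht ↦ ?_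
      have hle : (k : ℝ) / x ≤ ((k + 1 : ℕ) : ℝ) / x := by
        have : 0 < 1 / x := by positivity
        linarith
      rw [Set.uIoc_of_le hle] at ht
      refine (hE2 _ _).trans ?_
      rw [div_eq_mul_one_div M]
      gcongr
      rw [abs_le]
      constructor <;> linarith [ht.1, ht.2]
    rw [hlen, abs_of_pos (by positivity)] at h3
    calc _ ≤ x * (M / x * (1 / x)) := by gcongr
      _ = _ := by field_simp
  have hsum : ‖∑ y ∈ Finset.Ico a b, E (y / x) - x * ∫ t in ((a : ℝ) / x)..((b : ℝ) / x), E t‖ ≤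
      2 * M := by
    rw [← hsplit, Finset.mul_sum, ← Finset.sum_sub_distrib]
    refine (norm_sum_le_of_le _ fun k _ ↦ hcell k).trans ?_
    rw [Finset.sum_const, Nat.card_Ico, nsmul_eq_mul, Nat.cast_sub hab]
    have hb1 : (b : ℝ) < x / 2 + 1 := Nat.ceil_lt_add_one (by positivity)
    have ha0 : (0 : ℝ) ≤ a := by positivity
    rw [mul_div_assoc', div_le_iff₀ hx0]
    nlinarith
  have e1 : ∫ t in t₀..(1 / 2), E t = (∫ t in t₀..((a : ℝ) / x), E t) +
      (∫ t in ((a : ℝ) / x)..((b : ℝ) / x), E t) + ∫ t in ((b : ℝ) / x)..(1 / 2), E t := by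
    rw [intervalIntegral.integral_add_adjacent_intervals (hEint _ _) (hEint _ _),
      intervalIntegral.integral_add_adjacent_intervals (hEint _ _) (hEint _ _)]
  have b1 : ‖x * ∫ t in t₀..((a : ℝ) / x), E t‖ ≤ 1 := by
    rw [norm_mul, Complex.norm_real, Real.norm_of_nonneg hx0.le]
    have h2 : t₀ * x ≤ a := Nat.le_ceil _
    have h3 : (a : ℝ) < t₀ * x + 1 := Nat.ceil_lt_add_one (by positivity)
    calc _ ≤ x * |(a : ℝ) / x - t₀| := by gcongr; exact hnb _ _
      _ = |x * (a / x - t₀)| := by rw [abs_mul, abs_of_pos hx0]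
      _ = |(a : ℝ) - t₀ * x| := by congr 1; field_simp
      _ ≤ 1 := by rw [abs_le]; constructor <;> linarith
  have b2 : ‖x * ∫ t in ((b : ℝ) / x)..(1 / 2), E t‖ ≤ 1 := by
    rw [norm_mul, Complex.norm_real, Real.norm_of_nonneg hx0.le]
    have h2 : x / 2 ≤ b := Nat.le_ceil _
    have h3 : (b : ℝ) < x / 2 + 1 := Nat.ceil_lt_add_one (by positivity)
    calc _ ≤ x * |1 / 2 - (b : ℝ) / x| := by gcongr; exact hnb _ _
      _ = |x * (1 / 2 - b / x)| := by rw [abs_mul, abs_of_pos hx0]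
      _ = |x / 2 - (b : ℝ)| := by congr 1; field_simp
      _ ≤ 1 := by rw [abs_le]; constructor <;> linarith
  have e2 : ∑ y ∈ Finset.Ico a b, E (y / x) - x * ∫ t in t₀..(1 / 2), E t =
      (∑ y ∈ Finset.Ico a b, E (y / x) - x * ∫ t in ((a : ℝ) / x)..((b : ℝ) / x), E t) -
        x * (∫ t in t₀..((a : ℝ) / x), E t) - x * ∫ t in ((b : ℝ) / x)..(1 / 2), E t := by
    rw [e1]; ring
  rw [e2]
  refine (norm_sub_le _ _).trans ?_
  have := norm_sub_le (∑ y ∈ Finset.Ico a b, E (y / x) -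
    x * ∫ t in ((a : ℝ) / x)..((b : ℝ) / x), E t) (x * (∫ t in t₀..((a : ℝ) / x), E t))
  linarith

/-- The smallest slope `t ≥ 0` with `x² (1 - 2 t²) ≤ X`. -/
def minSlope (X x : ℝ) : ℝ := Real.sqrt ((1 - X / x ^ 2) / 2)

lemma minSlope_le_iff {X x t : ℝ} (hx : 0 < x) (ht : 0 ≤ t) :
    minSlope X x ≤ t ↔ x ^ 2 * (1 - 2 * t ^ 2) ≤ X := by
  rw [minSlope, Real.sqrt_le_left ht]
  constructor
  · intro h
    have h1 : 1 - 2 * t ^ 2 ≤ X / x ^ 2 := by linarith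
    rw [le_div_iff₀ (by positivity)] at h1
    linarith
  · intro h
    have h1 : 1 - 2 * t ^ 2 ≤ X / x ^ 2 := by
      rw [le_div_iff₀ (by positivity)]
      linarith
    linarith

/-- The sum of `E (y / x)` over the lattice points in the sector `0 ≤ 2y < x` for which `d ∣ x` and
`x² - 2y² ≤ X`. -/
def sectorSum (E : ℝ → ℂ) (d : ℕ) (X : ℝ) : ℂ :=
  ∑ m ∈ Finset.Icc 1 ⌊Real.sqrt (2 * X) / d⌋₊,
    ∑ y ∈ Finset.Ico ⌈minSlope X (d * m) * (d * m)⌉₊ ⌈(d * m : ℝ) / 2⌉₊, E (y / (d * m))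

lemma norm_sectorSum_le_mul {E : ℝ → ℂ} (hE1 : ∀ t, ‖E t‖ ≤ 1) {d : ℕ} (hd : 0 < d) {X : ℝ}
    (hX : 0 ≤ X) : ‖sectorSum E d X‖ ≤ 2 * X / d := by
  set N := ⌊Real.sqrt (2 * X) / d⌋₊ with hN
  have hd0 : (0 : ℝ) < d := by exact_mod_cast hd
  have hNle : (N : ℝ) ≤ Real.sqrt (2 * X) / d := Nat.floor_le (by positivity)
  have h1 : ‖sectorSum E d X‖ ≤ ∑ m ∈ Finset.Icc 1 N, (d * N : ℝ) := by
    refine norm_sum_le_of_le _ fun m hm ↦ ?_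
    rw [Finset.mem_Icc] at hm
    refine (norm_sum_le_of_le _ fun y _ ↦ hE1 _).trans ?_
    rw [Finset.sum_const, Nat.card_Ico, nsmul_eq_mul, mul_one]
    have h2 : ⌈(d * m : ℝ) / 2⌉₊ ≤ d * m := by
      rw [Nat.ceil_le]
      push_cast
      have : (0 : ℝ) ≤ d * m := by positivity
      linarith
    have h3 : ⌈(d * m : ℝ) / 2⌉₊ - ⌈minSlope X (d * m) * (d * m)⌉₊ ≤ d * N :=
      (Nat.sub_le _ _).trans (h2.trans (Nat.mul_le_mul_left d hm.2))
    exact_mod_cast h3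
  refine h1.trans ?_
  rw [Finset.sum_const, Nat.card_Icc, nsmul_eq_mul, Nat.add_sub_cancel]
  calc (N : ℝ) * (d * N) ≤ (Real.sqrt (2 * X) / d) * (d * (Real.sqrt (2 * X) / d)) := by gcongr
    _ = Real.sqrt (2 * X) ^ 2 / d := by field_simp
    _ = _ := by rw [Real.sq_sqrt (by positivity)]

lemma abs_sum_Icc_ite_sub_le {d : ℕ} (hd : 0 < d) {Z : ℝ} (hZ : 0 ≤ Z) {N : ℕ} (hN : ⌊Z / d⌋₊ ≤ N) :
    |∑ m ∈ Finset.Icc 1 N, (if (d * m : ℝ) ≤ Z then (d * m : ℝ) else 0) - Z ^ 2 / (2 * d)| ≤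
      Z + d := by
  have hd0 : (0 : ℝ) < d := by exact_mod_cast hd
  set k := ⌊Z / d⌋₊ with hk
  have h1 : ∑ m ∈ Finset.Icc 1 N, (if (d * m : ℝ) ≤ Z then (d * m : ℝ) else 0) =
      d * (k * (k + 1) / 2) := by
    rw [← Finset.sum_filter]
    have : (Finset.Icc 1 N).filter (fun m : ℕ ↦ (d * m : ℝ) ≤ Z) = Finset.Icc 1 k := by
      ext m
      rw [Finset.mem_filter, Finset.mem_Icc, Finset.mem_Icc]
      have hiff : (d * m : ℝ) ≤ Z ↔ m ≤ k := by
        rw [hk, Nat.le_floor_iff (by positivity), le_div_iff₀ hd0, mul_comm]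
      rw [hiff]
      constructor
      · rintro ⟨⟨h2, h3⟩, h4⟩; exact ⟨h2, h4⟩
      · rintro ⟨h2, h3⟩; exact ⟨⟨h2, h3.trans hN⟩, h3⟩
    rw [this, ← Finset.mul_sum]
    congr 1
    clear_value k
    clear hN hk this
    induction k with
    | zero => simp
    | succ n ih => rw [Finset.sum_Icc_succ_top (by omega), ih]; push_cast; ring
  rw [h1]
  have h2 : (k : ℝ) ≤ Z / d := Nat.floor_le (by positivity)
  have h3 : Z / d < k + 1 := Nat.lt_floor_add_one _
  obtain ⟨w, rfl⟩ : ∃ w, Z = d * w := ⟨Z / d, by field_simp⟩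
  rw [mul_div_cancel_left₀ _ hd0.ne'] at h2 h3
  have h4 : d * (k * (k + 1) / 2 : ℝ) - (d * w) ^ 2 / (2 * d) =
      d * ((k * (k + 1) - w ^ 2) / 2) := by
    field_simp
  have hk0 : (0 : ℝ) ≤ k := by positivity
  have h5 : |(k * (k + 1) - w ^ 2) / 2| ≤ w + 1 := by
    rw [abs_le]; constructor <;> nlinarith
  rw [h4, abs_mul, abs_of_pos hd0]
  nlinarith

lemma norm_sectorSum_le {E : ℝ → ℂ} (hE1 : ∀ t, ‖E t‖ ≤ 1) {M : ℝ} (hM : 0 ≤ M)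
    (hE2 : ∀ s t, ‖E s - E t‖ ≤ M * |s - t|) (hEc : Continuous E)
    (hE0 : ∫ t in (0 : ℝ)..(1 / 2), E t * ((1 / (1 - 2 * t ^ 2) : ℝ) : ℂ) = 0)
    {d : ℕ} (hd : 0 < d) {X : ℝ} (hX : 0 ≤ X) :
    ‖sectorSum E d X‖ ≤ (2 * M + 3) * Real.sqrt (2 * X) + d := by
  set N := ⌊Real.sqrt (2 * X) / d⌋₊ with hN
  have hd0 : (0 : ℝ) < d := by exact_mod_cast hd
  have hd1 : (1 : ℝ) ≤ d := by exact_mod_cast hd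
  have hNle : (N : ℝ) ≤ Real.sqrt (2 * X) / d := Nat.floor_le (by positivity)
  have hmX (m : ℕ) (hm : m ∈ Finset.Icc 1 N) : (d * m : ℝ) ^ 2 ≤ 2 * X := by
    rw [Finset.mem_Icc] at hm
    have h1 : (m : ℝ) ≤ N := by exact_mod_cast hm.2
    have h2 := h1.trans hNle
    rw [le_div_iff₀ hd0, mul_comm] at h2
    rw [← Real.sq_sqrt (show 0 ≤ 2 * X by positivity)]
    gcongr
  have hm0 (m : ℕ) (hm : m ∈ Finset.Icc 1 N) : (1 : ℝ) ≤ d * m := by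
    rw [Finset.mem_Icc] at hm
    have h1 : (1 : ℝ) ≤ m := by exact_mod_cast hm.1
    nlinarith
  have hA (m : ℕ) (hm : m ∈ Finset.Icc 1 N) :
      ‖(∑ y ∈ Finset.Ico ⌈minSlope X (d * m) * (d * m)⌉₊ ⌈(d * m : ℝ) / 2⌉₊, E (y / (d * m))) -
        ((d * m : ℝ) : ℂ) * ∫ t in (minSlope X (d * m))..(1 / 2), E t‖ ≤ 2 * M + 2 := by
    refine norm_sum_sub_integral_le hE1 hM hE2 hEc (hm0 m hm) (Real.sqrt_nonneg _) ?_
    rw [minSlope_le_iff (by linarith [hm0 m hm]) (by norm_num)]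
    linarith [hmX m hm]
  have hB (m : ℕ) (hm : m ∈ Finset.Icc 1 N) :
      ((d * m : ℝ) : ℂ) * ∫ t in (minSlope X (d * m))..(1 / 2), E t =
        ∫ t in Set.Icc (0 : ℝ) (1 / 2), E t *
          ((if (d * m : ℝ) ≤ Real.sqrt (X / (1 - 2 * t ^ 2)) then (d * m : ℝ) else 0 : ℝ) : ℂ) := by
    have hx := hm0 m hm
    have hms : minSlope X (d * m) ≤ 1 / 2 := by
      rw [minSlope_le_iff (by linarith) (by norm_num)]
      linarith [hmX m hm]
    have hms0 : 0 ≤ minSlope X (d * m) := Real.sqrt_nonneg _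
    rw [intervalIntegral.integral_of_le hms, ← integral_Icc_eq_integral_Ioc]
    have hset : Set.Icc (minSlope X (d * m)) (1 / 2) =
        Set.Icc (0 : ℝ) (1 / 2) ∩ Set.Ici (minSlope X (d * m)) := by
      ext t
      simp only [Set.mem_Icc, Set.mem_inter_iff, Set.mem_Ici]
      constructor
      · rintro ⟨h1, h2⟩; exact ⟨⟨hms0.trans h1, h2⟩, h1⟩
      · rintro ⟨⟨h1, h2⟩, h3⟩; exact ⟨h3, h2⟩
    rw [hset, ← setIntegral_indicator measurableSet_Ici, ← integral_const_mul]
    refine setIntegral_congr_fun measurableSet_Icc fun t ht ↦ ?_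
    have h12 : 0 < 1 - 2 * t ^ 2 := by nlinarith [ht.1, ht.2]
    have hiff : minSlope X (d * m) ≤ t ↔ (d * m : ℝ) ≤ Real.sqrt (X / (1 - 2 * t ^ 2)) := by
      rw [minSlope_le_iff (by linarith) ht.1, Real.le_sqrt' (by linarith), le_div_iff₀ h12]
    by_cases h : minSlope X (d * m) ≤ t
    · have h2 := hiff.mp h
      rw [Set.indicator_of_mem (Set.mem_Ici.mpr h), if_pos h2, mul_comm]
    · have h2 := fun h' ↦ h (hiff.mpr h')
      simp only [Set.indicator_of_notMem (fun h' ↦ h (Set.mem_Ici.mp h')), if_neg h2, mul_zero,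
        Complex.ofReal_zero]
  set W : ℝ → ℝ := fun t ↦ ∑ m ∈ Finset.Icc 1 N,
    (if (d * m : ℝ) ≤ Real.sqrt (X / (1 - 2 * t ^ 2)) then (d * m : ℝ) else 0) with hW
  have hEm : Measurable E := hEc.measurable
  have hmeas (m : ℕ) : Measurable fun t : ℝ ↦
      (if (d * m : ℝ) ≤ Real.sqrt (X / (1 - 2 * t ^ 2)) then (d * m : ℝ) else 0) :=
    Measurable.ite (measurableSet_le measurable_const (by fun_prop)) measurable_const
      measurable_const
  have hbdd {f : ℝ → ℂ} (hf : Measurable f) (c : ℝ) (hc : ∀ t, ‖f t‖ ≤ c) :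
      IntegrableOn f (Set.Icc (0 : ℝ) (1 / 2)) :=
    Measure.integrableOn_of_bounded (by simp) hf.aestronglyMeasurable
      (Filter.Eventually.of_forall hc)
  have hintm (m : ℕ) : IntegrableOn (fun t ↦ E t *
      ((if (d * m : ℝ) ≤ Real.sqrt (X / (1 - 2 * t ^ 2)) then (d * m : ℝ) else 0 : ℝ) : ℂ))
      (Set.Icc (0 : ℝ) (1 / 2)) := by
    refine hbdd (hEm.mul (Complex.measurable_ofReal.comp (hmeas m))) (d * m) fun t ↦ ?_
    rw [norm_mul, Complex.norm_real]
    have h1 : ‖(if (d * m : ℝ) ≤ Real.sqrt (X / (1 - 2 * t ^ 2)) then (d * m : ℝ) else 0)‖ ≤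
        d * m := by
      split_ifs
      · rw [Real.norm_of_nonneg (by positivity)]
      · rw [norm_zero]; positivity
    calc _ ≤ 1 * (d * m : ℝ) := by gcongr; exact hE1 t
      _ = _ := one_mul _
  have hsumW : ∑ m ∈ Finset.Icc 1 N, ((d * m : ℝ) : ℂ) * ∫ t in (minSlope X (d * m))..(1 / 2), E t =
      ∫ t in Set.Icc (0 : ℝ) (1 / 2), E t * (W t : ℂ) := by
    rw [Finset.sum_congr rfl hB, ← integral_finsetSum _ fun m _ ↦ hintm m]
    refine integral_congr_ae (Filter.Eventually.of_forall fun t ↦ ?_)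
    simp only [hW, Complex.ofReal_sum, Finset.mul_sum]
  have hWint : IntegrableOn (fun t ↦ E t * (W t : ℂ)) (Set.Icc (0 : ℝ) (1 / 2)) := by
    have := integrable_finsetSum (Finset.Icc 1 N) fun m _ ↦ hintm m
    refine this.congr (Filter.Eventually.of_forall fun t ↦ ?_)
    simp only [hW, Complex.ofReal_sum, Finset.mul_sum]
  have h0int : IntegrableOn (fun t ↦ E t * ((1 / (1 - 2 * t ^ 2) : ℝ) : ℂ))
      (Set.Icc (0 : ℝ) (1 / 2)) := by
    refine ContinuousOn.integrableOn_compact isCompact_Icc ?_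
    refine hEc.continuousOn.mul (Complex.continuous_ofReal.comp_continuousOn ?_)
    refine continuousOn_const.div (by fun_prop) fun t ht ↦ ?_
    have : 0 < 1 - 2 * t ^ 2 := by nlinarith [ht.1, ht.2]
    exact this.ne'
  have hzero : ∫ t in Set.Icc (0 : ℝ) (1 / 2), E t * ((1 / (1 - 2 * t ^ 2) : ℝ) : ℂ) = 0 := by
    rw [integral_Icc_eq_integral_Ioc, ← intervalIntegral.integral_of_le (by norm_num)]
    exact hE0
  have hmain : ‖∫ t in Set.Icc (0 : ℝ) (1 / 2), E t * (W t : ℂ)‖ ≤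
      (Real.sqrt (2 * X) + d) * (1 / 2) := by
    have e1 : ∫ t in Set.Icc (0 : ℝ) (1 / 2), E t * (W t : ℂ) =
        ∫ t in Set.Icc (0 : ℝ) (1 / 2), (E t * (W t : ℂ) -
          ((X / (2 * d) : ℝ) : ℂ) * (E t * ((1 / (1 - 2 * t ^ 2) : ℝ) : ℂ))) := by
      rw [integral_sub hWint (h0int.const_mul _), integral_const_mul, hzero, mul_zero, sub_zero]
    rw [e1]
    have := norm_setIntegral_le_of_norm_le_const (μ := volume) (s := Set.Icc (0 : ℝ) (1 / 2))
      (f := fun t ↦ E t * (W t : ℂ) -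
          ((X / (2 * d) : ℝ) : ℂ) * (E t * ((1 / (1 - 2 * t ^ 2) : ℝ) : ℂ)))
      (C := Real.sqrt (2 * X) + d) (by simp) ?_
    · simpa using this
    · intro t ht
      have h12 : 1 / 2 ≤ 1 - 2 * t ^ 2 := by nlinarith [ht.1, ht.2]
      have hZ : Real.sqrt (X / (1 - 2 * t ^ 2)) ≤ Real.sqrt (2 * X) := by
        apply Real.sqrt_le_sqrt
        rw [div_le_iff₀ (by linarith)]
        nlinarith
      have hab := abs_sum_Icc_ite_sub_le hd (Real.sqrt_nonneg (X / (1 - 2 * t ^ 2))) (N := N)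
        (Nat.floor_le_floor (by gcongr))
      rw [Real.sq_sqrt (div_nonneg hX (by linarith))] at hab
      have e2 : E t * (W t : ℂ) -
          ((X / (2 * d) : ℝ) : ℂ) * (E t * ((1 / (1 - 2 * t ^ 2) : ℝ) : ℂ)) =
          E t * ((W t - X / (1 - 2 * t ^ 2) / (2 * d) : ℝ) : ℂ) := by
        have : X / (1 - 2 * t ^ 2) / (2 * d) = (X / (2 * d)) * (1 / (1 - 2 * t ^ 2)) := by
          field_simp
        rw [this]
        push_cast
        ring
      rw [e2, norm_mul, Complex.norm_real]
      calc _ ≤ 1 * (Real.sqrt (X / (1 - 2 * t ^ 2)) + d) := by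
            gcongr
            · exact hE1 t
            · exact hab
        _ ≤ _ := by linarith
  have hdiff : ‖sectorSum E d X - ∫ t in Set.Icc (0 : ℝ) (1 / 2), E t * (W t : ℂ)‖ ≤
      N * (2 * M + 2) := by
    rw [← hsumW, sectorSum, ← Finset.sum_sub_distrib]
    refine (norm_sum_le_of_le _ hA).trans ?_
    rw [Finset.sum_const, Nat.card_Icc, nsmul_eq_mul, Nat.add_sub_cancel]
  have hN2 : (N : ℝ) ≤ Real.sqrt (2 * X) := hNle.trans (div_le_self (Real.sqrt_nonneg _) hd1)
  have htri := norm_add_le (sectorSum E d X - ∫ t in Set.Icc (0 : ℝ) (1 / 2), E t * (W t : ℂ))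
    (∫ t in Set.Icc (0 : ℝ) (1 / 2), E t * (W t : ℂ))
  rw [sub_add_cancel] at htri
  nlinarith [Real.sqrt_nonneg (2 * X)]

end

section

open MeasureTheory

/-- The logarithm of the ratio of the conjugates of `1 + t√2`. -/
def ratioLog (t : ℝ) : ℝ := Real.log ((1 + t * Real.sqrt 2) / (1 - t * Real.sqrt 2))

lemma mul_sqrt_two_lt_one {t : ℝ} (ht1 : t ≤ 1 / 2) : t * Real.sqrt 2 < 1 := by
  have h : Real.sqrt 2 < 2 := by
    rw [Real.sqrt_lt' (by norm_num)]; norm_num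
  have h0 := Real.sqrt_nonneg 2
  nlinarith

lemma hasDerivAt_ratioLog {t : ℝ} (ht0 : 0 ≤ t) (ht1 : t ≤ 1 / 2) :
    HasDerivAt ratioLog (2 * Real.sqrt 2 * (1 / (1 - 2 * t ^ 2))) t := by
  have h0 := Real.sqrt_nonneg 2
  have h1 : 0 < 1 - t * Real.sqrt 2 := by linarith [mul_sqrt_two_lt_one ht1]
  have h2 : 0 < 1 + t * Real.sqrt 2 := by positivity
  have hs : Real.sqrt 2 ^ 2 = 2 := Real.sq_sqrt (by norm_num)
  have h12 : 0 < 1 - 2 * t ^ 2 := by nlinarith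
  have hd1 : HasDerivAt (fun t : ℝ ↦ 1 + t * Real.sqrt 2) (Real.sqrt 2) t := by
    simpa using ((hasDerivAt_id t).mul_const (Real.sqrt 2)).const_add 1
  have hd2 : HasDerivAt (fun t : ℝ ↦ 1 - t * Real.sqrt 2) (-Real.sqrt 2) t := by
    simpa using ((hasDerivAt_id t).mul_const (Real.sqrt 2)).const_sub 1
  have := (hd1.div hd2 h1.ne').log (div_pos h2 h1).ne'
  refine this.congr_deriv ?_
  simp only [Pi.div_apply]
  have e : 1 - 2 * t ^ 2 = (1 + t * Real.sqrt 2) * (1 - t * Real.sqrt 2) := by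
    linear_combination t ^ 2 * hs
  rw [e]
  field_simp
  ring

/-- The truncation of `t` to the interval `[0, 1/2]`. -/
def clamp (t : ℝ) : ℝ := max 0 (min t (1 / 2))

lemma clamp_nonneg (t : ℝ) : 0 ≤ clamp t := le_max_left _ _

lemma clamp_le (t : ℝ) : clamp t ≤ 1 / 2 := max_le (by norm_num) (min_le_right _ _)

lemma clamp_of_mem {t : ℝ} (h0 : 0 ≤ t) (h1 : t ≤ 1 / 2) : clamp t = t := by
  rw [clamp, min_eq_left h1, max_eq_right h0]

lemma abs_clamp_sub_le (s t : ℝ) : |clamp s - clamp t| ≤ |s - t| := by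
  unfold clamp
  generalize (1 / 2 : ℝ) = c
  grind

/-- The character value at a lattice point of slope `t`, extended constantly outside `[0, 1/2]`. -/
def slopePhase (ν t : ℝ) : ℂ := Complex.exp ((ν * ratioLog (clamp t) : ℝ) * Complex.I)

lemma norm_slopePhase (ν t : ℝ) : ‖slopePhase ν t‖ = 1 := Complex.norm_exp_ofReal_mul_I _

lemma abs_ratioLog_sub_le {s t : ℝ} (hs0 : 0 ≤ s) (hs1 : s ≤ 1 / 2) (ht0 : 0 ≤ t)
    (ht1 : t ≤ 1 / 2) : |ratioLog s - ratioLog t| ≤ 6 * |s - t| := by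
  have := (convex_Icc (0 : ℝ) (1 / 2)).norm_image_sub_le_of_norm_hasDerivWithin_le
    (f := ratioLog) (f' := fun t ↦ 2 * Real.sqrt 2 * (1 / (1 - 2 * t ^ 2))) (C := 6)
    (fun x hx ↦ (hasDerivAt_ratioLog hx.1 hx.2).hasDerivWithinAt) ?_ ⟨ht0, ht1⟩ ⟨hs0, hs1⟩
  · simpa using this
  · intro x hx
    have h12 : 1 / 2 ≤ 1 - 2 * x ^ 2 := by nlinarith [hx.1, hx.2]
    have h2 : Real.sqrt 2 ≤ 3 / 2 := by
      rw [Real.sqrt_le_left (by norm_num)]; norm_num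
    have h3 : 1 / (1 - 2 * x ^ 2) ≤ 2 := by
      rw [div_le_iff₀ (by linarith)]; linarith
    have h4 : 0 < 1 / (1 - 2 * x ^ 2) := by
      have : 0 < 1 - 2 * x ^ 2 := by linarith
      positivity
    rw [Real.norm_of_nonneg (by positivity)]
    nlinarith [Real.sqrt_nonneg 2]

lemma norm_exp_mul_I_sub_le (a b : ℝ) :
    ‖Complex.exp (a * Complex.I) - Complex.exp (b * Complex.I)‖ ≤ |a - b| := by
  have h : Complex.exp (a * Complex.I) - Complex.exp (b * Complex.I) =
      Complex.exp (b * Complex.I) * (Complex.exp (Complex.I * ((a - b : ℝ) : ℂ)) - 1) := by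
    rw [mul_sub, ← Complex.exp_add, mul_one]
    congr 2
    push_cast
    ring
  rw [h, norm_mul, Complex.norm_exp_ofReal_mul_I, one_mul]
  exact Real.norm_exp_I_mul_ofReal_sub_one_le

lemma norm_slopePhase_sub_le {ν : ℝ} (hν : 0 ≤ ν) (s t : ℝ) :
    ‖slopePhase ν s - slopePhase ν t‖ ≤ 6 * ν * |s - t| := by
  refine (norm_exp_mul_I_sub_le _ _).trans ?_
  rw [← mul_sub, abs_mul, abs_of_nonneg hν]
  have h1 := abs_ratioLog_sub_le (clamp_nonneg s) (clamp_le s) (clamp_nonneg t) (clamp_le t)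
  have h2 := abs_clamp_sub_le s t
  calc _ ≤ ν * (6 * |s - t|) := by gcongr; linarith
    _ = _ := by ring

lemma continuous_slopePhase {ν : ℝ} (hν : 0 ≤ ν) : Continuous (slopePhase ν) := by
  have : LipschitzWith (Real.toNNReal (6 * ν)) (slopePhase ν) := by
    refine LipschitzWith.of_dist_le_mul fun s t ↦ ?_
    rw [Real.coe_toNNReal _ (by positivity), dist_eq_norm, Real.dist_eq]
    exact norm_slopePhase_sub_le hν s t
  exact this.continuous

lemma ratioLog_half : ratioLog (1 / 2) = 2 * Real.log (1 + Real.sqrt 2) := by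
  have hs : Real.sqrt 2 ^ 2 = 2 := Real.sq_sqrt (by norm_num)
  have h1 : 0 < 1 - 1 / 2 * Real.sqrt 2 := by linarith [mul_sqrt_two_lt_one (le_refl (1 / 2))]
  have h : (1 + 1 / 2 * Real.sqrt 2) / (1 - 1 / 2 * Real.sqrt 2) = (1 + Real.sqrt 2) ^ 2 := by
    rw [div_eq_iff h1.ne']
    linear_combination (1 / 2 * Real.sqrt 2) * hs
  rw [ratioLog, h, Real.log_pow]
  norm_num

lemma log_one_add_sqrt_two_pos : 0 < Real.log (1 + Real.sqrt 2) := by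
  apply Real.log_pos
  have : 0 < Real.sqrt 2 := by positivity
  linarith

/-- The frequency of the `l`-th Hecke character of `ℤ[√2]`. -/
def freq (l : ℕ) : ℝ := Real.pi * l / Real.log (1 + Real.sqrt 2)

lemma freq_nonneg (l : ℕ) : 0 ≤ freq l := by
  have := log_one_add_sqrt_two_pos
  have := Real.pi_pos
  unfold freq
  positivity

lemma freq_mul (l : ℕ) : freq l * Real.log (1 + Real.sqrt 2) = Real.pi * l := by
  have := log_one_add_sqrt_two_pos
  unfold freq
  field_simp

lemma integral_slopePhase {l : ℕ} (hl : l ≠ 0) :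
    ∫ t in (0 : ℝ)..(1 / 2), slopePhase (freq l) t * ((1 / (1 - 2 * t ^ 2) : ℝ) : ℂ) = 0 := by
  have hν : freq l ≠ 0 := by
    intro h
    have := freq_mul l
    rw [h, zero_mul] at this
    have h2 : Real.pi * l ≠ 0 := by positivity
    exact h2 this.symm
  set c : ℂ := (freq l : ℂ) * (2 * Real.sqrt 2 : ℝ) * Complex.I with hc
  have hc0 : c ≠ 0 := by
    have h2 : (2 * Real.sqrt 2 : ℝ) ≠ 0 := by positivity
    exact mul_ne_zero (mul_ne_zero (Complex.ofReal_ne_zero.mpr hν)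
      (Complex.ofReal_ne_zero.mpr h2)) Complex.I_ne_zero
  have hderiv (t : ℝ) (ht : t ∈ Set.uIcc (0 : ℝ) (1 / 2)) :
      HasDerivAt (fun t ↦ Complex.exp ((freq l * ratioLog t : ℝ) * Complex.I))
        (c * (Complex.exp ((freq l * ratioLog t : ℝ) * Complex.I) *
          ((1 / (1 - 2 * t ^ 2) : ℝ) : ℂ))) t := by
    rw [Set.uIcc_of_le (by norm_num)] at ht
    have h1 := (((hasDerivAt_ratioLog ht.1 ht.2).const_mul (freq l)).ofReal_comp.mul_const
      Complex.I).cexp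
    refine h1.congr_deriv ?_
    rw [hc]
    push_cast
    ring
  have hcont : ContinuousOn (fun t : ℝ ↦ Complex.exp ((freq l * ratioLog t : ℝ) * Complex.I) *
      ((1 / (1 - 2 * t ^ 2) : ℝ) : ℂ)) (Set.uIcc (0 : ℝ) (1 / 2)) := by
    refine ContinuousOn.mul (fun t ht ↦ (hderiv t ht).continuousAt.continuousWithinAt) ?_
    refine Complex.continuous_ofReal.comp_continuousOn ?_
    refine continuousOn_const.div (by fun_prop) fun t ht ↦ ?_
    rw [Set.uIcc_of_le (by norm_num)] at ht
    have : 0 < 1 - 2 * t ^ 2 := by nlinarith [ht.1, ht.2]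
    exact this.ne'
  have hEint := intervalIntegral.integral_eq_sub_of_hasDerivAt hderiv
    (continuousOn_const.mul hcont).intervalIntegrable
  rw [intervalIntegral.integral_const_mul] at hEint
  have hend : Complex.exp ((freq l * ratioLog (1 / 2) : ℝ) * Complex.I) -
      Complex.exp ((freq l * ratioLog 0 : ℝ) * Complex.I) = 0 := by
    have h1 : freq l * ratioLog (1 / 2) = 2 * Real.pi * l := by
      rw [ratioLog_half]; linear_combination 2 * freq_mul l
    have h0 : ratioLog 0 = 0 := by simp [ratioLog]
    rw [h1, h0]
    have h2 : ((2 * Real.pi * l : ℝ) : ℂ) * Complex.I = l * (2 * Real.pi * Complex.I) := by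
      push_cast; ring
    rw [h2, Complex.exp_nat_mul_two_pi_mul_I]
    simp
  rw [hend, mul_eq_zero, or_iff_right hc0] at hEint
  rw [← hEint]
  refine intervalIntegral.integral_congr fun t ht ↦ ?_
  rw [Set.uIcc_of_le (by norm_num)] at ht
  simp only [slopePhase, clamp_of_mem ht.1 ht.2]

lemma norm_sectorSum_slopePhase_le {l : ℕ} (hl : l ≠ 0) {d : ℕ} (hd : 0 < d) {X : ℝ} (hX : 0 ≤ X) :
    ‖sectorSum (slopePhase (freq l)) d X‖ ≤ (12 * freq l + 3) * Real.sqrt (2 * X) + d := by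
  have := norm_sectorSum_le (fun t ↦ (norm_slopePhase (freq l) t).le)
    (mul_nonneg (by norm_num) (freq_nonneg l)) (norm_slopePhase_sub_le (freq_nonneg l))
    (continuous_slopePhase (freq_nonneg l)) (integral_slopePhase hl) hd hX
  linarith

end

lemma sqrt_two_mul_self : Real.sqrt 2 * Real.sqrt 2 = 2 := Real.mul_self_sqrt (by norm_num)

lemma one_lt_sqrt_two : 1 < Real.sqrt 2 := by rw [Real.lt_sqrt] <;> norm_num

lemma toR_mul (z w : Zrt2) : toR (z * w) = toR z * toR w := by
  simp only [toR, Zsqrtd.re_mul, Zsqrtd.im_mul]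
  push_cast
  linear_combination (-(z.im * w.im : ℝ)) * sqrt_two_mul_self

lemma toR_neg (z : Zrt2) : toR (-z) = -toR z := by
  simp only [toR, Zsqrtd.re_neg, Zsqrtd.im_neg]
  push_cast
  ring

lemma toR_sigma (z : Zrt2) : toR (sigma z) = z.re - z.im * Real.sqrt 2 := by
  simp only [toR, sigma]
  push_cast
  ring

lemma sigma_mul (z w : Zrt2) : sigma (z * w) = sigma z * sigma w := by
  ext <;> simp [sigma]; ring

lemma sigma_sigma (z : Zrt2) : sigma (sigma z) = z := by
  ext <;> simp [sigma]

lemma sigma_neg (z : Zrt2) : sigma (-z) = -sigma z := by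
  ext <;> simp [sigma]

lemma mul_sigma (z : Zrt2) : z * sigma z = (z.norm : Zrt2) := by
  ext <;> simp [sigma, Zsqrtd.norm] <;> ring

lemma norm_sigma (z : Zrt2) : (sigma z).norm = z.norm := by
  simp [sigma, Zsqrtd.norm]

lemma toR_mul_toR_sigma (z : Zrt2) : toR z * toR (sigma z) = z.norm := by
  rw [toR_sigma, toR, Zsqrtd.norm]
  push_cast
  linear_combination (-(z.im * z.im : ℝ)) * sqrt_two_mul_self

lemma two_ne_mul_self (n : ℤ) : (2 : ℤ) ≠ n * n := by
  intro h
  have h1 : n < 2 := by nlinarith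
  have h2 : -2 < n := by nlinarith
  interval_cases n <;> omega

lemma norm_ne_zero {z : Zrt2} (hz : z ≠ 0) : z.norm ≠ 0 :=
  fun h ↦ hz ((Zsqrtd.norm_eq_zero two_ne_mul_self z).mp h)

lemma toR_ne_zero {z : Zrt2} (hz : z ≠ 0) : toR z ≠ 0 := by
  intro h
  have h1 := toR_mul_toR_sigma z
  rw [h, zero_mul] at h1
  exact norm_ne_zero hz (by exact_mod_cast h1.symm)

lemma sigma_ne_zero {z : Zrt2} (hz : z ≠ 0) : sigma z ≠ 0 := by
  intro h
  apply norm_ne_zero hz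
  rw [← norm_sigma, h, Zsqrtd.norm_zero]

instance : IsDomain Zrt2 := by
  have : NoZeroDivisors Zrt2 := by
    refine ⟨fun {a b} h ↦ ?_⟩
    by_contra! hab
    have := toR_mul a b
    rw [h] at this
    have h0 : toR 0 = 0 := by simp [toR]
    rw [h0] at this
    exact mul_ne_zero (toR_ne_zero hab.1) (toR_ne_zero hab.2) this.symm
  exact NoZeroDivisors.to_isDomain _

/-- The logarithm of the absolute ratio of the two real embeddings. -/
def ratioArg (z : Zrt2) : ℝ := Real.log (|toR z| / |toR (sigma z)|)

lemma ratioArg_mul {z w : Zrt2} (hz : z ≠ 0) (hw : w ≠ 0) :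
    ratioArg (z * w) = ratioArg z + ratioArg w := by
  have h1 := abs_pos.mpr (toR_ne_zero hz)
  have h2 := abs_pos.mpr (toR_ne_zero hw)
  have h3 := abs_pos.mpr (toR_ne_zero (sigma_ne_zero hz))
  have h4 := abs_pos.mpr (toR_ne_zero (sigma_ne_zero hw))
  rw [ratioArg, ratioArg, ratioArg, ← Real.log_mul (div_pos h1 h3).ne' (div_pos h2 h4).ne',
    toR_mul, sigma_mul, toR_mul, abs_mul, abs_mul, mul_div_mul_comm]

lemma ratioArg_neg (z : Zrt2) : ratioArg (-z) = ratioArg z := by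
  rw [ratioArg, ratioArg, sigma_neg, toR_neg, toR_neg, abs_neg, abs_neg]

lemma ratioArg_sigma (z : Zrt2) : ratioArg (sigma z) = -ratioArg z := by
  rw [ratioArg, ratioArg, sigma_sigma, ← Real.log_inv, inv_div]

lemma ratioArg_intCast (n : ℤ) : ratioArg (n : Zrt2) = 0 := by
  have : sigma (n : Zrt2) = n := by ext <;> simp [sigma]
  have h := ratioArg_sigma (n : Zrt2)
  rw [this] at h
  linarith

/-- The additive character `ratioArg` on units. -/
def unitArg : Zrt2ˣ →* Multiplicative ℝ where
  toFun u := Multiplicative.ofAdd (ratioArg u)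
  map_one' := by
    have := ratioArg_intCast 1
    rw [Int.cast_one] at this
    rw [Units.val_one, this, ofAdd_zero]
  map_mul' u v := by
    rw [Units.val_mul, ratioArg_mul u.ne_zero v.ne_zero, ofAdd_add]

/-- The fundamental unit `1 + √2`. -/
def fundUnit : Zrt2ˣ where
  val := ⟨1, 1⟩
  inv := ⟨-1, 1⟩
  val_inv := by ext <;> simp
  inv_val := by ext <;> simp

lemma ratioArg_fundUnit : ratioArg fundUnit = 2 * Real.log (1 + Real.sqrt 2) := by
  have h1 : toR (fundUnit : Zrt2) = 1 + Real.sqrt 2 := by simp [toR, fundUnit]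
  have h2 : toR (sigma (fundUnit : Zrt2)) = 1 - Real.sqrt 2 := by
    rw [toR_sigma]; simp [fundUnit]
  have h0 := one_lt_sqrt_two
  rw [ratioArg, h1, h2, abs_of_pos (by linarith), abs_of_neg (by linarith)]
  have : (1 + Real.sqrt 2) / -(1 - Real.sqrt 2) = (1 + Real.sqrt 2) ^ 2 := by
    rw [div_eq_iff (by linarith)]
    linear_combination (-(1 + Real.sqrt 2)) * sqrt_two_mul_self
  rw [this, Real.log_pow]
  norm_num

lemma ratioArg_fundUnit_zpow (n : ℤ) :
    ratioArg (fundUnit ^ n : Zrt2ˣ) = n * (2 * Real.log (1 + Real.sqrt 2)) := by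
  have h := map_zpow unitArg fundUnit n
  have h2 : Multiplicative.ofAdd (ratioArg (fundUnit ^ n : Zrt2ˣ)) =
      Multiplicative.ofAdd (n • ratioArg fundUnit) := h
  rw [Multiplicative.ofAdd.injective h2, ratioArg_fundUnit, zsmul_eq_mul]

/-- A fundamental domain for the action of the units on the nonzero elements. -/
def InDom (z : Zrt2) : Prop := 0 ≤ z.re ∧ 0 ≤ z.im ∧ (2 * z.im < z.re ∨ z.re < z.im)

lemma InDom.ne_zero {z : Zrt2} (h : InDom z) : z ≠ 0 := by
  rintro rfl
  obtain ⟨_, _, h | h⟩ := h <;> simp at h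

lemma InDom.toR_pos {z : Zrt2} (h : InDom z) : 0 < toR z := by
  obtain ⟨h1, h2, h3⟩ := h
  have h4 : (0 : ℝ) ≤ z.re := by exact_mod_cast h1
  have h5 : (0 : ℝ) ≤ z.im := by exact_mod_cast h2
  have hs : 0 < Real.sqrt 2 := by positivity
  rw [toR]
  rcases h3 with h3 | h3
  · have : (0 : ℝ) < z.re := by exact_mod_cast (by omega)
    positivity
  · have : (0 : ℝ) < z.im := by exact_mod_cast (by omega)
    positivity

lemma sqrt_two_lt_two : Real.sqrt 2 < 2 := by rw [Real.sqrt_lt' (by norm_num)]; norm_num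

lemma ratioArg_nonneg_iff {z : Zrt2} (hz : z ≠ 0) :
    0 ≤ ratioArg z ↔ |toR (sigma z)| ≤ |toR z| := by
  have h1 := abs_pos.mpr (toR_ne_zero hz)
  have h3 := abs_pos.mpr (toR_ne_zero (sigma_ne_zero hz))
  rw [ratioArg, Real.log_nonneg_iff (div_pos h1 h3), one_le_div h3]

lemma ratioArg_lt_iff {z : Zrt2} (hz : z ≠ 0) :
    ratioArg z < 2 * Real.log (1 + Real.sqrt 2) ↔
      |toR z| < (1 + Real.sqrt 2) ^ 2 * |toR (sigma z)| := by
  have h1 := abs_pos.mpr (toR_ne_zero hz)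
  have h3 := abs_pos.mpr (toR_ne_zero (sigma_ne_zero hz))
  have e : 2 * Real.log (1 + Real.sqrt 2) = Real.log ((1 + Real.sqrt 2) ^ 2) := by
    rw [Real.log_pow]; norm_num
  rw [e, ratioArg, Real.log_lt_log_iff (div_pos h1 h3) (by positivity), div_lt_iff₀ h3]

lemma inDom_iff {z : Zrt2} (hz : z ≠ 0) :
    InDom z ↔ 0 < toR z ∧ 0 ≤ ratioArg z ∧ ratioArg z < 2 * Real.log (1 + Real.sqrt 2) := by
  have hs1 := one_lt_sqrt_two
  have hs2 := sqrt_two_lt_two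
  have hs := sqrt_two_mul_self
  rw [ratioArg_nonneg_iff hz, ratioArg_lt_iff hz]
  constructor
  · intro h
    have hpos := h.toR_pos
    obtain ⟨h1, h2, h3⟩ := h
    have h4 : (0 : ℝ) ≤ z.re := by exact_mod_cast h1
    have h5 : (0 : ℝ) ≤ z.im := by exact_mod_cast h2
    refine ⟨hpos, ?_, ?_⟩
    · rw [abs_of_pos hpos, toR_sigma, toR, abs_le]
      constructor <;> nlinarith
    · rw [abs_of_pos hpos, toR_sigma, toR]
      rcases h3 with h3 | h3
      · have h6 : (2 * z.im : ℝ) < z.re := by exact_mod_cast h3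
        refine lt_of_lt_of_le ?_ (mul_le_mul_of_nonneg_left (le_abs_self _) (sq_nonneg _))
        have e : (1 + Real.sqrt 2) ^ 2 * (z.re - z.im * Real.sqrt 2) -
            (z.re + z.im * Real.sqrt 2) = (2 + 2 * Real.sqrt 2) * (z.re - 2 * z.im) := by
          linear_combination (z.re - z.im * Real.sqrt 2 - 2 * z.im : ℝ) * hs
        have : 0 < (2 + 2 * Real.sqrt 2) * (z.re - 2 * z.im) :=
          mul_pos (by positivity) (by linarith)
        linarith
      · have h6 : (z.re : ℝ) < z.im := by exact_mod_cast h3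
        refine lt_of_lt_of_le ?_ (mul_le_mul_of_nonneg_left (neg_le_abs _) (sq_nonneg _))
        have e : (1 + Real.sqrt 2) ^ 2 * -(z.re - z.im * Real.sqrt 2) -
            (z.re + z.im * Real.sqrt 2) = (4 + 2 * Real.sqrt 2) * (z.im - z.re) := by
          linear_combination (-(z.re - z.im * Real.sqrt 2) + 2 * z.im : ℝ) * hs
        have : 0 < (4 + 2 * Real.sqrt 2) * (z.im - z.re : ℝ) :=
          mul_pos (by positivity) (by linarith)
        linarith
  · rintro ⟨hpos, h1, h2⟩
    rw [abs_of_pos hpos, toR_sigma, toR, abs_le] at h1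
    rw [abs_of_pos hpos, toR_sigma, toR] at h2
    have h4 : (0 : ℝ) ≤ z.re := by linarith
    have h5 : (0 : ℝ) ≤ z.im := by nlinarith
    refine ⟨by exact_mod_cast h4, by exact_mod_cast h5, ?_⟩
    rcases abs_cases (z.re - z.im * Real.sqrt 2) with ⟨h6, _⟩ | ⟨h6, _⟩
    · left
      rw [h6] at h2
      have : (2 * z.im : ℝ) < z.re := by
        by_contra! h7
        nlinarith
      exact_mod_cast this
    · right
      rw [h6] at h2
      have : (z.re : ℝ) < z.im := by
        by_contra! h7
        nlinarith
      exact_mod_cast this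

lemma exists_inDom {z : Zrt2} (hz : z ≠ 0) :
    ∃ n : ℤ, InDom (z * (fundUnit ^ n : Zrt2ˣ)) ∨ InDom (-(z * (fundUnit ^ n : Zrt2ˣ))) := by
  have hpos : 0 < 2 * Real.log (1 + Real.sqrt 2) := by linarith [log_one_add_sqrt_two_pos]
  obtain ⟨n, hn, -⟩ := existsUnique_add_zsmul_mem_Ico hpos (ratioArg z) 0
  refine ⟨n, ?_⟩
  set w : Zrt2 := z * (fundUnit ^ n : Zrt2ˣ) with hw
  have hw0 : w ≠ 0 := mul_ne_zero hz (Units.ne_zero _)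
  have harg : ratioArg w = ratioArg z + n • (2 * Real.log (1 + Real.sqrt 2)) := by
    rw [hw, ratioArg_mul hz (Units.ne_zero _), ratioArg_fundUnit_zpow, zsmul_eq_mul]
  simp only [← harg, zero_add, Set.mem_Ico] at hn
  rcases lt_or_gt_of_ne (toR_ne_zero hw0) with h | h
  · right
    rw [inDom_iff (neg_ne_zero.mpr hw0), ratioArg_neg, toR_neg]
    exact ⟨by linarith, hn⟩
  · left
    rw [inDom_iff hw0]
    exact ⟨h, hn⟩

lemma InDom.eq_one {z : Zrt2} (h : InDom z) (hz : z.norm.natAbs = 1) : z = 1 := by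
  obtain ⟨h1, h2, h3⟩ := h
  rw [Int.natAbs_eq_iff, Zsqrtd.norm] at hz
  rcases h3 with h3 | h3
  · have h0 : z.im = 0 := by
      by_contra h0
      have : 1 ≤ z.im := by omega
      rcases hz with hz | hz <;> push_cast at hz <;> nlinarith
    have h0' : z.re = 1 := by
      rw [h0] at hz h3
      rcases hz with hz | hz <;> push_cast at hz <;> nlinarith
    ext <;> simp [h0, h0']
  · exfalso
    rcases hz with hz | hz <;> push_cast at hz <;> nlinarith

lemma unit_eq (u : Zrt2ˣ) : ∃ n : ℤ, u = fundUnit ^ n ∨ u = -fundUnit ^ n := by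
  obtain ⟨n, hn⟩ := exists_inDom u.ne_zero
  refine ⟨-n, ?_⟩
  have hnorm (v : Zrt2ˣ) : (v : Zrt2).norm.natAbs = 1 :=
    Zsqrtd.norm_eq_one_iff.mpr v.isUnit
  rcases hn with h | h
  · left
    have h1 : ((u * fundUnit ^ n : Zrt2ˣ) : Zrt2) = 1 := by
      rw [Units.val_mul]
      exact h.eq_one (by rw [← Units.val_mul]; exact hnorm _)
    rw [zpow_neg]
    exact eq_inv_of_mul_eq_one_left (Units.ext h1)
  · right
    have h1 : ((-(u * fundUnit ^ n) : Zrt2ˣ) : Zrt2) = 1 := by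
      rw [Units.val_neg, Units.val_mul]
      exact h.eq_one (by rw [← Units.val_mul, ← Units.val_neg]; exact hnorm _)
    have h2 : -u * fundUnit ^ n = 1 := by rw [neg_mul]; exact Units.ext h1
    rw [zpow_neg, ← eq_inv_of_mul_eq_one_left h2, neg_neg]

lemma ratioArg_unit (u : Zrt2ˣ) :
    ∃ n : ℤ, ratioArg u = n * (2 * Real.log (1 + Real.sqrt 2)) := by
  obtain ⟨n, rfl | rfl⟩ := unit_eq u
  · exact ⟨n, ratioArg_fundUnit_zpow n⟩
  · refine ⟨n, ?_⟩
    rw [Units.val_neg, ratioArg_neg, ratioArg_fundUnit_zpow]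

lemma InDom.eq_of_associated {z w : Zrt2} (hz : InDom z) (hw : InDom w) (h : Associated z w) :
    z = w := by
  obtain ⟨u, rfl⟩ := h
  have hpos := log_one_add_sqrt_two_pos
  have hz' := (inDom_iff hz.ne_zero).mp hz
  have hw' := (inDom_iff hw.ne_zero).mp hw
  rw [ratioArg_mul hz.ne_zero u.ne_zero] at hw'
  have harg {n : ℤ} (hn : ratioArg u = n * (2 * Real.log (1 + Real.sqrt 2))) : n = 0 := by
    rw [hn] at hw'
    have h1 : (n : ℝ) < 1 := by
      by_contra! h
      nlinarith
    have h2 : (-1 : ℝ) < n := by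
      by_contra! h
      nlinarith
    have h1' : n < 1 := by exact_mod_cast h1
    have h2' : -1 < n := by exact_mod_cast h2
    omega
  obtain ⟨n, hn | hn⟩ := unit_eq u
  · have := harg (n := n) (by rw [hn, ratioArg_fundUnit_zpow])
    rw [hn, this, zpow_zero, Units.val_one, mul_one]
  · have := harg (n := n) (by rw [hn, Units.val_neg, ratioArg_neg, ratioArg_fundUnit_zpow])
    rw [hn, this, zpow_zero, Units.val_neg, Units.val_one, mul_neg, mul_one, toR_neg] at hw'
    linarith [hw'.1, hz'.1]

/-- The `l`-th Hecke character `z ↦ |z / σ(z)| ^ (π i l / log ε)`. -/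
def hecke (l : ℕ) (z : Zrt2) : ℂ := Complex.exp ((freq l * ratioArg z : ℝ) * Complex.I)

lemma norm_hecke (l : ℕ) (z : Zrt2) : ‖hecke l z‖ = 1 := Complex.norm_exp_ofReal_mul_I _

lemma hecke_mul (l : ℕ) {z w : Zrt2} (hz : z ≠ 0) (hw : w ≠ 0) :
    hecke l (z * w) = hecke l z * hecke l w := by
  rw [hecke, hecke, hecke, ← Complex.exp_add, ratioArg_mul hz hw]
  congr 1
  push_cast
  ring

lemma hecke_intCast (l : ℕ) (n : ℤ) : hecke l (n : Zrt2) = 1 := by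
  rw [hecke, ratioArg_intCast]; simp

lemma hecke_unit (l : ℕ) (u : Zrt2ˣ) : hecke l u = 1 := by
  obtain ⟨n, hn⟩ := ratioArg_unit u
  have h : freq l * ratioArg u = ((l * n : ℤ) : ℝ) * (2 * Real.pi) := by
    rw [hn]
    push_cast
    linear_combination 2 * n * freq_mul l
  rw [hecke, h]
  have h2 : (((l * n : ℤ) * (2 * Real.pi) : ℝ) : ℂ) * Complex.I =
      (l * n : ℤ) * (2 * Real.pi * Complex.I) := by
    push_cast; ring
  rw [h2, Complex.exp_int_mul_two_pi_mul_I]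

lemma hecke_associated (l : ℕ) {z w : Zrt2} (hz : z ≠ 0) (h : Associated z w) :
    hecke l z = hecke l w := by
  obtain ⟨u, rfl⟩ := h
  rw [hecke_mul l hz u.ne_zero, hecke_unit, mul_one]

lemma natAbs_norm_eq_of_lt {z : Zrt2} (h1 : 0 ≤ z.im) (h2 : 2 * z.im < z.re) :
    (z.norm.natAbs : ℤ) = z.re ^ 2 - 2 * z.im ^ 2 := by
  rw [Zsqrtd.norm, Int.natAbs_of_nonneg (by nlinarith)]
  ring

lemma natAbs_norm_eq_of_gt {z : Zrt2} (h1 : 0 ≤ z.re) (h2 : z.re < z.im) :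
    (z.norm.natAbs : ℤ) = 2 * z.im ^ 2 - z.re ^ 2 := by
  rw [Zsqrtd.norm, Int.ofNat_natAbs_of_nonpos (by nlinarith)]
  ring

lemma finite_setOf_inDom (n : ℕ) : {z : Zrt2 | InDom z ∧ z.norm.natAbs = n}.Finite := by
  refine ((Finset.Icc (0 : ℤ) (2 * n) ×ˢ Finset.Icc (0 : ℤ) (2 * n)).finite_toSet.image
    fun q ↦ (⟨q.1, q.2⟩ : Zrt2)).subset ?_
  rintro ⟨a, b⟩ ⟨⟨h1, h2, h3⟩, h4⟩
  simp only at h1 h2 h3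
  refine ⟨(a, b), ?_, rfl⟩
  simp only [Finset.coe_product, Finset.coe_Icc, Set.mem_prod, Set.mem_Icc]
  rcases h3 with h3 | h3
  · have h5 := natAbs_norm_eq_of_lt (z := ⟨a, b⟩) h2 h3
    rw [h4] at h5
    simp only at h5
    have : a ≤ 2 * n := by nlinarith
    refine ⟨⟨h1, this⟩, h2, by linarith⟩
  · have h5 := natAbs_norm_eq_of_gt (z := ⟨a, b⟩) h1 h3
    rw [h4] at h5
    simp only at h5
    have : b ≤ n := by nlinarith
    refine ⟨⟨h1, by linarith⟩, h2, by linarith⟩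

/-- The elements of the fundamental domain of absolute norm `n`. -/
def domZ (n : ℕ) : Finset Zrt2 := (finite_setOf_inDom n).toFinset

lemma mem_domZ {n : ℕ} {z : Zrt2} : z ∈ domZ n ↔ InDom z ∧ z.norm.natAbs = n := by
  simp [domZ]

/-- The coefficients of the Hecke `L`-function of `hecke l`. -/
def heckeSum (l n : ℕ) : ℂ := ∑ z ∈ domZ n, hecke l z

lemma hecke_of_lt (l : ℕ) {z : Zrt2} (h1 : 0 ≤ z.im) (h2 : 2 * z.im < z.re) :
    hecke l z = slopePhase (freq l) (z.im / z.re) := by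
  have h3 : (0 : ℝ) ≤ z.im := by exact_mod_cast h1
  have h4 : (2 * z.im : ℝ) < z.re := by exact_mod_cast h2
  have h5 : (0 : ℝ) < z.re := by linarith
  have ht0 : (0 : ℝ) ≤ z.im / z.re := by positivity
  have ht1 : (z.im / z.re : ℝ) ≤ 1 / 2 := by
    rw [div_le_iff₀ h5]; linarith
  rw [hecke, slopePhase, clamp_of_mem ht0 ht1]
  have hs := sqrt_two_lt_two
  have h6 : 0 < toR z := by rw [toR]; positivity
  have h7 : 0 < toR (sigma z) := by rw [toR_sigma]; nlinarith
  have : ratioArg z = ratioLog (z.im / z.re) := by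
    have h8 := mul_sqrt_two_lt_one ht1
    have h9 : (1 - z.im / z.re * Real.sqrt 2 : ℝ) ≠ 0 := by linarith
    rw [ratioArg, ratioLog, abs_of_pos h6, abs_of_pos h7]
    congr 1
    rw [div_eq_div_iff h7.ne' h9, toR_sigma, toR]
    field_simp
  rw [this]

lemma hecke_of_gt (l : ℕ) {z : Zrt2} (h1 : 0 ≤ z.re) (h2 : z.re < z.im) :
    hecke l z = slopePhase (freq l) (z.re / (2 * z.im)) := by
  have h3 : (0 : ℝ) ≤ z.re := by exact_mod_cast h1
  have h4 : (z.re : ℝ) < z.im := by exact_mod_cast h2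
  have h5 : (0 : ℝ) < z.im := by linarith
  have ht0 : (0 : ℝ) ≤ z.re / (2 * z.im) := by positivity
  have ht1 : (z.re / (2 * z.im) : ℝ) ≤ 1 / 2 := by
    rw [div_le_iff₀ (by positivity)]; linarith
  rw [hecke, slopePhase, clamp_of_mem ht0 ht1]
  have hs := one_lt_sqrt_two
  have h6 : 0 < toR z := by rw [toR]; positivity
  have h7 : toR (sigma z) < 0 := by rw [toR_sigma]; nlinarith
  have : ratioArg z = ratioLog (z.re / (2 * z.im)) := by
    have h8 := mul_sqrt_two_lt_one ht1
    have h9 : (1 - z.re / (2 * z.im) * Real.sqrt 2 : ℝ) ≠ 0 := by linarith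
    rw [ratioArg, ratioLog, abs_of_pos h6, abs_of_neg h7]
    congr 1
    rw [div_eq_div_iff (by linarith) h9, toR_sigma, toR]
    field_simp
    linear_combination (-2 * z.im * z.re : ℝ) * sqrt_two_mul_self
  rw [this]

lemma mem_sector_iff {d : ℕ} (hd : 0 < d) (X : ℝ) (m y : ℕ) :
    (m ∈ Finset.Icc 1 ⌊Real.sqrt (2 * X) / d⌋₊ ∧
      y ∈ Finset.Ico ⌈minSlope X (d * m) * (d * m)⌉₊ ⌈(d * m : ℝ) / 2⌉₊) ↔
      0 < m ∧ 2 * y < d * m ∧ ((d * m : ℝ) ^ 2 - 2 * (y : ℝ) ^ 2 ≤ X) := by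
  have hd0 : (0 : ℝ) < d := by exact_mod_cast hd
  rw [Finset.mem_Icc, Finset.mem_Ico, Nat.ceil_le, Nat.lt_ceil, lt_div_iff₀ (by norm_num)]
  have hy (hm : 0 < m) : minSlope X (d * m) * (d * m) ≤ y ↔
      (d * m : ℝ) ^ 2 - 2 * (y : ℝ) ^ 2 ≤ X := by
    have hm0 : (0 : ℝ) < m := by exact_mod_cast hm
    have hx : (0 : ℝ) < d * m := by positivity
    rw [← le_div_iff₀ hx, minSlope_le_iff hx (by positivity)]
    have : (d * m : ℝ) ^ 2 * (1 - 2 * (y / (d * m)) ^ 2) = (d * m) ^ 2 - 2 * y ^ 2 := by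
      field_simp
    rw [this]
  have hlt : (y * 2 : ℝ) < d * m ↔ 2 * y < d * m := by
    rw [mul_comm (y : ℝ)]
    exact_mod_cast Iff.rfl
  rw [hlt]
  constructor
  · rintro ⟨⟨h1, -⟩, h2, h3⟩
    exact ⟨h1, h3, (hy h1).mp h2⟩
  · rintro ⟨h1, h2, h3⟩
    refine ⟨⟨h1, ?_⟩, (hy h1).mpr h3, h2⟩
    rw [Nat.le_floor_iff (by positivity), le_div_iff₀ hd0]
    apply Real.le_sqrt_of_sq_le
    have h4 : (2 * y : ℝ) < d * m := by exact_mod_cast h2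
    have h5 : (0 : ℝ) ≤ y := by positivity
    nlinarith

lemma sectorSum_eq_sum_sigma (E : ℝ → ℂ) (d : ℕ) (X : ℝ) :
    sectorSum E d X = ∑ q ∈ (Finset.Icc 1 ⌊Real.sqrt (2 * X) / d⌋₊).sigma (fun m ↦
      Finset.Ico ⌈minSlope X (d * m) * (d * m)⌉₊ ⌈(d * m : ℝ) / 2⌉₊),
        E (q.2 / (d * q.1)) := by
  rw [Finset.sum_sigma]
  rfl

lemma sum_heckeSum_eq (l : ℕ) {X : ℝ} (hX : 0 ≤ X) :
    ∑ n ∈ Finset.Icc 1 ⌊X⌋₊, heckeSum l n =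
      sectorSum (slopePhase (freq l)) 1 X + sectorSum (slopePhase (freq l)) 2 (2 * X) := by
  have hle (n : ℕ) : n ≤ ⌊X⌋₊ ↔ (n : ℝ) ≤ X := Nat.le_floor_iff hX
  unfold heckeSum
  rw [Finset.sum_sigma', ← Finset.sum_filter_add_sum_filter_not _ (fun q ↦ 2 * q.2.im < q.2.re),
    sectorSum_eq_sum_sigma, sectorSum_eq_sum_sigma]
  congr 1
  · refine Finset.sum_bij' (fun q _ ↦ ⟨q.2.re.toNat, q.2.im.toNat⟩)
      (fun q _ ↦ ⟨((⟨q.1, q.2⟩ : Zrt2).norm.natAbs), ⟨q.1, q.2⟩⟩) ?_ ?_ ?_ ?_ ?_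
    · rintro ⟨n, z⟩ hq
      simp only [Finset.mem_filter, Finset.mem_sigma, mem_domZ, Finset.mem_Icc, hle] at hq
      obtain ⟨⟨⟨hn1, hnX⟩, ⟨hre, him, -⟩, hnorm⟩, hlt⟩ := hq
      rw [Finset.mem_sigma, mem_sector_iff one_pos]
      have e := natAbs_norm_eq_of_lt him hlt
      rw [hnorm] at e
      obtain ⟨a, ha⟩ := Int.eq_ofNat_of_zero_le hre
      obtain ⟨b, hb⟩ := Int.eq_ofNat_of_zero_le him
      simp only [ha, hb, Int.toNat_natCast] at e hlt ⊢
      refine ⟨by omega, by omega, ?_⟩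
      have e' : (n : ℝ) = a ^ 2 - 2 * b ^ 2 := by exact_mod_cast e
      push_cast
      linarith
    · rintro ⟨m, y⟩ hq
      rw [Finset.mem_sigma, mem_sector_iff one_pos] at hq
      obtain ⟨h1, h2, h3⟩ := hq
      simp only at h1 h2 h3
      have hlt : 2 * (y : ℤ) < m := by omega
      have e := natAbs_norm_eq_of_lt (z := ⟨m, y⟩) (by simp) hlt
      simp only [Finset.mem_filter, Finset.mem_sigma, mem_domZ, Finset.mem_Icc, hle, and_true]
      obtain ⟨n, hn⟩ : ∃ n : ℕ, n = (Zsqrtd.norm (⟨m, y⟩ : Zrt2)).natAbs := ⟨_, rfl⟩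
      simp only [← hn] at e ⊢
      have e' : (n : ℝ) = m ^ 2 - 2 * y ^ 2 := by exact_mod_cast e
      refine ⟨⟨⟨?_, ?_⟩, ⟨by simp, by simp, Or.inl hlt⟩⟩, hlt⟩
      · zify
        rw [e]
        nlinarith
      · rw [e']
        push_cast at h3
        linarith
    · rintro ⟨n, z⟩ hq
      simp only [Finset.mem_filter, Finset.mem_sigma, mem_domZ] at hq
      obtain ⟨⟨-, ⟨hre, him, -⟩, hnorm⟩, -⟩ := hq
      simp only [Int.toNat_of_nonneg hre, Int.toNat_of_nonneg him]
      rw [← hnorm]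
    · rintro ⟨m, y⟩ hq
      simp
    · rintro ⟨n, z⟩ hq
      simp only [Finset.mem_filter, Finset.mem_sigma, mem_domZ] at hq
      obtain ⟨⟨-, ⟨hre, him, -⟩, -⟩, hlt⟩ := hq
      rw [hecke_of_lt l him hlt]
      obtain ⟨a, ha⟩ := Int.eq_ofNat_of_zero_le hre
      obtain ⟨b, hb⟩ := Int.eq_ofNat_of_zero_le him
      simp [ha, hb]
  · refine Finset.sum_bij' (fun q _ ↦ ⟨q.2.im.toNat, q.2.re.toNat⟩)
      (fun q _ ↦ ⟨((⟨q.2, q.1⟩ : Zrt2).norm.natAbs), ⟨q.2, q.1⟩⟩) ?_ ?_ ?_ ?_ ?_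
    · rintro ⟨n, z⟩ hq
      simp only [Finset.mem_filter, Finset.mem_sigma, mem_domZ, Finset.mem_Icc, hle] at hq
      obtain ⟨⟨⟨hn1, hnX⟩, ⟨hre, him, hor⟩, hnorm⟩, hnlt⟩ := hq
      have hlt := hor.resolve_left hnlt
      rw [Finset.mem_sigma, mem_sector_iff two_pos]
      have e := natAbs_norm_eq_of_gt hre hlt
      rw [hnorm] at e
      obtain ⟨a, ha⟩ := Int.eq_ofNat_of_zero_le hre
      obtain ⟨b, hb⟩ := Int.eq_ofNat_of_zero_le him
      simp only [ha, hb, Int.toNat_natCast] at e hlt ⊢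
      refine ⟨by omega, by omega, ?_⟩
      have e' : (n : ℝ) = 2 * b ^ 2 - a ^ 2 := by exact_mod_cast e
      push_cast
      linarith
    · rintro ⟨m, y⟩ hq
      rw [Finset.mem_sigma, mem_sector_iff two_pos] at hq
      obtain ⟨h1, h2, h3⟩ := hq
      simp only at h1 h2 h3
      have hlt : (y : ℤ) < m := by omega
      have e := natAbs_norm_eq_of_gt (z := ⟨y, m⟩) (by simp) hlt
      simp only [Finset.mem_filter, Finset.mem_sigma, mem_domZ, Finset.mem_Icc, hle, and_true]
      obtain ⟨n, hn⟩ : ∃ n : ℕ, n = (Zsqrtd.norm (⟨y, m⟩ : Zrt2)).natAbs := ⟨_, rfl⟩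
      simp only [← hn] at e ⊢
      have e' : (n : ℝ) = 2 * m ^ 2 - y ^ 2 := by exact_mod_cast e
      refine ⟨⟨⟨?_, ?_⟩, ⟨by simp, by simp, Or.inr hlt⟩⟩, by omega⟩
      · zify
        rw [e]
        nlinarith
      · rw [e']
        push_cast at h3
        linarith
    · rintro ⟨n, z⟩ hq
      simp only [Finset.mem_filter, Finset.mem_sigma, mem_domZ] at hq
      obtain ⟨⟨-, ⟨hre, him, -⟩, hnorm⟩, -⟩ := hq
      simp only [Int.toNat_of_nonneg hre, Int.toNat_of_nonneg him]
      rw [← hnorm]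
    · rintro ⟨m, y⟩ hq
      simp
    · rintro ⟨n, z⟩ hq
      simp only [Finset.mem_filter, Finset.mem_sigma, mem_domZ] at hq
      obtain ⟨⟨-, ⟨hre, him, hor⟩, -⟩, hnlt⟩ := hq
      rw [hecke_of_gt l hre (hor.resolve_left hnlt)]
      obtain ⟨a, ha⟩ := Int.eq_ofNat_of_zero_le hre
      obtain ⟨b, hb⟩ := Int.eq_ofNat_of_zero_le him
      simp [ha, hb]

lemma norm_sum_heckeSum_le_mul (l : ℕ) {X : ℝ} (hX : 0 ≤ X) :
    ‖∑ n ∈ Finset.Icc 1 ⌊X⌋₊, heckeSum l n‖ ≤ 4 * X := by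
  rw [sum_heckeSum_eq l hX]
  have hE := fun t ↦ (norm_slopePhase (freq l) t).le
  have h1 := norm_sectorSum_le_mul hE one_pos hX
  have h2 := norm_sectorSum_le_mul hE two_pos (X := 2 * X) (by positivity)
  refine (norm_add_le _ _).trans ?_
  push_cast at h1 h2
  linarith

lemma norm_sum_heckeSum_le {l : ℕ} (hl : l ≠ 0) {X : ℝ} (hX : 0 ≤ X) :
    ‖∑ n ∈ Finset.Icc 1 ⌊X⌋₊, heckeSum l n‖ ≤ (48 * freq l + 15) * Real.sqrt X := by
  rcases lt_or_ge X 1 with h | h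
  · rw [Nat.floor_eq_zero.mpr h]
    simp only [Finset.Icc_eq_empty_of_lt one_pos, Finset.sum_empty, norm_zero]
    have := freq_nonneg l
    positivity
  · rw [sum_heckeSum_eq l hX]
    have h1 := norm_sectorSum_slopePhase_le hl one_pos hX
    have h2 := norm_sectorSum_slopePhase_le hl two_pos (X := 2 * X) (by positivity)
    refine (norm_add_le _ _).trans ?_
    have hs1 : Real.sqrt (2 * X) ≤ 2 * Real.sqrt X := by
      rw [Real.sqrt_mul (by norm_num)]
      have := sqrt_two_lt_two
      gcongr
    have hs2 : Real.sqrt (2 * (2 * X)) = 2 * Real.sqrt X := by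
      have : 2 * (2 * X) = 2 ^ 2 * X := by ring
      rw [this, Real.sqrt_mul (by norm_num), Real.sqrt_sq (by norm_num)]
    have hs3 : 1 ≤ Real.sqrt X := Real.one_le_sqrt.mpr h
    have := freq_nonneg l
    rw [hs2] at h2
    push_cast at h1 h2
    nlinarith [mul_le_mul_of_nonneg_left hs1 (show 0 ≤ 12 * freq l + 3 by positivity)]

lemma exists_associated_inDom {z : Zrt2} (hz : z ≠ 0) : ∃ w, InDom w ∧ Associated z w := by
  obtain ⟨n, h | h⟩ := exists_inDom hz
  · exact ⟨_, h, ⟨_, rfl⟩⟩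
  · refine ⟨_, h, ⟨-(fundUnit ^ n), ?_⟩⟩
    rw [Units.val_neg, mul_neg]

lemma natAbs_norm_eq_of_associated {z w : Zrt2} (h : Associated z w) :
    z.norm.natAbs = w.norm.natAbs := by
  obtain ⟨u, rfl⟩ := h
  rw [Zsqrtd.norm_mul, Int.natAbs_mul, Zsqrtd.norm_eq_one_iff.mpr u.isUnit, mul_one]

open scoped Classical in
lemma sum_dvd_hecke (l : ℕ) {P : Zrt2} (hP : P ≠ 0) (n : ℕ) :
    ∑ z ∈ domZ (P.norm.natAbs * n), (if P ∣ z then hecke l z else 0) =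
      hecke l P * heckeSum l n := by
  have hq : 0 < P.norm.natAbs := Int.natAbs_pos.mpr (norm_ne_zero hP)
  rw [← Finset.sum_filter, heckeSum, Finset.mul_sum]
  symm
  have hex (w : Zrt2) (hw : w ∈ domZ n) : ∃ z, InDom z ∧ Associated (P * w) z :=
    exists_associated_inDom (mul_ne_zero hP (mem_domZ.mp hw).1.ne_zero)
  choose f hf1 hf2 using hex
  refine Finset.sum_bij f ?_ ?_ ?_ ?_
  · intro w hw
    rw [Finset.mem_filter, mem_domZ]
    refine ⟨⟨hf1 w hw, ?_⟩, (dvd_mul_right P w).trans (hf2 w hw).dvd⟩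
    rw [← natAbs_norm_eq_of_associated (hf2 w hw), Zsqrtd.norm_mul, Int.natAbs_mul,
      (mem_domZ.mp hw).2]
  · intro w hw w' hw' h
    have h1 : Associated (P * w) (P * w') := (hf2 w hw).trans (h ▸ (hf2 w' hw').symm)
    exact (mem_domZ.mp hw).1.eq_of_associated (mem_domZ.mp hw').1
      (h1.of_mul_left (Associated.refl P) hP)
  · intro z hz
    rw [Finset.mem_filter, mem_domZ] at hz
    obtain ⟨⟨hzD, hzn⟩, w₀, rfl⟩ := hz
    have hw₀ : w₀ ≠ 0 := right_ne_zero_of_mul hzD.ne_zero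
    obtain ⟨w, hwD, hw⟩ := exists_associated_inDom hw₀
    have hwn : w ∈ domZ n := by
      rw [mem_domZ, ← natAbs_norm_eq_of_associated hw]
      rw [Zsqrtd.norm_mul, Int.natAbs_mul] at hzn
      exact ⟨hwD, Nat.eq_of_mul_eq_mul_left hq hzn⟩
    refine ⟨w, hwn, (hf1 w hwn).eq_of_associated hzD ?_⟩
    exact (hf2 w hwn).symm.trans (hw.symm.mul_left P)
  · intro w hw
    have hw0 := (mem_domZ.mp hw).1.ne_zero
    rw [← hecke_mul l hP hw0, hecke_associated l (mul_ne_zero hP hw0) (hf2 w hw)]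

lemma intCast_dvd_iff {p : ℤ} {z : Zrt2} : (p : Zrt2) ∣ z ↔ p ∣ z.re ∧ p ∣ z.im :=
  Zsqrtd.intCast_dvd p z

lemma dvd_of_intCast_dvd_mul_sigma {ρ z : Zrt2} {p : ℤ} (hp : p ≠ 0) (hρ : ρ.norm = p)
    (h : (p : Zrt2) ∣ z * sigma ρ) : ρ ∣ z := by
  obtain ⟨w, hw⟩ := h
  have hσ : sigma ρ ≠ 0 := by
    intro h0
    rw [← norm_sigma, h0, Zsqrtd.norm_zero] at hρ
    exact hp hρ.symm
  refine ⟨w, mul_right_cancel₀ hσ ?_⟩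
  rw [hw, ← hρ, ← mul_sigma]
  ring

lemma dvd_or_dvd_sigma {p : ℕ} (hp : p.Prime) {ρ z : Zrt2} (hρ : ρ.norm = p)
    (hz : (p : ℤ) ∣ z.norm) : ρ ∣ z ∨ sigma ρ ∣ z := by
  have hpi : Prime (p : ℤ) := Nat.prime_iff_prime_int.mp hp
  obtain ⟨a, b⟩ := ρ
  obtain ⟨x, y⟩ := z
  simp only [Zsqrtd.norm] at hρ hz
  have hb : ¬ (p : ℤ) ∣ b := by
    intro hb
    have ha : (p : ℤ) ∣ a := by
      have : (p : ℤ) ∣ a * a := by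
        have h1 : a * a = p + 2 * b * b := by linarith
        rw [h1]
        exact dvd_add dvd_rfl (hb.mul_left _)
      rcases hpi.dvd_or_dvd this with h | h <;> exact h
    obtain ⟨a', rfl⟩ := ha
    obtain ⟨b', rfl⟩ := hb
    have h2 : (p : ℤ) * (p * (a' * a' - 2 * b' * b')) = p * 1 := by linarith
    have h3 := mul_left_cancel₀ hpi.ne_zero h2
    exact hpi.not_isUnit (IsUnit.of_mul_eq_one _ h3)
  have hprod : (p : ℤ) ∣ (y * a - x * b) * (y * a + x * b) := by
    have : (y * a - x * b) * (y * a + x * b) = y * y * p - b * b * (x * x - 2 * y * y) := by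
      rw [← hρ]; ring
    rw [this]
    exact dvd_sub (dvd_mul_left _ _) (hz.mul_left _)
  rcases hpi.dvd_or_dvd hprod with h | h
  · left
    refine dvd_of_intCast_dvd_mul_sigma (p := p) hpi.ne_zero hρ ?_
    rw [intCast_dvd_iff]
    simp only [sigma, Zsqrtd.re_mul, Zsqrtd.im_mul]
    constructor
    · have : (p : ℤ) ∣ b * (x * a - 2 * y * b) := by
        have e : b * (x * a - 2 * y * b) = y * p - a * (y * a - x * b) := by rw [← hρ]; ring
        rw [e]
        exact dvd_sub (dvd_mul_left _ _) (h.mul_left _)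
      obtain ⟨c, hc⟩ := (hpi.dvd_or_dvd this).resolve_left hb
      exact ⟨c, by linarith⟩
    · obtain ⟨c, hc⟩ := h
      exact ⟨c, by linarith⟩
  · right
    refine dvd_of_intCast_dvd_mul_sigma (p := p) hpi.ne_zero ?_ ?_
    · rw [norm_sigma]; exact hρ
    rw [sigma_sigma, intCast_dvd_iff]
    simp only [Zsqrtd.re_mul, Zsqrtd.im_mul]
    constructor
    · have : (p : ℤ) ∣ b * (x * a + 2 * y * b) := by
        have e : b * (x * a + 2 * y * b) = a * (y * a + x * b) - y * p := by rw [← hρ]; ring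
        rw [e]
        exact dvd_sub (h.mul_left _) (dvd_mul_left _ _)
      obtain ⟨c, hc⟩ := (hpi.dvd_or_dvd this).resolve_left hb
      exact ⟨c, by linarith⟩
    · obtain ⟨c, hc⟩ := h
      exact ⟨c, by linarith⟩

lemma dvd_and_dvd_sigma_iff {p : ℕ} (hp : p.Prime) (hp2 : p ≠ 2) {ρ z : Zrt2}
    (hρ : ρ.norm = p) : (ρ ∣ z ∧ sigma ρ ∣ z) ↔ ((p : ℤ) : Zrt2) ∣ z := by
  have hpi : Prime (p : ℤ) := Nat.prime_iff_prime_int.mp hp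
  have hp2' : ¬ (p : ℤ) ∣ 2 := by
    intro h
    have : p ∣ 2 := by exact_mod_cast h
    exact hp2 ((Nat.prime_dvd_prime_iff_eq hp Nat.prime_two).mp this)
  rw [← hρ, ← mul_sigma]
  constructor
  · rintro ⟨⟨w, hw⟩, ⟨w', hw'⟩⟩
    have h1 : ((p : ℤ) : Zrt2) ∣ z * sigma ρ := ⟨w, by rw [hw, ← hρ, ← mul_sigma]; ring⟩
    have h2 : ((p : ℤ) : Zrt2) ∣ z * ρ := ⟨w', by rw [hw', ← hρ, ← mul_sigma]; ring⟩
    rw [mul_sigma, hρ, intCast_dvd_iff]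
    have h3 : ((p : ℤ) : Zrt2) ∣ z * (ρ + sigma ρ) := by
      rw [mul_add]; exact dvd_add h2 h1
    have h4 : ((p : ℤ) : Zrt2) ∣ z * (ρ - sigma ρ) := by
      rw [mul_sub]; exact dvd_sub h2 h1
    obtain ⟨a, b⟩ := ρ
    obtain ⟨x, y⟩ := z
    rw [intCast_dvd_iff] at h3 h4
    simp only [sigma, Zsqrtd.re_mul, Zsqrtd.im_mul, Zsqrtd.re_add, Zsqrtd.im_add,
      Zsqrtd.re_sub, Zsqrtd.im_sub, Zsqrtd.norm] at h3 h4 hρ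
    by_cases ha : (p : ℤ) ∣ a
    · by_cases hb : (p : ℤ) ∣ b
      · exfalso
        obtain ⟨a', rfl⟩ := ha
        obtain ⟨b', rfl⟩ := hb
        have h2 : (p : ℤ) * (p * (a' * a' - 2 * b' * b')) = p * 1 := by linarith
        have h3 := mul_left_cancel₀ hpi.ne_zero h2
        exact hpi.not_isUnit (IsUnit.of_mul_eq_one _ h3)
      · have h5 : (p : ℤ) ∣ 2 * 2 * (b * y) := by convert h4.1 using 1; ring
        have h6 : (p : ℤ) ∣ 2 * (b * x) := by convert h4.2 using 1; ring
        have hr (c : ℤ) (h : (p : ℤ) ∣ 2 * (b * c)) : (p : ℤ) ∣ c :=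
          (hpi.dvd_or_dvd ((hpi.dvd_or_dvd h).resolve_left hp2')).resolve_left hb
        refine ⟨hr x h6, hr y ?_⟩
        rw [mul_assoc] at h5
        exact (hpi.dvd_or_dvd h5).resolve_left hp2'
    · have h5 : (p : ℤ) ∣ 2 * (a * x) := by convert h3.1 using 1; ring
      have h6 : (p : ℤ) ∣ 2 * (a * y) := by convert h3.2 using 1; ring
      have hr (c : ℤ) (h : (p : ℤ) ∣ 2 * (a * c)) : (p : ℤ) ∣ c :=
        (hpi.dvd_or_dvd ((hpi.dvd_or_dvd h).resolve_left hp2')).resolve_left ha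
      exact ⟨hr x h5, hr y h6⟩
  · intro h
    exact ⟨(dvd_mul_right _ _).trans h, (dvd_mul_left _ _).trans h⟩

lemma intCast_dvd_of_inert {p : ℕ} (hp : p.Prime) (hp2 : p ≠ 2) (h8 : ¬ (p % 8 = 1 ∨ p % 8 = 7))
    {z : Zrt2} (hz : (p : ℤ) ∣ z.norm) : ((p : ℤ) : Zrt2) ∣ z := by
  have : Fact p.Prime := ⟨hp⟩
  have hns : ¬ IsSquare (2 : ZMod p) := fun h ↦ h8 ((ZMod.exists_sq_eq_two_iff hp2).mp h)
  obtain ⟨x, y⟩ := z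
  rw [intCast_dvd_iff]
  simp only [Zsqrtd.norm] at hz ⊢
  rw [← ZMod.intCast_zmod_eq_zero_iff_dvd] at hz
  rw [← ZMod.intCast_zmod_eq_zero_iff_dvd, ← ZMod.intCast_zmod_eq_zero_iff_dvd]
  push_cast at hz
  have hy : (y : ZMod p) = 0 := by
    by_contra hy
    apply hns
    refine ⟨x / y, ?_⟩
    field_simp
    linear_combination -hz
  refine ⟨?_, hy⟩
  rw [hy, mul_zero, sub_zero] at hz
  exact mul_self_eq_zero.mp hz

lemma sqrt_two_dvd_of_two_dvd_norm {z : Zrt2} (hz : (2 : ℤ) ∣ z.norm) : (⟨0, 1⟩ : Zrt2) ∣ z := by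
  obtain ⟨x, y⟩ := z
  simp only [Zsqrtd.norm] at hz
  have h1 : (2 : ℤ) ∣ x * x := by
    have : x * x = (x * x - 2 * y * y) + 2 * (y * y) := by ring
    rw [this]
    exact dvd_add hz (dvd_mul_right _ _)
  obtain ⟨t, rfl⟩ : (2 : ℤ) ∣ x := (Int.prime_two.dvd_or_dvd h1).elim id id
  refine ⟨⟨y, t⟩, ?_⟩
  ext <;> simp

/-- The completely multiplicative function with prescribed values at the primes. -/
def ofPrimes (g : ℕ → ℂ) : ℕ →*₀ ℂ where
  toFun n := if n = 0 then 0 else (n.primeFactorsList.map g).prod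
  map_zero' := if_pos rfl
  map_one' := by simp
  map_mul' m n := by
    rcases eq_or_ne m 0 with rfl | hm
    · simp
    rcases eq_or_ne n 0 with rfl | hn
    · simp
    rw [if_neg (mul_ne_zero hm hn), if_neg hm, if_neg hn,
      ((Nat.perm_primeFactorsList_mul hm hn).map g).prod_eq, List.map_append, List.prod_append]

lemma ofPrimes_prime (g : ℕ → ℂ) {p : ℕ} (hp : p.Prime) : ofPrimes g p = g p := by
  change (if p = 0 then 0 else (p.primeFactorsList.map g).prod) = g p
  rw [if_neg hp.ne_zero, Nat.primeFactorsList_prime hp]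
  simp

lemma norm_ofPrimes_le {g : ℕ → ℂ} (hg : ∀ p, ‖g p‖ ≤ 1) (n : ℕ) : ‖ofPrimes g n‖ ≤ 1 := by
  change ‖if n = 0 then 0 else (n.primeFactorsList.map g).prod‖ ≤ 1
  split_ifs
  · simp
  · induction n.primeFactorsList with
    | nil => simp
    | cons a L ih =>
      rw [List.map_cons, List.prod_cons, norm_mul]
      exact mul_le_one₀ (hg a) (norm_nonneg _) ih

/-- First Euler parameters of the Hecke `L`-function. -/
def eulerU (ρ : ℕ → Zrt2) (l : ℕ) : ℕ →*₀ ℂ :=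
  ofPrimes fun p ↦ if p % 8 = 1 ∨ p % 8 = 7 then hecke l (ρ p) else 1

/-- Second Euler parameters of the Hecke `L`-function. -/
def eulerV (ρ : ℕ → Zrt2) (l : ℕ) : ℕ →*₀ ℂ :=
  ofPrimes fun p ↦ if p % 8 = 1 ∨ p % 8 = 7 then hecke l (sigma (ρ p)) else if p = 2 then 0 else -1

lemma norm_eulerU_le (ρ : ℕ → Zrt2) (l n : ℕ) : ‖eulerU ρ l n‖ ≤ 1 := by
  refine norm_ofPrimes_le (fun p ↦ ?_) n
  split_ifs
  · rw [norm_hecke]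
  · simp

lemma norm_eulerV_le (ρ : ℕ → Zrt2) (l n : ℕ) : ‖eulerV ρ l n‖ ≤ 1 := by
  refine norm_ofPrimes_le (fun p ↦ ?_) n
  split_ifs
  · rw [norm_hecke]
  · simp
  · simp

lemma dvd_norm_of_mem_domZ {p n : ℕ} (hn : p ∣ n) {z : Zrt2} (hz : z ∈ domZ n) :
    (p : ℤ) ∣ z.norm := by
  rw [← Int.dvd_natAbs, (mem_domZ.mp hz).2]
  exact_mod_cast hn

lemma norm_natCast_natAbs (p : ℕ) : (((p : ℤ) : Zrt2).norm).natAbs = p * p := by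
  rw [Zsqrtd.norm_intCast, Int.natAbs_mul, Int.natAbs_natCast]

open scoped Classical in
lemma sum_prime_dvd_hecke (l : ℕ) {p : ℕ} (hp : p.Prime) {n : ℕ} (hn : p ∣ n) :
    ∑ z ∈ domZ n, (if ((p : ℤ) : Zrt2) ∣ z then hecke l z else 0) =
      if p ∣ n / p then heckeSum l (n / p / p) else 0 := by
  have hp0 : ((p : ℤ) : Zrt2) ≠ 0 := by
    intro h
    have := norm_natCast_natAbs p
    rw [h, Zsqrtd.norm_zero] at this
    exact mul_ne_zero hp.ne_zero hp.ne_zero this.symm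
  split_ifs with h
  · have e : n = p * p * (n / p / p) := by
      rw [mul_assoc, Nat.mul_div_cancel' h, Nat.mul_div_cancel' hn]
    have := sum_dvd_hecke l hp0 (n / p / p)
    rw [norm_natCast_natAbs, ← e, hecke_intCast, one_mul] at this
    exact this
  · refine Finset.sum_eq_zero fun z hz ↦ if_neg fun hd ↦ h ?_
    obtain ⟨w, rfl⟩ := hd
    have h1 := (mem_domZ.mp hz).2
    rw [Zsqrtd.norm_mul, Int.natAbs_mul, norm_natCast_natAbs] at h1
    rw [← h1, mul_assoc, Nat.mul_div_cancel_left _ hp.pos]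
    exact dvd_mul_right _ _

lemma heckeSum_one (l : ℕ) : heckeSum l 1 = 1 := by
  have : domZ 1 = {1} := by
    ext z
    rw [mem_domZ, Finset.mem_singleton]
    constructor
    · rintro ⟨h1, h2⟩
      exact h1.eq_one h2
    · rintro rfl
      exact ⟨⟨by simp, by simp, by simp⟩, by simp⟩
  rw [heckeSum, this, Finset.sum_singleton]
  exact_mod_cast hecke_intCast l 1

lemma heckeSum_split (l : ℕ) {p : ℕ} (hp : p.Prime) (hp2 : p ≠ 2) {ρ : Zrt2} (hρ : ρ.norm = p)
    {n : ℕ} (hn : p ∣ n) :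
    heckeSum l n = (hecke l ρ + hecke l (sigma ρ)) * heckeSum l (n / p) -
      hecke l ρ * hecke l (sigma ρ) * (if p ∣ n / p then heckeSum l (n / p / p) else 0) := by
  classical
  have hρ0 : ρ ≠ 0 := by
    rintro rfl
    rw [Zsqrtd.norm_zero] at hρ
    exact hp.ne_zero (by exact_mod_cast hρ.symm)
  have h1 := sum_dvd_hecke l hρ0 (n / p)
  have h2 := sum_dvd_hecke l (sigma_ne_zero hρ0) (n / p)
  rw [norm_sigma] at h2
  rw [hρ, Int.natAbs_natCast, Nat.mul_div_cancel' hn] at h1 h2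
  have h3 := sum_prime_dvd_hecke l hp hn
  have h4 : hecke l ρ * hecke l (sigma ρ) = 1 := by
    rw [← hecke_mul l hρ0 (sigma_ne_zero hρ0), mul_sigma, hecke_intCast]
  rw [h4, one_mul, add_mul, ← h1, ← h2, ← h3, ← Finset.sum_add_distrib, ← Finset.sum_sub_distrib,
    heckeSum]
  refine Finset.sum_congr rfl fun z hz ↦ ?_
  have hor := dvd_or_dvd_sigma hp hρ (dvd_norm_of_mem_domZ hn hz)
  have hand := dvd_and_dvd_sigma_iff hp hp2 hρ (z := z)
  by_cases ha : ρ ∣ z <;> by_cases hb : sigma ρ ∣ z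
  · rw [if_pos ha, if_pos hb, if_pos (hand.mp ⟨ha, hb⟩)]; ring
  · rw [if_pos ha, if_neg hb, if_neg fun h ↦ hb (hand.mpr h).2]; ring
  · rw [if_neg ha, if_pos hb, if_neg fun h ↦ ha (hand.mpr h).1]; ring
  · exact absurd hor (by tauto)

lemma heckeSum_inert (l : ℕ) {p : ℕ} (hp : p.Prime) (hp2 : p ≠ 2)
    (h8 : ¬ (p % 8 = 1 ∨ p % 8 = 7)) {n : ℕ} (hn : p ∣ n) :
    heckeSum l n = if p ∣ n / p then heckeSum l (n / p / p) else 0 := by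
  classical
  rw [← sum_prime_dvd_hecke l hp hn, heckeSum]
  exact Finset.sum_congr rfl fun z hz ↦
    (if_pos (intCast_dvd_of_inert hp hp2 h8 (dvd_norm_of_mem_domZ hn hz))).symm

lemma heckeSum_two (l : ℕ) {n : ℕ} (hn : 2 ∣ n) : heckeSum l n = heckeSum l (n / 2) := by
  classical
  have h0 : (⟨0, 1⟩ : Zrt2) ≠ 0 := by
    intro h
    have := congrArg Zsqrtd.im h
    simp at this
  have h1 := sum_dvd_hecke l h0 (n / 2)
  have h2 : (Zsqrtd.norm (⟨0, 1⟩ : Zrt2)).natAbs = 2 := by simp [Zsqrtd.norm]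
  have h3 : hecke l (⟨0, 1⟩ : Zrt2) = 1 := by
    have : ratioArg (⟨0, 1⟩ : Zrt2) = 0 := by
      rw [ratioArg, toR_sigma, toR]
      simp
    rw [hecke, this]
    simp
  rw [h2, Nat.mul_div_cancel' hn, h3, one_mul] at h1
  rw [← h1, heckeSum]
  exact Finset.sum_congr rfl fun z hz ↦
    (if_pos (sqrt_two_dvd_of_two_dvd_norm (dvd_norm_of_mem_domZ hn hz))).symm

lemma heckeSum_eq {ρ : ℕ → Zrt2}
    (hρ : ∀ p : ℕ, p.Prime → (p % 8 = 1 ∨ p % 8 = 7) → (ρ p).norm = p) (l : ℕ) {n : ℕ}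
    (hn : n ≠ 0) : heckeSum l n = (toArith (eulerU ρ l) * toArith (eulerV ρ l)) n := by
  induction n using Nat.strong_induction_on with
  | _ n ih =>
  rcases eq_or_ne n 1 with rfl | h1
  · rw [heckeSum_one]
    simp [ArithmeticFunction.mul_apply]
  have hp := Nat.minFac_prime h1
  have hpn := Nat.minFac_dvd n
  set p := n.minFac
  have hnp0 : n / p ≠ 0 := (Nat.div_pos (Nat.le_of_dvd (by omega) hpn) hp.pos).ne'
  have ih1 := ih (n / p) (Nat.div_lt_self (by omega) hp.one_lt) hnp0
  have ih2 : (if p ∣ n / p then heckeSum l (n / p / p) else 0) = if p ∣ n / p then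
      (toArith (eulerU ρ l) * toArith (eulerV ρ l)) (n / p / p) else 0 := by
    split_ifs with h
    · refine ih _ ?_ (Nat.div_pos (Nat.le_of_dvd (Nat.pos_of_ne_zero hnp0) h) hp.pos).ne'
      exact (Nat.div_lt_self (Nat.pos_of_ne_zero hnp0) hp.one_lt).trans
        (Nat.div_lt_self (by omega) hp.one_lt)
    · rfl
  rw [toArith_mul_toArith_recursion _ _ hp hpn, ← ih1, ← ih2, eulerU, eulerV,
    ofPrimes_prime _ hp, ofPrimes_prime _ hp]
  by_cases h8 : p % 8 = 1 ∨ p % 8 = 7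
  · rw [if_pos h8, if_pos h8]
    exact heckeSum_split l hp (by omega) (hρ p hp h8) hpn
  · rw [if_neg h8, if_neg h8]
    by_cases h2 : p = 2
    · rw [if_pos h2, h2, heckeSum_two l (h2 ▸ hpn)]
      ring
    · rw [if_neg h2, heckeSum_inert l hp h2 h8 hpn]
      ring

lemma psum_euler {ρ : ℕ → Zrt2}
    (hρ : ∀ p : ℕ, p.Prime → (p % 8 = 1 ∨ p % 8 = 7) → (ρ p).norm = p) (l : ℕ) (X : ℝ) :
    psum (toArith (eulerU ρ l) * toArith (eulerV ρ l)) X =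
      ∑ n ∈ Finset.Icc 1 ⌊X⌋₊, heckeSum l n := by
  refine Finset.sum_congr rfl fun n hn ↦ (heckeSum_eq hρ l ?_).symm
  rw [Finset.mem_Icc] at hn
  omega

/-- `cos (freq l * log (ρ_p / σ(ρ_p)))` at the primes `p` that split in `ℤ[√2]`, and `0` at the
other primes. -/
def splitCos (ρ : ℕ → Zrt2) (l p : ℕ) : ℝ :=
  if p % 8 = 1 ∨ p % 8 = 7 then Real.cos (freq l * ratioArg (ρ p)) else 0

lemma re_hecke (l : ℕ) (z : Zrt2) : (hecke l z).re = Real.cos (freq l * ratioArg z) :=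
  Complex.exp_ofReal_mul_I_re _

lemma freq_two_mul (l : ℕ) : freq (2 * l) = 2 * freq l := by
  rw [freq, freq]
  push_cast
  ring

lemma re_euler_add (ρ : ℕ → Zrt2) (l : ℕ) {p : ℕ} (hp : p.Prime) :
    (eulerU ρ l p).re + (eulerV ρ l p).re = 2 * splitCos ρ l p + if p = 2 then 1 else 0 := by
  rw [eulerU, eulerV, ofPrimes_prime _ hp, ofPrimes_prime _ hp, splitCos]
  by_cases h8 : p % 8 = 1 ∨ p % 8 = 7
  · have h2 : p ≠ 2 := by omega
    rw [if_pos h8, if_pos h8, if_pos h8, if_neg h2, re_hecke, re_hecke, ratioArg_sigma,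
      mul_neg, Real.cos_neg]
    ring
  · rw [if_neg h8, if_neg h8, if_neg h8]
    by_cases h2 : p = 2 <;> simp [h2]

lemma sum_primesUpTo_ite_eq_two {T : ℝ} (hT : 1 ≤ T) :
    ∑ p ∈ primesUpTo (Real.exp T), (if p = 2 then (1 / 2 : ℝ) else 0) = 1 / 2 := by
  have h2 : 2 ∈ primesUpTo (Real.exp T) := by
    rw [mem_primesUpTo]
    refine ⟨Nat.prime_two, ?_⟩
    have := Real.add_one_le_exp T
    push_cast
    linarith
  rw [Finset.sum_ite_eq' (primesUpTo (Real.exp T)) 2 (fun _ ↦ (1 / 2 : ℝ)), if_pos h2]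

lemma truncSum_euler_add (ρ : ℕ → Zrt2) (l : ℕ) {T : ℝ} (hT : 1 ≤ T) :
    truncSum (fun p ↦ (eulerU ρ l p).re) (Real.exp T) +
      truncSum (fun p ↦ (eulerV ρ l p).re) (Real.exp T) =
      2 * truncSum (splitCos ρ l) (Real.exp T) + 1 / 2 := by
  rw [truncSum, truncSum, truncSum, ← sum_primesUpTo_ite_eq_two hT, Finset.mul_sum,
    ← Finset.sum_add_distrib, ← Finset.sum_add_distrib]
  refine Finset.sum_congr rfl fun p hp ↦ ?_
  rw [← add_div, re_euler_add ρ l (mem_primesUpTo.mp hp).1, add_div, mul_div_assoc]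
  congr 1
  split_ifs with h
  · rw [h]; norm_num
  · simp

lemma three_four_one_nonneg (ρ : ℕ → Zrt2) (l : ℕ) {p : ℕ} (hp : p.Prime) (hp2 : p ≠ 2) :
    0 ≤ 3 * (1 + (chiHom p).re) + 4 * ((eulerU ρ l p).re + (eulerV ρ l p).re) +
      ((eulerU ρ (2 * l) p).re + (eulerV ρ (2 * l) p).re) := by
  rw [re_euler_add ρ l hp, re_euler_add ρ (2 * l) hp, if_neg hp2, chiHom_apply, splitCos, splitCos]
  have hodd := hp.eq_two_or_odd
  by_cases h8 : p % 8 = 1 ∨ p % 8 = 7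
  · rw [if_neg (by omega), if_pos h8, if_pos h8, if_pos h8, freq_two_mul, mul_assoc 2,
      Real.cos_two_mul]
    simp only [Complex.one_re]
    nlinarith [sq_nonneg (1 + Real.cos (freq l * ratioArg (ρ p)))]
  · rw [if_neg (by omega), if_neg h8, if_neg h8, if_neg h8]
    simp

lemma log_add_ge (l : ℕ) : 3.46 ≤ Real.log (l + 32) := by
  have h2 := Real.log_two_gt_d9
  have h32 : Real.log 32 = 5 * Real.log 2 := by
    rw [show (32 : ℝ) = 2 ^ 5 by norm_num, Real.log_pow]; norm_num
  have hl : Real.log 32 ≤ Real.log (l + 32) :=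
    Real.log_le_log (by norm_num) (by linarith [Nat.cast_nonneg (α := ℝ) l])
  linarith

lemma eleven_tenths_le_log_rpow {l : ℕ} :
    (11 / 10 : ℝ) ≤ Real.log (l + 32) ^ (1 / 13 : ℝ) := by
  have h : (11 / 10 : ℝ) ^ 13 ≤ Real.log (l + 32) :=
    le_trans (by norm_num) (log_add_ge l)
  calc (11 / 10 : ℝ) = ((11 / 10 : ℝ) ^ 13) ^ (1 / 13 : ℝ) := by
        rw [← Real.rpow_natCast, ← Real.rpow_mul (by norm_num)]; norm_num
    _ ≤ _ := Real.rpow_le_rpow (by positivity) h (by norm_num)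

/-- The Hecke characters have bounded prime sums beyond `exp (C₁ (log l) ^ 2)`. -/
theorem exists_abs_truncSum_splitCos_sub_le : ∃ C C₁ : ℝ, 0 ≤ C ∧ 1 ≤ C₁ ∧
    ∀ l : ℕ, l ≠ 0 → ∀ ρ : ℕ → Zrt2,
    (∀ p : ℕ, p.Prime → (p % 8 = 1 ∨ p % 8 = 7) → (ρ p).norm = p) →
    ∀ T₁ T₂ : ℝ, C₁ * Real.log (l + 32) ^ 2 ≤ T₁ → C₁ * Real.log (l + 32) ^ 2 ≤ T₂ →
    |truncSum (splitCos ρ l) (Real.exp T₁) - truncSum (splitCos ρ l) (Real.exp T₂)| ≤ C := by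
  have hF := freq_nonneg 1
  obtain ⟨C, C₁, hC, hC₁, h⟩ := exists_abs_truncSum_sub_le (96 * freq 1 + 15) (by positivity)
  refine ⟨C, C₁, hC, hC₁, fun l hl ρ hρ T₁ T₂ hT₁ hT₂ ↦ ?_⟩
  have ha := eleven_tenths_le_log_rpow (l := l)
  have hlog1 : 1 ≤ Real.log (l + 32) := le_trans (by norm_num) (log_add_ge l)
  set a := Real.log (l + 32) ^ (1 / 13 : ℝ) with ha_def
  have ha13 : a ^ 13 = Real.log (l + 32) := by
    rw [ha_def, ← Real.rpow_natCast, ← Real.rpow_mul (by linarith)]; norm_num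
  have ha26 : a ^ 26 = Real.log (l + 32) ^ 2 := by
    rw [← ha13]; ring
  have hl0 : (0 : ℝ) ≤ l := Nat.cast_nonneg l
  have hexp : Real.exp (a ^ 13) = l + 32 := by
    rw [ha13, Real.exp_log (by positivity)]
  have hfreq : freq l = freq 1 * l := by
    rw [freq, freq]; push_cast; ring
  have hlin (m : ℕ) (X : ℝ) (hX : 0 ≤ X) :
      ‖psum (toArith (eulerU ρ m) * toArith (eulerV ρ m)) X‖ ≤ (96 * freq 1 + 15) * X := by
    rw [psum_euler hρ]
    refine (norm_sum_heckeSum_le_mul m hX).trans ?_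
    gcongr
    linarith
  have hsqrt (m : ℕ) (hm : m ≠ 0) (hm2 : freq m ≤ 2 * freq l) (X : ℝ) (hX : 0 ≤ X) :
      ‖psum (toArith (eulerU ρ m) * toArith (eulerV ρ m)) X‖ ≤
        (96 * freq 1 + 15) * Real.exp (a ^ 13) * Real.sqrt X := by
    rw [psum_euler hρ, hexp]
    refine (norm_sum_heckeSum_le hm hX).trans ?_
    gcongr
    rw [hfreq] at hm2
    nlinarith
  have key := h a ha (eulerU ρ l) (eulerV ρ l) (eulerU ρ (2 * l)) (eulerV ρ (2 * l))
    (norm_eulerU_le ρ l) (norm_eulerV_le ρ l) (norm_eulerU_le ρ _) (norm_eulerV_le ρ _)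
    (hsqrt l hl (by linarith [freq_nonneg l])) (hlin l)
    (hsqrt (2 * l) (by omega) (freq_two_mul l).le) (hlin _)
    (fun p hp hp2 ↦ three_four_one_nonneg ρ l hp hp2) T₁ T₂ (ha26 ▸ hT₁) (ha26 ▸ hT₂)
  have hone : 1 ≤ C₁ * Real.log (l + 32) ^ 2 :=
    one_le_mul_of_one_le_of_one_le hC₁ (one_le_pow₀ hlog1)
  rw [truncSum_euler_add ρ l (hone.trans hT₁), truncSum_euler_add ρ l (hone.trans hT₂)] at key
  rw [abs_le] at key ⊢
  constructor <;> linarith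

section Fourier

local instance : Fact (0 < Real.pi) := ⟨Real.pi_pos⟩

lemma periodic_abs_cos : Function.Periodic (fun y : ℝ ↦ ((|Real.cos y| : ℝ) : ℂ)) Real.pi := by
  intro y
  simp only [Real.cos_add_pi, abs_neg]

/-- `|cos|` on the circle `ℝ / πℤ`. -/
def absCosCircle : C(AddCircle Real.pi, ℂ) where
  toFun := periodic_abs_cos.lift
  continuous_toFun := continuous_coinduced_dom.mpr <| by
    change Continuous fun y : ℝ ↦ ((|Real.cos y| : ℝ) : ℂ)
    fun_prop

lemma absCosCircle_coe (y : ℝ) : absCosCircle (y : AddCircle Real.pi) = (|Real.cos y| : ℝ) := rfl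

lemma one_sub_four_mul_sq_ne_zero (n : ℤ) : (1 - 4 * (n : ℂ) ^ 2) ≠ 0 := by
  have h : (1 - 4 * n ^ 2 : ℤ) ≠ 0 := by omega
  exact_mod_cast h

lemma exp_pi_mul_int (n : ℤ) : Complex.exp (Real.pi * n * Complex.I) = (-1) ^ n := by
  rw [← Complex.exp_pi_mul_I, ← Complex.exp_int_mul]
  congr 1
  ring

lemma integral_exp_mul_cos (n : ℤ) :
    ∫ y in (-(Real.pi / 2))..(Real.pi / 2),
      Complex.exp (-(2 * n * Complex.I) * y) * (Real.cos y : ℂ) =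
      2 * (-1) ^ n / (1 - 4 * (n : ℂ) ^ 2) := by
  have hn := one_sub_four_mul_sq_ne_zero n
  have hderiv (y : ℝ) : HasDerivAt (fun y : ℝ ↦ Complex.exp (-(2 * n * Complex.I) * y) *
      ((Real.sin y : ℂ) - 2 * n * Complex.I * (Real.cos y : ℂ)) / (1 - 4 * (n : ℂ) ^ 2))
      (Complex.exp (-(2 * n * Complex.I) * y) * (Real.cos y : ℂ)) y := by
    have h1 : HasDerivAt (fun y : ℝ ↦ Complex.exp (-(2 * n * Complex.I) * y))
        (Complex.exp (-(2 * n * Complex.I) * y) * (-(2 * n * Complex.I) * 1)) y :=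
      ((Complex.ofRealCLM.hasDerivAt (x := y)).const_mul _).cexp
    have h2 : HasDerivAt (fun y : ℝ ↦ ((Real.sin y : ℂ) - 2 * n * Complex.I * (Real.cos y : ℂ)))
        ((Real.cos y : ℂ) - 2 * n * Complex.I * ((-Real.sin y : ℝ) : ℂ)) y :=
      (Real.hasDerivAt_sin y).ofReal_comp.sub ((Real.hasDerivAt_cos y).ofReal_comp.const_mul _)
    convert! (h1.mul h2).div_const _ using 1
    rw [eq_div_iff hn]
    push_cast
    linear_combination (4 * (n : ℂ) ^ 2 * Complex.exp (-(2 * n * Complex.I) * y) * Complex.cos y) *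
      (- Complex.I_sq)
  rw [intervalIntegral.integral_eq_sub_of_hasDerivAt (fun y _ ↦ hderiv y)
    (Continuous.intervalIntegrable (by fun_prop) _ _)]
  have h1 : Complex.exp (-(2 * n * Complex.I) * ((Real.pi / 2 : ℝ) : ℂ)) = (-1) ^ n := by
    rw [show -(2 * n * Complex.I) * ((Real.pi / 2 : ℝ) : ℂ) =
      Real.pi * ((-n : ℤ) : ℂ) * Complex.I by push_cast; ring, exp_pi_mul_int]
    simp [zpow_neg, ← inv_zpow]
  have h2 : Complex.exp (-(2 * n * Complex.I) * ((-(Real.pi / 2) : ℝ) : ℂ)) = (-1) ^ n := by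
    rw [show -(2 * n * Complex.I) * ((-(Real.pi / 2) : ℝ) : ℂ) =
      Real.pi * (n : ℂ) * Complex.I by push_cast; ring, exp_pi_mul_int]
  rw [h1, h2, Real.sin_neg, Real.cos_neg, Real.sin_pi_div_two, Real.cos_pi_div_two]
  push_cast
  ring

lemma fourierCoeff_absCosCircle (n : ℤ) :
    fourierCoeff absCosCircle n = 2 / Real.pi * ((-1) ^ n / (1 - 4 * (n : ℂ) ^ 2)) := by
  rw [fourierCoeff_eq_intervalIntegral _ n (-(Real.pi / 2)),
    show -(Real.pi / 2) + Real.pi = Real.pi / 2 by ring]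
  have h : ∫ y in (-(Real.pi / 2))..(Real.pi / 2), fourier (-n) (y : AddCircle Real.pi) •
      absCosCircle (y : AddCircle Real.pi) = ∫ y in (-(Real.pi / 2))..(Real.pi / 2),
      Complex.exp (-(2 * n * Complex.I) * y) * (Real.cos y : ℂ) := by
    refine intervalIntegral.integral_congr fun y hy ↦ ?_
    rw [Set.uIcc_of_le (by linarith [Real.pi_pos])] at hy
    have hpi : (Real.pi : ℂ) ≠ 0 := by exact_mod_cast Real.pi_ne_zero
    simp only [absCosCircle_coe, fourier_coe_apply, smul_eq_mul]
    rw [abs_of_nonneg (Real.cos_nonneg_of_mem_Icc hy)]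
    congr 2
    push_cast
    field_simp
  rw [h, integral_exp_mul_cos, Complex.real_smul]
  push_cast
  ring

lemma summable_fourierCoeff_absCosCircle : Summable (fourierCoeff absCosCircle) := by
  have hs : Summable fun n : ℤ ↦ 1 / (n : ℝ) ^ 2 := Real.summable_one_div_int_pow.mpr (by norm_num)
  refine Summable.of_norm_bounded_eventually (hs.mul_left 1) ?_
  filter_upwards [(Set.finite_singleton (0 : ℤ)).compl_mem_cofinite] with n hn
  have hn0 : n ≠ 0 := by simpa using hn
  have hn1 : (1 : ℝ) ≤ (n : ℝ) ^ 2 := by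
    have : 1 ≤ n ^ 2 := by have := sq_nonneg n; have : n ^ 2 ≠ 0 := pow_ne_zero 2 hn0; omega
    exact_mod_cast this
  have hpi := Real.pi_gt_three
  have hnorm : ‖(1 - 4 * (n : ℂ) ^ 2)‖ = 4 * (n : ℝ) ^ 2 - 1 := by
    rw [show (1 - 4 * (n : ℂ) ^ 2) = ((1 - 4 * (n : ℝ) ^ 2 : ℝ) : ℂ) by push_cast; ring,
      Complex.norm_real, Real.norm_eq_abs, abs_of_nonpos (by linarith)]
    ring
  rw [fourierCoeff_absCosCircle, norm_mul, norm_div, norm_div, hnorm, norm_zpow, norm_neg,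
    norm_one, one_zpow, Complex.norm_real, Real.norm_eq_abs, abs_of_pos Real.pi_pos]
  have h2 : ‖(2 : ℂ)‖ / Real.pi ≤ 1 := by
    rw [div_le_one Real.pi_pos, Complex.norm_ofNat]
    linarith
  have h4 : (n : ℝ) ^ 2 ≤ 4 * (n : ℝ) ^ 2 - 1 := by linarith
  exact mul_le_mul h2 (one_div_le_one_div_of_le (by linarith) h4)
    (one_div_nonneg.mpr (by linarith)) zero_le_one

/-- The Fourier series of `|cos|`. -/
theorem hasSum_abs_cos (θ : ℝ) :
    HasSum (fun m : ℕ ↦ 4 / Real.pi * ((-1) ^ m / (4 * ((m : ℝ) + 1) ^ 2 - 1)) *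
      Real.cos (2 * (m + 1) * θ)) (|Real.cos θ| - 2 / Real.pi) := by
  have h := (has_pointwise_sum_fourier_series_of_summable summable_fourierCoeff_absCosCircle
    (θ : AddCircle Real.pi)).nat_add_neg
  have h' := (hasSum_nat_add_iff' 1).mpr h
  rw [absCosCircle_coe] at h'
  rw [← Complex.hasSum_ofReal]
  convert! h' using 1
  · funext m
    have hpi : (Real.pi : ℂ) ≠ 0 := by exact_mod_cast Real.pi_ne_zero
    have e1 : (2 * Real.pi * Complex.I * ((m + 1 : ℕ) : ℤ) * θ / Real.pi : ℂ) =
        2 * (m + 1) * θ * Complex.I := by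
      push_cast; field_simp
    have e2 : (2 * Real.pi * Complex.I * ((-((m + 1 : ℕ) : ℤ) : ℤ) : ℂ) * θ / Real.pi : ℂ) =
        -(2 * (m + 1) * θ) * Complex.I := by
      push_cast; field_simp
    have hm : (1 - 4 * ((m : ℂ) + 1) ^ 2) ≠ 0 := by
      have := one_sub_four_mul_sq_ne_zero (m + 1)
      push_cast at this
      exact this
    have hm' : (4 * ((m : ℂ) + 1) ^ 2 - 1) ≠ 0 := by
      rw [← neg_ne_zero, neg_sub]; exact hm
    rw [fourierCoeff_absCosCircle, fourierCoeff_absCosCircle, fourier_coe_apply,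
      fourier_coe_apply, e1, e2, smul_eq_mul, smul_eq_mul, zpow_neg, ← inv_zpow, inv_neg_one,
      zpow_natCast, pow_succ]
    push_cast
    rw [Complex.cos, neg_sq,
      show (1 - 4 * ((m : ℂ) + 1) ^ 2) = -(4 * ((m : ℂ) + 1) ^ 2 - 1) by ring]
    field_simp
    ring
  · simp [fourierCoeff_absCosCircle]

end Fourier

/-- The indicator function of the primes that split in `ℤ[√2]`. -/
def splitInd (p : ℕ) : ℝ := if p % 8 = 1 ∨ p % 8 = 7 then 1 else 0

lemma abs_splitCos_le (ρ : ℕ → Zrt2) (l p : ℕ) : |splitCos ρ l p| ≤ splitInd p := by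
  rw [splitCos, splitInd]
  split_ifs
  · exact Real.abs_cos_le_one _
  · simp

lemma abs_truncSum_sub_le {f g : ℕ → ℝ} (hfg : ∀ p, |f p| ≤ g p) {X Y : ℝ} (h : Y ≤ X) :
    |truncSum f X - truncSum f Y| ≤ truncSum g X - truncSum g Y := by
  have hsub : primesUpTo Y ⊆ primesUpTo X := fun p hp ↦ by
    rw [mem_primesUpTo] at hp ⊢
    exact ⟨hp.1, hp.2.trans h⟩
  have e (f : ℕ → ℝ) : truncSum f X - truncSum f Y =
      ∑ p ∈ primesUpTo X \ primesUpTo Y, f p / p := by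
    rw [truncSum, truncSum, ← Finset.sum_sdiff hsub, add_sub_cancel_right]
  rw [e, e]
  refine (Finset.abs_sum_le_sum_abs _ _).trans (Finset.sum_le_sum fun p _ ↦ ?_)
  rw [abs_div, Nat.abs_cast]
  gcongr
  exact hfg p

lemma abs_truncSum_splitInd_sub_le : ∃ C : ℝ, 0 ≤ C ∧ ∀ T : ℝ, 1 ≤ T →
    |truncSum splitInd (Real.exp T) - Real.log T / 2| ≤ C := by
  obtain ⟨A, hA, h1⟩ := abs_truncSum_one_sub_le
  obtain ⟨B, hB, h2⟩ := abs_truncSum_chi_le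
  refine ⟨A + B + 1, by positivity, fun T hT ↦ ?_⟩
  have key : truncSum (fun _ ↦ 1) (Real.exp T) + truncSum (fun p ↦ (chiHom p).re) (Real.exp T) =
      2 * truncSum splitInd (Real.exp T) + 1 / 2 := by
    rw [truncSum, truncSum, truncSum, ← sum_primesUpTo_ite_eq_two hT, Finset.mul_sum,
      ← Finset.sum_add_distrib, ← Finset.sum_add_distrib]
    refine Finset.sum_congr rfl fun p hp ↦ ?_
    have hodd := (mem_primesUpTo.mp hp).1.eq_two_or_odd
    rw [chiHom_apply, splitInd]
    by_cases hp2 : p = 2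
    · simp [hp2]
    · rw [if_neg (by omega), if_neg hp2]
      split_ifs
      · rw [Complex.one_re]; ring
      · rw [Complex.neg_re, Complex.one_re]; ring
  have := h1 T hT
  have := h2 T hT
  rw [abs_le] at *
  constructor <;> linarith

lemma log_add_le_log_add_log {m n : ℕ} (hn : n ≠ 0) :
    Real.log (((m + 1) * n : ℕ) + 32) ≤
      7 * Real.log (2 * n) * (1 + Real.log (m + 1)) := by
  have hn1 : (1 : ℝ) ≤ n := by exact_mod_cast Nat.one_le_iff_ne_zero.mpr hn
  have hm0 : (0 : ℝ) ≤ m := Nat.cast_nonneg m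
  have h2 := Real.log_two_gt_d9
  have h64 : Real.log 64 = 6 * Real.log 2 := by
    rw [show (64 : ℝ) = 2 ^ 6 by norm_num, Real.log_pow]; norm_num
  have hL : Real.log 2 ≤ Real.log (2 * n) := Real.log_le_log (by norm_num) (by linarith)
  have hlm : 0 ≤ Real.log (m + 1) := Real.log_nonneg (by linarith)
  have h1 : Real.log (((m + 1) * n : ℕ) + 32) ≤ Real.log ((m + 1) * (64 * (2 * n))) := by
    refine Real.log_le_log (by positivity) ?_
    push_cast
    nlinarith [mul_nonneg hm0 (zero_le_one.trans hn1)]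
  rw [Real.log_mul (by positivity) (by positivity), Real.log_mul (by norm_num) (by positivity),
    h64] at h1
  nlinarith

/-- The absolute values of the Fourier coefficients of `|cos|`. -/
def cosCoeff (m : ℕ) : ℝ := 4 / Real.pi * (1 / (4 * ((m : ℝ) + 1) ^ 2 - 1))

lemma cosCoeff_nonneg (m : ℕ) : 0 ≤ cosCoeff m := by
  have : (0 : ℝ) ≤ 4 * ((m : ℝ) + 1) ^ 2 - 1 := by nlinarith [Nat.cast_nonneg (α := ℝ) m]
  have := Real.pi_pos
  unfold cosCoeff
  positivity

lemma summable_cosCoeff_mul (A : ℝ) (hA : 0 ≤ A) :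
    Summable fun m : ℕ ↦ cosCoeff m * (A + Real.log (m + 1)) := by
  have hs : Summable fun m : ℕ ↦ 1 / ((m + 1 : ℕ) : ℝ) ^ (3 / 2 : ℝ) :=
    (summable_nat_add_iff 1).mpr (Real.summable_one_div_nat_rpow.mpr (by norm_num))
  refine Summable.of_nonneg_of_le (fun m ↦ ?_) (fun m ↦ ?_) (hs.mul_left (2 * (A + 2)))
  · have : (0 : ℝ) ≤ Real.log (m + 1) := Real.log_nonneg (by linarith [Nat.cast_nonneg (α := ℝ) m])
    exact mul_nonneg (cosCoeff_nonneg m) (by positivity)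
  · have hy : (1 : ℝ) ≤ (m : ℝ) + 1 := by linarith [Nat.cast_nonneg (α := ℝ) m]
    push_cast
    rw [cosCoeff]
    set y : ℝ := (m : ℝ) + 1
    have hs1 : 1 ≤ Real.sqrt y := Real.one_le_sqrt.mpr hy
    have hlog : Real.log y ≤ 2 * Real.sqrt y := by
      have := Real.log_le_sub_one_of_pos (show 0 < Real.sqrt y by positivity)
      rw [Real.log_sqrt (by positivity)] at this
      linarith
    have hpow : y ^ (3 / 2 : ℝ) * Real.sqrt y = y ^ 2 := by
      rw [Real.sqrt_eq_rpow, ← Real.rpow_add (by positivity), ← Real.rpow_natCast]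
      norm_num
    have hp0 : 0 < y ^ (3 / 2 : ℝ) := by positivity
    have hpi := Real.pi_gt_three
    have h1 : 4 / Real.pi ≤ 2 := by rw [div_le_iff₀ Real.pi_pos]; linarith
    have hd : y ^ 2 ≤ 4 * y ^ 2 - 1 := by nlinarith
    have h2 : 1 / (4 * y ^ 2 - 1) ≤ 1 / y ^ 2 := one_div_le_one_div_of_le (by positivity) hd
    have h3 : A + Real.log y ≤ (A + 2) * Real.sqrt y := by nlinarith
    have hlog0 := Real.log_nonneg hy
    calc 4 / Real.pi * (1 / (4 * y ^ 2 - 1)) * (A + Real.log y)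
        ≤ 2 * (1 / y ^ 2) * ((A + 2) * Real.sqrt y) := by
          have : 0 ≤ 4 * y ^ 2 - 1 := by nlinarith
          gcongr
      _ = 2 * (A + 2) * (1 / y ^ (3 / 2 : ℝ)) := by
          rw [← hpow]
          field_simp

lemma hasSum_truncSum_abs_cos (ρ : ℕ → Zrt2) (n : ℕ) (X : ℝ) :
    HasSum (fun m : ℕ ↦ 4 / Real.pi * ((-1) ^ m / (4 * ((m : ℝ) + 1) ^ 2 - 1)) *
      truncSum (splitCos ρ ((m + 1) * n)) X)
      (truncSum (fun p ↦ splitInd p * |Real.cos (freq n / 2 * ratioArg (ρ p))|) X -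
        2 / Real.pi * truncSum splitInd X) := by
  have h (p : ℕ) (_ : p ∈ primesUpTo X) :=
    (hasSum_abs_cos (freq n / 2 * ratioArg (ρ p))).mul_left (splitInd p / p)
  convert! hasSum_sum h using 1
  · funext m
    rw [truncSum, Finset.mul_sum]
    refine Finset.sum_congr rfl fun p _ ↦ ?_
    have e : 2 * ((m : ℝ) + 1) * (freq n / 2 * ratioArg (ρ p)) =
        freq ((m + 1) * n) * ratioArg (ρ p) := by
      rw [freq, freq]; push_cast; ring
    rw [e, splitCos, splitInd]
    split_ifs <;> ring
  · rw [truncSum, truncSum, Finset.mul_sum, ← Finset.sum_sub_distrib]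
    refine Finset.sum_congr rfl fun p _ ↦ ?_
    ring

/-- The prime sums of the Hecke characters vary little beyond `exp (49 C₁ (log k) ^ 2)`. -/
lemma exists_abs_truncSum_splitCos_sub_le_add_log : ∃ C C₁ : ℝ, 0 ≤ C ∧ 1 ≤ C₁ ∧
    ∀ n : ℕ, n ≠ 0 → ∀ ρ : ℕ → Zrt2,
    (∀ p : ℕ, p.Prime → (p % 8 = 1 ∨ p % 8 = 7) → (ρ p).norm = p) →
    ∀ m : ℕ, ∀ T : ℝ, C₁ * (7 * Real.log (2 * n)) ^ 2 ≤ T →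
    |truncSum (splitCos ρ ((m + 1) * n)) (Real.exp T) -
      truncSum (splitCos ρ ((m + 1) * n)) (Real.exp (C₁ * (7 * Real.log (2 * n)) ^ 2))| ≤
      C + Real.log (m + 1) := by
  obtain ⟨A, C₁, hA, hC₁, h⟩ := exists_abs_truncSum_splitCos_sub_le
  obtain ⟨B, hB, hind⟩ := abs_truncSum_splitInd_sub_le
  refine ⟨A + 2 * B, C₁, by positivity, hC₁, fun n hn ρ hρ m T hT ↦ ?_⟩
  have hn1 : (1 : ℝ) ≤ n := by exact_mod_cast Nat.one_le_iff_ne_zero.mpr hn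
  have hm0 : (0 : ℝ) ≤ m := Nat.cast_nonneg m
  have h2 := Real.log_two_gt_d9
  have hL : Real.log 2 ≤ Real.log (2 * n) := Real.log_le_log (by norm_num) (by linarith)
  have hlog := log_add_le_log_add_log (m := m) hn
  set W := 7 * Real.log (2 * n) with hW
  have hW1 : 1 ≤ W := by linarith
  set l := (m + 1) * n with hl
  have hl0 : l ≠ 0 := by positivity
  set q := 1 + Real.log (m + 1) with hq
  have hq1 : 1 ≤ q := by linarith [Real.log_nonneg (show (1 : ℝ) ≤ (m : ℝ) + 1 by linarith)]
  have hT₀ : 1 ≤ C₁ * W ^ 2 := one_le_mul_of_one_le_of_one_le hC₁ (one_le_pow₀ hW1)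
  have hlog0 : 0 ≤ Real.log (l + 32) := Real.log_nonneg (by linarith [Nat.cast_nonneg (α := ℝ) l])
  have hthr : C₁ * Real.log (l + 32) ^ 2 ≤ C₁ * W ^ 2 * q ^ 2 := by
    rw [mul_assoc, ← mul_pow]
    gcongr
  have hlogq : Real.log q ≤ Real.log (m + 1) := by
    have := Real.log_le_sub_one_of_pos (show 0 < q by linarith)
    linarith
  have hshort (T' : ℝ) (h1 : C₁ * W ^ 2 ≤ T') (h2 : T' ≤ C₁ * W ^ 2 * q ^ 2) :
      |truncSum (splitCos ρ l) (Real.exp T') - truncSum (splitCos ρ l) (Real.exp (C₁ * W ^ 2))| ≤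
        2 * B + Real.log (m + 1) := by
    refine (abs_truncSum_sub_le (abs_splitCos_le ρ l) (Real.exp_le_exp.mpr h1)).trans ?_
    have i1 := abs_le.mp (hind T' (hT₀.trans h1))
    have i2 := abs_le.mp (hind _ hT₀)
    have i3 : Real.log T' ≤ Real.log (C₁ * W ^ 2 * q ^ 2) := Real.log_le_log (by linarith) h2
    rw [Real.log_mul (by positivity) (by positivity), Real.log_pow q] at i3
    push_cast at i3
    linarith
  rcases le_total T (C₁ * W ^ 2 * q ^ 2) with hle | hge
  · linarith [hshort T hT hle]
  · have k1 := hshort _ (le_mul_of_one_le_right (by linarith) (one_le_pow₀ hq1)) le_rfl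
    have k2 := h l hl0 ρ hρ T _ (hthr.trans hge) hthr
    rw [abs_le] at *
    constructor <;> linarith

/-- The mean of `|cos|` over the split primes, in terms of `log |k| = log (2 n)`. -/
theorem exists_truncSum_abs_cos_le : ∃ C C₁ : ℝ, 0 ≤ C ∧ 1 ≤ C₁ ∧
    ∀ n : ℕ, n ≠ 0 → ∀ ρ : ℕ → Zrt2,
    (∀ p : ℕ, p.Prime → (p % 8 = 1 ∨ p % 8 = 7) → (ρ p).norm = p) →
    ∀ T : ℝ, C₁ * (7 * Real.log (2 * n)) ^ 2 ≤ T →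
    truncSum (fun p ↦ splitInd p * |Real.cos (freq n / 2 * ratioArg (ρ p))|) (Real.exp T) ≤
      1 / Real.pi * Real.log T + (1 - 2 / Real.pi) * Real.log (Real.log (2 * n)) + C := by
  obtain ⟨A, C₁, hA, hC₁, h⟩ := exists_abs_truncSum_splitCos_sub_le_add_log
  obtain ⟨B, hB, hind⟩ := abs_truncSum_splitInd_sub_le
  have hsum := summable_cosCoeff_mul A hA
  have hsum0 : 0 ≤ ∑' m : ℕ, cosCoeff m * (A + Real.log (m + 1)) := tsum_nonneg fun m ↦
    mul_nonneg (cosCoeff_nonneg m) (add_nonneg hA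
      (Real.log_nonneg (by linarith [Nat.cast_nonneg (α := ℝ) m])))
  have hlogC : 0 ≤ Real.log (49 * C₁) := Real.log_nonneg (by linarith)
  have hpi := Real.pi_gt_three
  have hpi2 : 2 / Real.pi ≤ 1 := by rw [div_le_one Real.pi_pos]; linarith
  have hpi0 : 0 ≤ 2 / Real.pi := by positivity
  refine ⟨(∑' m : ℕ, cosCoeff m * (A + Real.log (m + 1))) + B + Real.log (49 * C₁), C₁,
    by positivity, hC₁, fun n hn ρ hρ T hT ↦ ?_⟩
  have hn1 : (1 : ℝ) ≤ n := by exact_mod_cast Nat.one_le_iff_ne_zero.mpr hn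
  have h2 := Real.log_two_gt_d9
  have hL : Real.log 2 ≤ Real.log (2 * n) := Real.log_le_log (by norm_num) (by linarith)
  have hT₀ : 1 ≤ C₁ * (7 * Real.log (2 * n)) ^ 2 :=
    one_le_mul_of_one_le_of_one_le hC₁ (one_le_pow₀ (by linarith))
  have hlogT₀ : Real.log (C₁ * (7 * Real.log (2 * n)) ^ 2) =
      Real.log (49 * C₁) + 2 * Real.log (Real.log (2 * n)) := by
    rw [show C₁ * (7 * Real.log (2 * n)) ^ 2 = 49 * C₁ * Real.log (2 * n) ^ 2 by ring,
      Real.log_mul (by positivity) (by have : 0 < Real.log (2 * n) := by linarith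
                                       positivity), Real.log_pow]
    push_cast
    rfl
  set T₀ := C₁ * (7 * Real.log (2 * n)) ^ 2 with hT₀_def
  set F := fun p ↦ splitInd p * |Real.cos (freq n / 2 * ratioArg (ρ p))| with hF
  have hdiff := (hasSum_truncSum_abs_cos ρ n (Real.exp T)).sub
    (hasSum_truncSum_abs_cos ρ n (Real.exp T₀))
  have hbound := tsum_of_norm_bounded hsum.hasSum (fun m ↦ (?_ : ‖4 / Real.pi *
      ((-1) ^ m / (4 * ((m : ℝ) + 1) ^ 2 - 1)) * truncSum (splitCos ρ ((m + 1) * n)) (Real.exp T) -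
      4 / Real.pi * ((-1) ^ m / (4 * ((m : ℝ) + 1) ^ 2 - 1)) *
      truncSum (splitCos ρ ((m + 1) * n)) (Real.exp T₀)‖ ≤ cosCoeff m * (A + Real.log (m + 1))))
  · rw [hdiff.tsum_eq, Real.norm_eq_abs] at hbound
    have hb := (abs_le.mp hbound).2
    have hF₀ : truncSum F (Real.exp T₀) ≤ truncSum splitInd (Real.exp T₀) := by
      refine Finset.sum_le_sum fun p _ ↦ ?_
      have : 0 ≤ splitInd p := by rw [splitInd]; split_ifs <;> norm_num
      have := mul_le_of_le_one_right this (Real.abs_cos_le_one (freq n / 2 * ratioArg (ρ p)))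
      gcongr
    have i1 := (abs_le.mp (hind T (hT₀.trans hT))).2
    have i2 := (abs_le.mp (hind T₀ hT₀)).2
    have j1 : 2 / Real.pi * truncSum splitInd (Real.exp T) ≤
        2 / Real.pi * (Real.log T / 2 + B) := by
      gcongr; linarith
    have j2 : (1 - 2 / Real.pi) * truncSum splitInd (Real.exp T₀) ≤
        (1 - 2 / Real.pi) * ((Real.log (49 * C₁) + 2 * Real.log (Real.log (2 * n))) / 2 + B) := by
      rw [hlogT₀] at i2
      exact mul_le_mul_of_nonneg_left (by linarith) (by linarith)
    have e1 : 2 / Real.pi * (Real.log T / 2 + B) = 1 / Real.pi * Real.log T + 2 / Real.pi * B := by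
      ring
    have e2 : (1 - 2 / Real.pi) * (Real.log (49 * C₁) / 2) ≤ 1 * Real.log (49 * C₁) :=
      mul_le_mul (by linarith) (by linarith) (by linarith) zero_le_one
    nlinarith
  · rw [← mul_sub, norm_mul, Real.norm_eq_abs, Real.norm_eq_abs]
    have hd : (0 : ℝ) ≤ 4 * ((m : ℝ) + 1) ^ 2 - 1 := by nlinarith [Nat.cast_nonneg (α := ℝ) m]
    have : |4 / Real.pi * ((-1) ^ m / (4 * ((m : ℝ) + 1) ^ 2 - 1))| = cosCoeff m := by
      rw [cosCoeff, abs_mul, abs_div, abs_div, abs_pow, abs_neg, abs_one, one_pow,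
        abs_of_pos Real.pi_pos, abs_of_nonneg hd, Nat.abs_ofNat]
    rw [this]
    exact mul_le_mul_of_nonneg_left (h n hn ρ hρ m T hT) (cosCoeff_nonneg m)

end SqrtTwo

theorem stmt14 :
    ∃ b > (0 : ℝ), ∃ C > (0 : ℝ),
      ∀ (k : ℤ), Even k → k ≠ 0 → ∀ x : ℝ, 3 ≤ x →
        Real.log |(k : ℝ)| ≤ b * Real.sqrt (Real.log x) →
        ∀ ρ : ℕ → Zrt2,
          (∀ p : ℕ, p.Prime → (p % 8 = 1 ∨ p % 8 = 7) →
            0 < toR (ρ p) ∧ 0 < toR (sigma (ρ p)) ∧ (ρ p).norm = (p : ℤ)) →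
          ∑ p ∈ Finset.filter (fun p => Nat.Prime p ∧ (p % 8 = 1 ∨ p % 8 = 7))
              (Finset.Icc 1 ⌊x⌋₊),
              |Real.cos ((Real.pi * (k : ℝ) / (4 * Real.log (1 + Real.sqrt 2))) *
                Real.log (toR (ρ p) / toR (sigma (ρ p))))| / (p : ℝ) ≤
            (1 / Real.pi) * Real.log (Real.log x) +
              (1 - 2 / Real.pi) * Real.log (Real.log |(k : ℝ)|) + C := by
  obtain ⟨C, C₁, hC, hC₁, h⟩ := SqrtTwo.exists_truncSum_abs_cos_le
  refine ⟨1 / (7 * Real.sqrt C₁), by positivity, C + 1, by positivity, ?_⟩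
  intro k hk hk0 x hx hkx ρ hρ
  obtain ⟨n, hn⟩ : ∃ n : ℕ, k.natAbs = 2 * n := by
    obtain ⟨n, hn⟩ := Int.natAbs_even.mpr hk
    exact ⟨n, by omega⟩
  have hn0 : n ≠ 0 := by omega
  have hkabs : |(k : ℝ)| = 2 * n := by
    rw [← Int.cast_abs, Int.abs_eq_natAbs, hn]
    push_cast
    rfl
  rw [hkabs] at hkx ⊢
  have hn1 : (1 : ℝ) ≤ n := by exact_mod_cast Nat.one_le_iff_ne_zero.mpr hn0
  have hx0 : 0 < x := by linarith
  have hlx : 0 ≤ Real.log x := Real.log_nonneg (by linarith)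
  have hL : 0 ≤ Real.log (2 * n) := Real.log_nonneg (by linarith)
  have hT : C₁ * (7 * Real.log (2 * n)) ^ 2 ≤ Real.log x := by
    have hs : 0 < 7 * Real.sqrt C₁ := by positivity
    rw [one_div, inv_mul_eq_div, le_div_iff₀ hs] at hkx
    calc C₁ * (7 * Real.log (2 * n)) ^ 2 = (Real.log (2 * n) * (7 * Real.sqrt C₁)) ^ 2 := by
          rw [mul_pow, mul_pow, mul_pow, Real.sq_sqrt (by linarith)]; ring
      _ ≤ Real.sqrt (Real.log x) ^ 2 := by gcongr
      _ = Real.log x := Real.sq_sqrt hlx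
  have key := h n hn0 ρ (fun p hp h8 ↦ (hρ p hp h8).2.2) (Real.log x) hT
  rw [Real.exp_log hx0] at key
  refine le_trans (le_of_eq ?_) (key.trans (by linarith))
  rw [SqrtTwo.truncSum, SqrtTwo.primesUpTo, ← Finset.filter_filter, Finset.sum_filter]
  refine Finset.sum_congr rfl fun p hp ↦ ?_
  rw [SqrtTwo.splitInd]
  split_ifs with h8
  · obtain ⟨h1, h2, -⟩ := hρ p (Finset.mem_filter.mp hp).2 h8
    rw [SqrtTwo.ratioArg, abs_of_pos h1, abs_of_pos h2, one_mul]
    congr 1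
    rcases abs_eq_abs.mp (hkabs.trans (abs_of_nonneg (show (0 : ℝ) ≤ 2 * n by positivity)).symm)
      with hk' | hk'
    · rw [hk', SqrtTwo.freq]
      congr 2
      ring
    · rw [hk', SqrtTwo.freq, ← Real.cos_neg]
      congr 2
      ring
  · simp

end
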